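/- There exists an absolute constant C > 0 such that for every positive integer n there exist δ = δ(n) > 0 and p_0 = p_0(n) such that for every prime p ≥ p_0, every positive integer N with N > p^{C/n²}, all intervals I_1, …, I_n ⊂ F_p not containing 0, each of length N, all complex coefficients α_1(x_1), …, α_n(x_n) with |α_i(x_i)| ≤ 1, and every a ∈ F_p with a ≠ 0, one has |∑_{x_1∈I_1} … ∑_{x_n∈I_n} α_1(x_1)⋯α_n(x_n) e_p(a x_1^{-1}⋯x_n^{-1})| < p^{−δ}·N^n. -/

import Mathlib

open Finset

/-- The interval `{a+1, a+2, …, a+N}` in `ZMod p`. -/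
def interval (p : ℕ) (a : ZMod p) (N : ℕ) : Finset (ZMod p) :=
  (Finset.Icc 1 N).image (fun i : ℕ => a + (i : ZMod p))

/-- `e_p(z) = exp(2πi z/p)` for `z ∈ ZMod p`. -/
noncomputable def ep (p : ℕ) (z : ZMod p) : ℂ :=
  Complex.exp (2 * (Real.pi : ℂ) * Complex.I * (z.val : ℂ) / (p : ℂ))

section DependentRandomChoice

open scoped Classical in
/-- Sampling `t` points independently from `ω` : their joint law, tested on a product event. -/
lemma sum_prod_mul_indicator {Y : Type*} [Fintype Y] (ω : Y → ℝ) (P : Y → Prop) (t : ℕ) :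
    ∑ y : Fin t → Y, (∏ i, ω (y i)) * (if ∀ i, P (y i) then 1 else 0)
      = (∑ y with P y, ω y) ^ t := by
  rw [Finset.sum_filter, Fintype.sum_pow]
  refine Finset.sum_congr rfl fun y _ => ?_
  by_cases h : ∀ i, P (y i)
  · simp [h]
  · rw [if_neg h, mul_zero]
    push Not at h
    obtain ⟨i, hi⟩ := h
    exact (Finset.prod_eq_zero (Finset.mem_univ i) (by simp [hi])).symm

open scoped Classical in
/-- Dependent random choice for a bipartite relation between two finite probability spaces. -/
theorem exists_common_neighbourhood {X Y : Type*} [Fintype X] [Fintype Y]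
    (μ : X → ℝ) (ω : Y → ℝ) (hμ : ∀ x, 0 ≤ μ x) (hω : ∀ y, 0 ≤ ω y)
    (hμ1 : ∑ x, μ x = 1) (hω1 : ∑ y, ω y = 1) (r : X → Y → Prop) {η θ : ℝ} (hη : 0 < η)
    (hθ : 0 ≤ θ) (t k : ℕ)
    (hdens : η ≤ ∑ x, μ x * ∑ y with r x y, ω y)
    (hbad : (Fintype.card X : ℝ) ^ k * θ ^ t ≤ η ^ t / 2) :
    ∃ y : Fin t → Y, (η ^ t / 2 ≤ ∑ x with ∀ i, r x (y i), μ x) ∧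
      ∀ f : Fin k → X, (∀ i j, r (f j) (y i)) → θ ≤ ∑ z with ∀ j, r (f j) z, ω z := by
  set w : (Fin t → Y) → ℝ := fun y => ∏ i, ω (y i) with hw
  have hw0 : ∀ y, 0 ≤ w y := fun y => Finset.prod_nonneg fun i _ => hω _
  have hw1 : ∑ y, w y = 1 := by
    have := sum_prod_mul_indicator ω (fun _ => True) t
    simpa [hω1] using this
  set g : (Fin t → Y) → ℝ := fun y => ∑ x with ∀ i, r x (y i), μ x with hg
  set bad : (Fin t → Y) → ℝ := fun y => ∑ f : Fin k → X,
    if (∑ z with ∀ j, r (f j) z, ω z) < θ then (if ∀ i, ∀ j, r (f j) (y i) then (1 : ℝ) else 0) else 0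
    with hbad'
  have hg1 : ∀ y, g y ≤ 1 := fun y => by
    rw [← hμ1]
    exact Finset.sum_le_sum_of_subset_of_nonneg (Finset.filter_subset _ _) fun x _ _ => hμ x
  have hgs : η ^ t ≤ ∑ y, w y * g y := by
    have h1 : ∑ y, w y * g y = ∑ x, μ x * (∑ y with r x y, ω y) ^ t := by
      simp_rw [hg, Finset.sum_filter, Finset.mul_sum]
      rw [Finset.sum_comm]
      refine Finset.sum_congr rfl fun x _ => ?_
      rw [← Finset.sum_filter, ← sum_prod_mul_indicator, Finset.mul_sum]
      refine Finset.sum_congr rfl fun y _ => ?_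
      simp only [hw]
      split_ifs <;> ring
    rw [h1]
    refine le_trans (pow_le_pow_left₀ hη.le hdens t) ?_
    exact Real.pow_arith_mean_le_arith_mean_pow _ _ _ (fun x _ => hμ x) hμ1
      (fun x _ => Finset.sum_nonneg fun y _ => hω y) t
  have hbs : ∑ y, w y * bad y ≤ η ^ t / 2 := by
    refine le_trans ?_ hbad
    have h1 : ∑ y, w y * bad y = ∑ f : Fin k → X, if (∑ z with ∀ j, r (f j) z, ω z) < θ then
        (∑ z with ∀ j, r (f j) z, ω z) ^ t else 0 := by
      simp_rw [hbad', Finset.mul_sum]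
      rw [Finset.sum_comm]
      refine Finset.sum_congr rfl fun f _ => ?_
      split_ifs with h
      · convert sum_prod_mul_indicator ω (fun z => ∀ j, r (f j) z) t
      · simp
    rw [h1]
    calc _ ≤ ∑ f : Fin k → X, θ ^ t := by
          refine Finset.sum_le_sum fun f _ => ?_
          split_ifs with h
          · exact pow_le_pow_left₀ (Finset.sum_nonneg fun y _ => hω y) h.le t
          · positivity
      _ = _ := by simp
  have hex : ∃ y, η ^ t / 2 ≤ g y - bad y := by
    by_contra! hcon
    have h1 : ∑ y, w y * (g y - bad y) < ∑ y, w y * (η ^ t / 2) := by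
      have hpos : ∃ y, 0 < w y := by
        by_contra! h
        have : ∑ y, w y ≤ 0 := Finset.sum_nonpos fun y _ => h y
        linarith
      obtain ⟨y, hy⟩ := hpos
      exact Finset.sum_lt_sum (fun z _ => mul_le_mul_of_nonneg_left (hcon z).le (hw0 z))
        ⟨y, Finset.mem_univ _, mul_lt_mul_of_pos_left (hcon y) hy⟩
    rw [← Finset.sum_mul, hw1] at h1
    simp_rw [mul_sub, Finset.sum_sub_distrib] at h1
    linarith
  obtain ⟨y, hy⟩ := hex
  have hb0 : 0 ≤ bad y := by
    refine Finset.sum_nonneg fun f _ => ?_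
    split_ifs <;> norm_num
  refine ⟨y, by change η ^ t / 2 ≤ g y; linarith, fun f hf => ?_⟩
  by_contra! hlt
  have h1 : 1 ≤ bad y := by
    refine le_trans ?_ (Finset.single_le_sum (f := fun f : Fin k → X =>
      if (∑ z with ∀ j, r (f j) z, ω z) < θ then
        (if ∀ i, ∀ j, r (f j) (y i) then (1 : ℝ) else 0) else 0) (fun f _ => by
          split_ifs <;> norm_num) (Finset.mem_univ f))
    simp only [hlt, if_true]
    rw [if_pos hf]
  have h2 : 0 < η ^ t := by positivity
  linarith [hg1 y]

end DependentRandomChoice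

section DifferenceLaw
open scoped Pointwise

variable {G : Type*} [AddCommGroup G] [Fintype G]

/-- The law of the difference of two independent variables of law `ρ`. -/
def diffLaw (ρ : G → ℝ) (z : G) : ℝ := ∑ s, ρ s * ρ (s + z)

/-- `ρ` is a probability mass function. -/
structure IsProb {X : Type*} [Fintype X] (ρ : X → ℝ) : Prop where
  nonneg : ∀ x, 0 ≤ ρ x
  sum_eq_one : ∑ x, ρ x = 1

lemma diffLaw_nonneg {ρ : G → ℝ} (h : ∀ x, 0 ≤ ρ x) (z : G) : 0 ≤ diffLaw ρ z :=
  Finset.sum_nonneg fun _ _ => mul_nonneg (h _) (h _)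

/-- Testing the law of a difference against a function. -/
lemma sum_diffLaw_mul (ρ φ : G → ℝ) :
    ∑ z, diffLaw ρ z * φ z = ∑ s, ∑ x, ρ s * ρ x * φ (x - s) := by
  simp_rw [diffLaw, Finset.sum_mul]
  rw [Finset.sum_comm]
  refine Finset.sum_congr rfl fun s _ => ?_
  exact Fintype.sum_equiv (Equiv.addLeft s) _ _ fun x => by simp

lemma IsProb.diffLaw {ρ : G → ℝ} (h : IsProb ρ) : IsProb (diffLaw ρ) := by
  refine ⟨diffLaw_nonneg h.nonneg, ?_⟩
  have := sum_diffLaw_mul ρ (fun _ => 1)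
  simp only [mul_one] at this
  rw [this, ← Finset.sum_mul_sum, h.sum_eq_one, one_mul]

lemma IsProb.iterate_diffLaw {ρ : G → ℝ} (h : IsProb ρ) (j : ℕ) : IsProb (_root_.diffLaw^[j] ρ) := by
  induction j with
  | zero => exact h
  | succ j ih => rw [Function.iterate_succ_apply']; exact ih.diffLaw

lemma diffLaw_zero (ρ : G → ℝ) : diffLaw ρ 0 = ∑ x, ρ x ^ 2 := by
  simp [diffLaw, sq]

lemma diffLaw_le_sum_sq (ρ : G → ℝ) (z : G) : diffLaw ρ z ≤ ∑ x, ρ x ^ 2 := by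
  have h1 : ∑ s, ρ (s + z) ^ 2 = ∑ s, ρ s ^ 2 :=
    Fintype.sum_equiv (Equiv.addRight z) _ _ fun x => by simp
  have h2 : diffLaw ρ z ≤ ∑ s, (ρ s ^ 2 + ρ (s + z) ^ 2) / 2 :=
    Finset.sum_le_sum fun s _ => by nlinarith [sq_nonneg (ρ s - ρ (s + z))]
  rw [← Finset.sum_div, Finset.sum_add_distrib, h1] at h2
  linarith

lemma IsProb.sum_sq_le {X : Type*} [Fintype X] {ρ : X → ℝ} (h : IsProb ρ) {S : ℝ}
    (hS : ∀ x, ρ x ≤ S) : ∑ x, ρ x ^ 2 ≤ S := by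
  calc ∑ x, ρ x ^ 2 ≤ ∑ x, S * ρ x := Finset.sum_le_sum fun x _ => by
        rw [sq]; exact mul_le_mul_of_nonneg_right (hS x) (h.nonneg x)
    _ = S := by rw [← Finset.mul_sum, h.sum_eq_one, mul_one]

lemma IsProb.diffLaw_le {ρ : G → ℝ} (h : IsProb ρ) {S : ℝ} (hS : ∀ x, ρ x ≤ S) (z : G) :
    _root_.diffLaw ρ z ≤ S :=
  (diffLaw_le_sum_sq ρ z).trans (h.sum_sq_le hS)

lemma IsProb.iterate_diffLaw_le {ρ : G → ℝ} (h : IsProb ρ) {S : ℝ} (hS : ∀ x, ρ x ≤ S) (j : ℕ)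
    (z : G) : _root_.diffLaw^[j] ρ z ≤ S := by
  induction j generalizing z with
  | zero => exact hS z
  | succ j ih => rw [Function.iterate_succ_apply']; exact (h.iterate_diffLaw j).diffLaw_le ih z

lemma IsProb.sum_sq_diffLaw_le {ρ : G → ℝ} (h : IsProb ρ) :
    ∑ x, _root_.diffLaw ρ x ^ 2 ≤ ∑ x, ρ x ^ 2 :=
  h.diffLaw.sum_sq_le (diffLaw_le_sum_sq ρ)

lemma IsProb.sum_sq_iterate_antitone {ρ : G → ℝ} (h : IsProb ρ) :
    Antitone fun j => ∑ x, _root_.diffLaw^[j] ρ x ^ 2 := by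
  refine antitone_nat_of_succ_le fun j => ?_
  simp only [Function.iterate_succ_apply']
  exact (h.iterate_diffLaw j).sum_sq_diffLaw_le

/-- A set charged by the law of iterated differences has a translate charged by the law itself. -/
lemma IsProb.exists_translate {ρ : G → ℝ} (h : IsProb ρ) (H : Finset G) {η : ℝ} (j : ℕ) (z₀ : G)
    (hη : η ≤ ∑ x ∈ H, _root_.diffLaw^[j] ρ (z₀ + x)) : ∃ z, η ≤ ∑ x ∈ H, ρ (z + x) := by
  induction j generalizing z₀ with
  | zero => exact ⟨z₀, hη⟩
  | succ i ih =>
    have hi := h.iterate_diffLaw i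
    by_contra! hcon
    have this : ∀ z, ∑ x ∈ H, _root_.diffLaw^[i] ρ (z + x) < η := by
      intro z
      by_contra! hh
      obtain ⟨z', hz'⟩ := ih z hh
      exact absurd hz' (not_le.2 (hcon z'))
    rw [Function.iterate_succ_apply'] at hη
    simp_rw [_root_.diffLaw] at hη
    rw [Finset.sum_comm] at hη
    simp_rw [← Finset.mul_sum, ← add_assoc] at hη
    have hlt : ∑ s, _root_.diffLaw^[i] ρ s * ∑ x ∈ H, _root_.diffLaw^[i] ρ (s + z₀ + x)
        < ∑ s, _root_.diffLaw^[i] ρ s * η := by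
      have hpos : ∃ y, 0 < _root_.diffLaw^[i] ρ y := by
        by_contra! h'
        have : ∑ y, _root_.diffLaw^[i] ρ y ≤ 0 := Finset.sum_nonpos fun y _ => h' y
        linarith [hi.sum_eq_one]
      obtain ⟨y, hy⟩ := hpos
      exact Finset.sum_lt_sum
        (fun z _ => mul_le_mul_of_nonneg_left (this _).le (hi.nonneg z))
        ⟨y, Finset.mem_univ _, mul_lt_mul_of_pos_left (this _) hy⟩
    rw [← Finset.sum_mul, hi.sum_eq_one] at hlt
    linarith

/-- The triple correlation of a difference law is bounded below by its energy. -/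
lemma sq_energy_le (ρ : G → ℝ) :
    (∑ x, diffLaw ρ x ^ 2) ^ 2 ≤
      (∑ x, ρ x ^ 2) * ∑ x, ∑ y, diffLaw ρ x * diffLaw ρ y * diffLaw ρ (y - x) := by
  set f := diffLaw ρ with hf
  have h1 : ∑ x, f x ^ 2 = ∑ u, ρ u * ∑ x, f x * ρ (u + x) := by
    simp_rw [Finset.mul_sum]
    rw [Finset.sum_comm]
    refine Finset.sum_congr rfl fun x _ => ?_
    conv_lhs => rw [sq, hf, diffLaw, Finset.sum_mul]
    exact Finset.sum_congr rfl fun u _ => by rw [hf, diffLaw]; ring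
  have h2 : ∑ u, (∑ x, f x * ρ (u + x)) ^ 2 = ∑ x, ∑ y, f x * f y * f (y - x) := by
    simp_rw [sq, Finset.sum_mul_sum]
    rw [Finset.sum_comm]
    refine Finset.sum_congr rfl fun x _ => ?_
    rw [Finset.sum_comm]
    refine Finset.sum_congr rfl fun y _ => ?_
    have : f (y - x) = ∑ u, ρ (u + x) * ρ (u + y) := by
      rw [hf, diffLaw]
      exact (Fintype.sum_equiv (Equiv.addRight x) _ _ fun u => by simp [add_assoc]).symm
    rw [this, Finset.mul_sum]
    exact Finset.sum_congr rfl fun u _ => by ring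
  rw [h1, ← h2]
  exact Finset.sum_mul_sq_le_sq_mul_sq _ _ _

open scoped Classical in
/-- If taking differences hardly decreases the energy of `ρ`, the law of differences charges a set
with small difference set. -/
theorem IsProb.exists_small_doubling {ρ : G → ℝ} (h : IsProb ρ) {κ θ : ℝ} (hκ : 0 < κ)
    (hθ : 0 < θ) (t : ℕ)
    (hM : ∑ x, ρ x ^ 2 ≤ κ * ∑ x, _root_.diffLaw ρ x ^ 2)
    (ht : (Fintype.card G : ℝ) ^ 2 * θ ^ t ≤ (1 / (2 * κ ^ 2)) ^ t / 2) :
    ∃ H : Finset G, (1 / (2 * κ ^ 2)) ^ t / 2 ≤ ∑ x ∈ H, _root_.diffLaw ρ x ∧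
      (#(H - H) : ℝ) * (θ * ∑ x, ρ x ^ 2) ≤ 4 * κ ^ 4 := by
  set M := ∑ x, ρ x ^ 2 with hMdef
  set f := _root_.diffLaw ρ with hf
  have hfp : IsProb f := h.diffLaw
  have hM0 : 0 < M := by
    have : 0 ≤ M := Finset.sum_nonneg fun x _ => sq_nonneg _
    rcases this.eq_or_lt with h0 | h0
    · exfalso
      have hz : ∀ x, ρ x = 0 := fun x => by
        have := (Finset.sum_eq_zero_iff_of_nonneg (fun x _ => sq_nonneg (ρ x))).1
          (hMdef ▸ h0.symm) x (Finset.mem_univ x)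
        simpa using this
      have := h.sum_eq_one
      simp [hz] at this
    · exact h0
  have hfM : ∀ x, f x ≤ M := diffLaw_le_sum_sq ρ
  set η := 1 / (2 * κ ^ 2) with hη
  have hη0 : 0 < η := by positivity
  have hdens : η ≤ ∑ x, f x * ∑ y with η * M ≤ f (y - x), f y := by
    have h1 : M / κ ^ 2 ≤ ∑ x, ∑ y, f x * f y * f (y - x) := by
      have h2 := sq_energy_le ρ
      have h3 : (M / κ) ^ 2 ≤ (∑ x, f x ^ 2) ^ 2 :=
        pow_le_pow_left₀ (by positivity) ((div_le_iff₀ hκ).2 (by linarith)) 2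
      have h4 := h3.trans h2
      rw [← hMdef] at h4
      refine le_of_mul_le_mul_left ?_ hM0
      calc M * (M / κ ^ 2) = (M / κ) ^ 2 := by ring
        _ ≤ _ := h4
    have h2 : ∑ x, ∑ y, f x * f y * f (y - x) ≤
        M * (∑ x, f x * ∑ y with η * M ≤ f (y - x), f y) + η * M := by
      have h3 : ∀ x y, f x * f y * f (y - x) ≤
          M * (f x * (if η * M ≤ f (y - x) then f y else 0)) + η * M * (f x * f y) := by
        intro x y
        have hx := hfp.nonneg x
        have hy := hfp.nonneg y
        have hxy := mul_nonneg hx hy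
        split_ifs with hh
        · have := mul_le_mul_of_nonneg_left (hfM (y - x)) hxy
          have h4 : 0 ≤ η * M * (f x * f y) := by positivity
          linarith
        · push Not at hh
          have := mul_le_mul_of_nonneg_left hh.le hxy
          linarith
      calc _ ≤ ∑ x, ∑ y, (M * (f x * (if η * M ≤ f (y - x) then f y else 0))
            + η * M * (f x * f y)) :=
            Finset.sum_le_sum fun x _ => Finset.sum_le_sum fun y _ => h3 x y
        _ = _ := by
          simp_rw [Finset.sum_add_distrib, ← Finset.mul_sum, hfp.sum_eq_one, Finset.sum_filter]
          simp_rw [mul_one, hfp.sum_eq_one]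
          rw [mul_one]
    have h3 : M / κ ^ 2 = 2 * (η * M) := by rw [hη]; field_simp
    rw [h3] at h1
    have h4 : M * η ≤ M * (∑ x, f x * ∑ y with η * M ≤ f (y - x), f y) := by linarith
    exact le_of_mul_le_mul_left h4 hM0
  obtain ⟨y, hy1, hy2⟩ := exists_common_neighbourhood f f hfp.nonneg hfp.nonneg hfp.sum_eq_one
    hfp.sum_eq_one (fun x y => η * M ≤ f (y - x)) hη0 hθ.le t 2 hdens ht
  set H : Finset G := Finset.univ.filter fun x => ∀ i, η * M ≤ f (y i - x) with hH
  refine ⟨H, hy1, ?_⟩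
  set P : Finset G := Finset.univ.filter fun z => η * M ≤ f z with hP
  have hPc : (#P : ℝ) * (η * M) ≤ 1 := by
    rw [← hfp.sum_eq_one, ← nsmul_eq_mul]
    exact (Finset.card_nsmul_le_sum P f _ fun x hx => (Finset.mem_filter.1 hx).2).trans
      (Finset.sum_le_sum_of_subset_of_nonneg (Finset.subset_univ _) fun x _ _ => hfp.nonneg x)
  have hrep : ∀ d ∈ H - H, θ ≤ M * #((P ×ˢ P).filter fun q => q.1 - q.2 = d) := by
    intro d hd
    obtain ⟨a, ha, a', ha', rfl⟩ := Finset.mem_sub.1 hd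
    have := hy2 ![a, a'] (fun i j => by
      fin_cases j
      · exact (Finset.mem_filter.1 ha).2 i
      · exact (Finset.mem_filter.1 ha').2 i)
    refine this.trans ((Finset.sum_le_card_nsmul _ _ M fun x _ => hfM x).trans ?_)
    rw [nsmul_eq_mul, mul_comm]
    refine mul_le_mul_of_nonneg_left ?_ hM0.le
    norm_cast
    refine Finset.card_le_card_of_injOn (fun z => (z - a', z - a)) ?_ ?_
    · intro z hz
      have hz' := (Finset.mem_filter.1 hz).2
      simp only [Finset.coe_filter, Finset.mem_product, Set.mem_ofPred_eq, hP, Finset.mem_filter,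
        Finset.mem_univ, true_and]
      exact ⟨⟨hz' 1, hz' 0⟩, by abel⟩
    · intro z _ z' _ hzz
      simpa using congrArg Prod.fst hzz
  have hcount : (#(H - H) : ℝ) * θ ≤ M * (#P : ℝ) ^ 2 := by
    have h1 : ∑ d ∈ H - H, #((P ×ˢ P).filter fun q => q.1 - q.2 = d) ≤ #(P ×ˢ P) := by
      rw [← Finset.card_biUnion]
      · exact Finset.card_le_card (Finset.biUnion_subset.2 fun d _ => Finset.filter_subset _ _)
      · intro d _ d' _ hne
        refine Finset.disjoint_left.2 fun q hq hq' => hne ?_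
        rw [← (Finset.mem_filter.1 hq).2, (Finset.mem_filter.1 hq').2]
    rw [Finset.card_product] at h1
    calc (#(H - H) : ℝ) * θ = ∑ d ∈ H - H, θ := by simp
      _ ≤ ∑ d ∈ H - H, M * (#((P ×ˢ P).filter fun q => q.1 - q.2 = d) : ℝ) :=
          Finset.sum_le_sum hrep
      _ = M * ((∑ d ∈ H - H, #((P ×ˢ P).filter fun q => q.1 - q.2 = d) : ℕ) : ℝ) := by
          push_cast; rw [Finset.mul_sum]
      _ ≤ M * (#P : ℝ) ^ 2 := by
          refine mul_le_mul_of_nonneg_left ?_ hM0.le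
          calc _ ≤ ((#P * #P : ℕ) : ℝ) := by exact_mod_cast h1
            _ = _ := by push_cast; ring
  have h5 : ((#P : ℝ) * (η * M)) ^ 2 ≤ 1 := pow_le_one₀ (by positivity) hPc
  have h6 : ((#P : ℝ) * M) ^ 2 ≤ 4 * κ ^ 4 := by
    have : ((#P : ℝ) * M) ^ 2 = ((#P : ℝ) * (η * M)) ^ 2 * (4 * κ ^ 4) := by
      rw [hη]; field_simp; ring
    rw [this]
    exact mul_le_of_le_one_left (by positivity) h5
  calc (#(H - H) : ℝ) * (θ * M) = (#(H - H) : ℝ) * θ * M := by ring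
    _ ≤ M * (#P : ℝ) ^ 2 * M := mul_le_mul_of_nonneg_right hcount hM0.le
    _ = ((#P : ℝ) * M) ^ 2 := by ring
    _ ≤ _ := h6

end DifferenceLaw

section Pivot
open scoped Pointwise

/-- A nonempty subset of `ZMod p` stable under a nonzero translation is everything. -/
lemma exists_mem_add_notMem {p : ℕ} [Fact p.Prime] {R : Finset (ZMod p)} (hR : R.Nonempty)
    (hlt : #R < p) {s : ZMod p} (hs : s ≠ 0) : ∃ r ∈ R, r + s ∉ R := by
  by_contra! h
  obtain ⟨r, hr⟩ := hR
  have h1 : ∀ n : ℕ, r + n * s ∈ R := by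
    intro n
    induction n with
    | zero => simpa using hr
    | succ n ih =>
      have := h _ ih
      push_cast
      rwa [add_mul, one_mul, ← add_assoc]
  have h2 : R = Finset.univ := by
    refine Finset.eq_univ_of_forall fun x => ?_
    have := h1 (((x - r) / s).val)
    rw [ZMod.natCast_zmod_val, div_mul_cancel₀ _ hs] at this
    simpa using this
  rw [h2, Finset.card_univ, ZMod.card] at hlt
  exact lt_irrefl _ hlt

open scoped Classical in
/-- The pivot argument: two sets whose products mostly lie in an additively structured set `A`
cannot both be large. -/
theorem card_mul_card_le_of_mul_mem {p : ℕ} [Fact p.Prime] (A B Q : Finset (ZMod p))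
    {b₀ q₀ : ZMod p} (hb₀ : b₀ ≠ 0) (hq₀ : q₀ ≠ 0) (hB : B.Nonempty)
    (hb : ∀ q ∈ Q, b₀ * q ∈ A) (hq : ∀ b ∈ B, b * q₀ ∈ A) {m₁ m₂ : ℝ} (hm₁ : 0 ≤ m₁)
    (h1 : ∀ v : Fin 6 → ZMod p, (∀ i, v i ∈ B) → m₁ ≤ #(Q.filter fun q => ∀ i, v i * q ∈ A))
    (h2 : ∀ q₁ ∈ Q, ∀ q₂ ∈ Q, m₂ ≤ #(B.filter fun w => w * q₁ ∈ A ∧ w * q₂ ∈ A))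
    (hR : #(A - A) * #Q ^ 2 < p) :
    m₁ * #B ≤ #(A - A) ∨ m₂ * m₁ * #B ≤ #(A - A) * #(4 • A - 4 • A) := by
  have hBc : (0 : ℝ) < #B := by exact_mod_cast hB.card_pos
  set B₀ := B.image (· * q₀) with hB₀
  have hinj : Function.Injective (· * q₀) := mul_left_injective₀ hq₀
  have hB₀c : #B₀ = #B := Finset.card_image_of_injective _ hinj
  have hB₀A : B₀ ⊆ A := Finset.image_subset_iff.2 hq
  have hBB : #(B - B) ≤ #(A - A) := by
    rw [← Finset.card_image_of_injective (B - B) hinj]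
    refine Finset.card_le_card (Finset.image_subset_iff.2 fun d hd => ?_)
    obtain ⟨b, hb, b', hb', rfl⟩ := Finset.mem_sub.1 hd
    rw [sub_mul]
    exact Finset.sub_mem_sub (hq b hb) (hq b' hb')
  obtain ⟨T, -, hTc, hT⟩ := Finset.ruzsa_covering_add (A := A) (B := -B₀)
    (K := #(A - A) / #B) (by
      rw [Finset.neg_nonempty_iff]; exact hB.image _) (by
      rw [Finset.card_neg, hB₀c, div_mul_cancel₀ _ hBc.ne', ← sub_eq_add_neg]
      exact_mod_cast Finset.card_le_card (Finset.sub_subset_sub_left hB₀A))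
  rw [le_div_iff₀ hBc] at hTc
  have hlab : ∀ q ∈ Q, ∃ l x y, l ∈ T ∧ x ∈ B ∧ y ∈ B ∧ b₀ * q = l + (y - x) * q₀ := by
    intro q hqQ
    obtain ⟨l, hl, d, hd, hld⟩ := Finset.mem_add.1 (hT (hb q hqQ))
    obtain ⟨x', hx', y', hy', rfl⟩ := Finset.mem_sub.1 hd
    obtain ⟨x, hx, hxe⟩ := Finset.mem_image.1 (Finset.mem_neg'.1 hx')
    obtain ⟨y, hy, hye⟩ := Finset.mem_image.1 (Finset.mem_neg'.1 hy')
    refine ⟨l, x, y, hl, hx, hy, ?_⟩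
    rw [← hld, sub_mul, hxe, hye]
    ring
  choose! l x y hl hx hy hlq using hlab
  by_cases hmT : m₁ ≤ #T
  · left
    exact (mul_le_mul_of_nonneg_right hmT hBc.le).trans hTc
  right
  push Not at hmT
  obtain ⟨β, hβ⟩ := hB
  have hQT : #T < #Q := by
    have h3 := h1 (fun _ => β) (fun _ => hβ)
    have h4 : ((#(Q.filter fun q => ∀ _ : Fin 6, β * q ∈ A) : ℕ) : ℝ) ≤ #Q := by
      exact_mod_cast Finset.card_filter_le _ _
    exact_mod_cast hmT.trans_le (h3.trans h4)
  obtain ⟨q₁, hq₁, q₂, hq₂, hne, hll⟩ :=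
    Finset.exists_ne_map_eq_of_card_lt_of_maps_to hQT (f := l) (fun q hq => hl q hq)
  set R : Finset (ZMod p) := ((B - B) ×ˢ ((Q ×ˢ Q).filter fun q => q.1 ≠ q.2 ∧ l q.1 = l q.2)).image
    (fun d => d.1 / (d.2.1 - d.2.2)) with hRdef
  have hRc : #R < p := by
    refine lt_of_le_of_lt ?_ hR
    refine Finset.card_image_le.trans ?_
    rw [Finset.card_product, sq]
    refine Nat.mul_le_mul hBB ((Finset.card_filter_le _ _).trans ?_)
    rw [Finset.card_product]
  have hRmem : ∀ b ∈ B, ∀ b' ∈ B, ∀ q ∈ Q, ∀ q' ∈ Q, q ≠ q' → l q = l q' →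
      (b - b') / (q - q') ∈ R := fun b hb b' hb' q hq q' hq' hn hl =>
    Finset.mem_image.2 ⟨(b - b', q, q'), by
      simp only [Finset.mem_product, Finset.mem_filter]
      exact ⟨Finset.sub_mem_sub hb hb', ⟨hq, hq'⟩, hn, hl⟩, rfl⟩
  obtain ⟨r, hr, hrs⟩ := exists_mem_add_notMem ⟨_, hRmem β hβ β hβ q₁ hq₁ q₂ hq₂ hne hll⟩ hRc
    (div_ne_zero hb₀ hq₀)
  clear hne hll hq₁ hq₂ q₁ q₂
  obtain ⟨⟨d, q₁, q₂⟩, hd, rfl⟩ := Finset.mem_image.1 hr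
  simp only [Finset.mem_product, Finset.mem_filter] at hd
  obtain ⟨hd, ⟨hq₁, hq₂⟩, hne, hll⟩ := hd
  obtain ⟨b, hbB, b', hbB', rfl⟩ := Finset.mem_sub.1 hd
  have hsub : q₁ - q₂ ≠ 0 := sub_ne_zero.2 hne
  set V := b + y q₁ + x q₂ - (b' + x q₁ + y q₂) with hV
  have hVu : V = ((b - b') / (q₁ - q₂) + b₀ / q₀) * (q₁ - q₂) := by
    have e1 := hlq q₁ hq₁
    have e2 := hlq q₂ hq₂
    have e3 : b₀ * (q₁ - q₂) = (y q₁ - x q₁ - (y q₂ - x q₂)) * q₀ := by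
      rw [mul_sub, e1, e2, hll]; ring
    rw [add_mul, div_mul_cancel₀ _ hsub, div_mul_eq_mul_div, e3, mul_div_cancel_right₀ _ hq₀, hV]
    ring
  have hS := h1 ![b, y q₁, x q₂, b', x q₁, y q₂] (by
    intro i
    fin_cases i
    exacts [hbB, hy _ hq₁, hx _ hq₂, hbB', hx _ hq₁, hy _ hq₂])
  set S := Q.filter fun q => ∀ i, (![b, y q₁, x q₂, b', x q₁, y q₂] : Fin 6 → ZMod p) i * q ∈ A
    with hSdef
  have hT0 : T.Nonempty := ⟨_, hl q₁ hq₁⟩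
  have hTpos : (0 : ℝ) < #T := by exact_mod_cast hT0.card_pos
  obtain ⟨l₀, -, hl₀⟩ := Finset.exists_le_card_fiber_of_nsmul_le_card_of_maps_to (s := S) (t := T)
    (f := l) (b := (#S : ℝ) / #T) (fun q hq => hl q (Finset.mem_filter.1 hq).1) hT0
    (by rw [nsmul_eq_mul, mul_div_cancel₀ _ hTpos.ne'])
  set X := S.filter fun q => l q = l₀ with hX
  set W := B.filter fun w => w * q₁ ∈ A ∧ w * q₂ ∈ A with hW
  have hWc := h2 q₁ hq₁ q₂ hq₂
  have hprod : #W * #X ≤ #(4 • A - 4 • A) := by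
    rw [← Finset.card_product]
    refine Finset.card_le_card_of_injOn
      (fun z => (z.1 * q₁ + b * z.2 + y q₁ * z.2 + x q₂ * z.2) -
        (z.1 * q₂ + b' * z.2 + x q₁ * z.2 + y q₂ * z.2)) ?_ ?_
    · rintro ⟨w, q⟩ hz
      simp only [Finset.coe_product, Set.mem_prod, Finset.mem_coe, hW, hX, Finset.mem_filter,
        hSdef] at hz
      obtain ⟨⟨-, hw1, hw2⟩, ⟨-, hqA⟩, -⟩ := hz
      have h4 : 4 • A = A + A + A + A := by simp only [succ_nsmul, zero_nsmul, zero_add]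
      rw [h4]
      exact Finset.sub_mem_sub
        (Finset.add_mem_add (Finset.add_mem_add (Finset.add_mem_add hw1 (hqA 0)) (hqA 1)) (hqA 2))
        (Finset.add_mem_add (Finset.add_mem_add (Finset.add_mem_add hw2 (hqA 3)) (hqA 4)) (hqA 5))
    · rintro ⟨w, q⟩ hz ⟨w', q'⟩ hz' heq
      simp only [Finset.coe_product, Set.mem_prod, Finset.mem_coe, hW, hX, Finset.mem_filter,
        hSdef] at hz hz'
      simp only at heq
      have e1 : (w - w') * (q₁ - q₂) = V * (q' - q) := by rw [hV]; linear_combination heq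
      rw [hVu] at e1
      have e2 : w - w' = ((b - b') / (q₁ - q₂) + b₀ / q₀) * (q' - q) :=
        mul_right_cancel₀ hsub (by rw [e1]; ring)
      by_cases hqq : q = q'
      · subst hqq
        rw [sub_self, mul_zero, sub_eq_zero] at e2
        rw [e2]
      · exfalso
        apply hrs
        have hs' : q' - q ≠ 0 := sub_ne_zero.2 (Ne.symm hqq)
        rw [← mul_div_cancel_right₀ ((b - b') / (q₁ - q₂) + b₀ / q₀) hs', ← e2]
        exact hRmem w hz.1.1 w' hz'.1.1 q' hz'.2.1.1 q hz.2.1.1 (Ne.symm hqq)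
          (by rw [hz.2.2, hz'.2.2])
  have hX2 : m₁ / #T ≤ #X := le_trans (by gcongr) hl₀
  have h5 : m₂ * (m₁ / #T) ≤ #(4 • A - 4 • A) := by
    calc m₂ * (m₁ / #T) ≤ (#W : ℝ) * #X := by gcongr
      _ ≤ _ := by exact_mod_cast hprod
  calc m₂ * m₁ * #B = m₂ * (m₁ / #T) * (#T * #B) := by field_simp
    _ ≤ #(4 • A - 4 • A) * #(A - A) := by gcongr
    _ = _ := mul_comm _ _

end Pivot

section ProductCore
open scoped Pointwise
open scoped Classical in
/-- The uniform probability on a finite set. -/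
noncomputable def unifOn {X : Type*} (Q : Finset X) (x : X) : ℝ := if x ∈ Q then (#Q : ℝ)⁻¹ else 0

open scoped Classical in
lemma sum_unifOn {X : Type*} [Fintype X] (Q : Finset X) (P : X → Prop) [DecidablePred P] :
    ∑ x with P x, unifOn Q x = #(Q.filter P) * (#Q : ℝ)⁻¹ := by
  simp only [unifOn]
  rw [← Finset.sum_filter, Finset.sum_const, nsmul_eq_mul, Finset.filter_filter]
  congr 3
  ext x
  simp [and_comm]

lemma isProb_unifOn {X : Type*} [Fintype X] {Q : Finset X} (hQ : Q.Nonempty) :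
    IsProb (unifOn Q) := by
  classical
  refine ⟨fun x => by unfold unifOn; positivity, ?_⟩
  have := sum_unifOn Q (fun _ => True)
  simp only [Finset.filter_true] at this
  rw [this, mul_inv_cancel₀]
  exact_mod_cast hQ.card_pos.ne'

open scoped Classical in
/-- A spread-out law `ν` and a large set `Q` cannot have most products in a set of small
doubling whose size matches the spread of `ν`. -/
theorem false_of_mul_mem_small_doubling {p : ℕ} [Fact p.Prime] (A Q : Finset (ZMod p))
    {ν : ZMod p → ℝ} (hν : IsProb ν) (hQ0 : 0 ∉ Q) {τ M η : ℝ} (hτ : 2 ≤ τ) (hM : 0 < M)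
    (hη : 0 < η) (W : ℕ) (hp : (p : ℝ) ≤ τ ^ W)
    (hητ : 1 ≤ τ * (η ^ (W * (6 + (2 * W + 1)) + 2) / 2))
    (hdens : η ≤ ∑ b, ν b * (#(Q.filter fun q => b ≠ 0 ∧ b * q ∈ A) * (#Q : ℝ)⁻¹))
    (hAM : #(A - A) * M ≤ τ) (hAA : (#(A - A) : ℝ) ≤ τ * #A) (hνM : ∑ x, ν x ^ 2 ≤ τ ^ 200 * M)
    (hQp : #(A - A) * #Q ^ 2 < p) (hQτ : τ ^ 420 ≤ #Q) : False := by
  have hτ0 : 0 < τ := by linarith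
  have hQpos : (0 : ℝ) < #Q := lt_of_lt_of_le (by positivity) hQτ
  have hQne : Q.Nonempty := Finset.card_pos.1 (by exact_mod_cast hQpos)
  set t₂ := 2 * W + 1 with ht₂
  set t₁ := W * (6 + t₂) + 2 with ht₁
  have hητ' : τ⁻¹ ≤ η ^ t₁ / 2 := by
    rw [inv_le_iff_one_le_mul₀ hτ0, mul_comm]; linarith
  have hunif := isProb_unifOn hQne
  obtain ⟨y₁, hy₁, hg₁⟩ := exists_common_neighbourhood ν (unifOn Q) hν.nonneg hunif.nonneg
    hν.sum_eq_one hunif.sum_eq_one (fun b q => q ∈ Q ∧ b ≠ 0 ∧ b * q ∈ A) hη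
    (θ := τ⁻¹) (by positivity) t₁ (6 + t₂) (by
      refine hdens.trans_eq (Finset.sum_congr rfl fun b _ => ?_)
      rw [sum_unifOn]
      congr 3
      refine congrArg _ (Finset.ext fun q => ?_)
      simp only [Finset.mem_filter]; tauto) (by
      refine le_trans ?_ hητ'
      rw [ZMod.card, inv_pow]
      calc (p : ℝ) ^ (6 + t₂) * (τ ^ t₁)⁻¹ ≤ (τ ^ W) ^ (6 + t₂) * (τ ^ t₁)⁻¹ := by gcongr
        _ = τ⁻¹ * τ⁻¹ := by
          rw [← pow_mul, ht₁, pow_add]; field_simp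
        _ ≤ τ⁻¹ * 1 := by
          gcongr
          exact inv_le_one_of_one_le₀ (by linarith)
        _ = τ⁻¹ := mul_one _)
  set B := Finset.univ.filter fun b => ∀ i, y₁ i ∈ Q ∧ b ≠ 0 ∧ b * y₁ i ∈ A with hB
  have hνB : τ⁻¹ ≤ ∑ x ∈ B, ν x := by
    refine hητ'.trans (hy₁.trans_eq ?_)
    rw [hB]
    congr!
  have hBne : B.Nonempty := by
    by_contra h
    rw [Finset.not_nonempty_iff_eq_empty] at h
    rw [h, Finset.sum_empty] at hνB
    have : 0 < τ⁻¹ := by positivity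
    linarith
  have hBpos : (0 : ℝ) < #B := by exact_mod_cast hBne.card_pos
  have hBM : 1 ≤ τ ^ 202 * (#B * M) := by
    have h1 := Finset.sum_mul_sq_le_sq_mul_sq B (fun _ => (1 : ℝ)) ν
    simp only [one_mul, one_pow, Finset.sum_const, nsmul_eq_mul, mul_one] at h1
    have h2 : (τ⁻¹) ^ 2 ≤ (∑ x ∈ B, ν x) ^ 2 := by gcongr
    have h3 : ∑ x ∈ B, ν x ^ 2 ≤ τ ^ 200 * M :=
      (Finset.sum_le_sum_of_subset_of_nonneg (Finset.subset_univ _)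
        fun x _ _ => sq_nonneg _).trans hνM
    have h4 : (τ⁻¹) ^ 2 ≤ #B * (τ ^ 200 * M) := h2.trans (h1.trans (by gcongr))
    calc (1 : ℝ) = τ ^ 2 * (τ⁻¹) ^ 2 := by field_simp
      _ ≤ τ ^ 2 * (#B * (τ ^ 200 * M)) := by gcongr
      _ = _ := by ring
  have hdeg : ∀ v : Fin (6 + t₂) → ZMod p, (∀ j, v j ∈ B) →
      τ⁻¹ * #Q ≤ #(Q.filter fun q => ∀ j, v j ≠ 0 ∧ v j * q ∈ A) := by
    intro v hv
    have := hg₁ v fun i j => (Finset.mem_filter.1 (hv j)).2 i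
    rw [sum_unifOn, ← div_eq_mul_inv, le_div_iff₀ hQpos] at this
    refine this.trans ?_
    norm_cast
    refine Finset.card_le_card fun q hq => ?_
    simp only [Finset.mem_filter] at hq ⊢
    exact ⟨hq.1, fun j => (hq.2 j).2⟩
  have hunB := isProb_unifOn hBne
  obtain ⟨y₂, hy₂, hg₂⟩ := exists_common_neighbourhood (unifOn Q) (unifOn B) hunif.nonneg
    hunB.nonneg hunif.sum_eq_one hunB.sum_eq_one
    (fun q b => q ∈ Q ∧ b ∈ B ∧ b ≠ 0 ∧ b * q ∈ A) (η := τ⁻¹) (by positivity)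
    (θ := (τ ^ 2)⁻¹) (by positivity) t₂ 2 (by
      have h1 : ∑ q, unifOn Q q * ∑ b with q ∈ Q ∧ b ∈ B ∧ b ≠ 0 ∧ b * q ∈ A, unifOn B b =
          ∑ b, unifOn B b * ∑ q with q ∈ Q ∧ b ∈ B ∧ b ≠ 0 ∧ b * q ∈ A, unifOn Q q := by
        simp_rw [Finset.sum_filter, Finset.mul_sum]
        rw [Finset.sum_comm]
        refine Finset.sum_congr rfl fun b _ => Finset.sum_congr rfl fun q _ => ?_
        split_ifs <;> ring
      refine le_trans ?_ (h1.symm.le.trans_eq (by congr!))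
      have h2 : ∑ b, unifOn B b * τ⁻¹ = τ⁻¹ := by
        rw [← Finset.sum_mul, hunB.sum_eq_one, one_mul]
      rw [← h2]
      refine Finset.sum_le_sum fun b _ => ?_
      by_cases hb : b ∈ B
      · refine mul_le_mul_of_nonneg_left ?_ (hunB.nonneg _)
        rw [sum_unifOn, ← div_eq_mul_inv, le_div_iff₀ hQpos]
        refine (hdeg (fun _ => b) fun _ => hb).trans ?_
        norm_cast
        refine Finset.card_le_card fun q hq => ?_
        simp only [Finset.mem_filter] at hq ⊢
        exact ⟨hq.1, hq.1, hb, hq.2 0⟩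
      · simp [unifOn, hb]) (by
      rw [ZMod.card, inv_pow, inv_pow]
      calc (p : ℝ) ^ 2 * ((τ ^ 2) ^ t₂)⁻¹ ≤ (τ ^ W) ^ 2 * ((τ ^ 2) ^ t₂)⁻¹ := by gcongr
        _ = (τ ^ t₂)⁻¹ / τ := by
          rw [← pow_mul, ← pow_mul, ht₂]; field_simp; ring
        _ ≤ _ := by gcongr)
  set Q' := Finset.univ.filter fun q => ∀ i, q ∈ Q ∧ y₂ i ∈ B ∧ y₂ i ≠ 0 ∧ y₂ i * q ∈ A with hQ'
  have hQ'ne : Q'.Nonempty := by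
    by_contra h
    rw [Finset.not_nonempty_iff_eq_empty] at h
    have hy₂' : (τ⁻¹) ^ t₂ / 2 ≤ ∑ x ∈ Q', unifOn Q x := by
      refine hy₂.trans_eq ?_
      rw [hQ']
      congr!
    rw [h, Finset.sum_empty] at hy₂'
    have : 0 < (τ⁻¹) ^ t₂ / 2 := by positivity
    linarith
  have hQ'Q : Q' ⊆ Q := fun q hq => ((Finset.mem_filter.1 hq).2 0).1
  obtain ⟨b₁, hb₁⟩ := hBne
  obtain ⟨q₁, hq₁⟩ := hQ'ne
  have hy₂B : ∀ i, y₂ i ∈ B := fun i => ((Finset.mem_filter.1 hq₁).2 i).2.1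
  have hy₁Q : y₁ 0 ∈ Q := ((Finset.mem_filter.1 hb₁).2 0).1
  have hAc : (#A : ℝ) ≤ #(A - A) := by
    have hAne : A.Nonempty := ⟨_, ((Finset.mem_filter.1 hb₁).2 0).2.2⟩
    exact_mod_cast Finset.card_le_card_sub_right hAne
  have hApos : (0 : ℝ) < #A := by
    have hAne : A.Nonempty := ⟨_, ((Finset.mem_filter.1 hb₁).2 0).2.2⟩
    exact_mod_cast hAne.card_pos
  have hplu : (#(4 • A - 4 • A) : ℝ) ≤ τ ^ 8 * #A := by
    have hAne : A.Nonempty := ⟨_, ((Finset.mem_filter.1 hb₁).2 0).2.2⟩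
    have h1 := Finset.pluennecke_ruzsa_inequality_nsmul_sub_nsmul_sub hAne A 4 4
    have h2 : (#(4 • A - 4 • A) : ℝ) ≤ ((#(A - A) : ℝ) / #A) ^ 8 * #A := by
      have := (NNRat.cast_le (K := ℝ)).2 h1
      push_cast at this
      exact this
    refine h2.trans ?_
    gcongr
    rw [div_le_iff₀ hApos]
    exact hAA
  rcases card_mul_card_le_of_mul_mem A B Q' (b₀ := y₂ 0) (q₀ := y₁ 0)
    (((Finset.mem_filter.1 hq₁).2 0).2.2.1) (fun h => hQ0 (h ▸ hy₁Q)) ⟨b₁, hb₁⟩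
    (fun q hq => ((Finset.mem_filter.1 hq).2 0).2.2.2)
    (fun b hb => ((Finset.mem_filter.1 hb).2 0).2.2)
    (m₁ := τ⁻¹ * #Q) (m₂ := (τ ^ 2)⁻¹ * #B) (by positivity)
    (by
      intro v hv
      refine (hdeg (Fin.append v y₂) fun j => ?_).trans ?_
      · refine Fin.addCases (fun i => ?_) (fun i => ?_) j
        · rw [Fin.append_left]; exact hv i
        · rw [Fin.append_right]; exact hy₂B i
      · norm_cast
        refine Finset.card_le_card fun q hq => ?_
        simp only [hQ', Finset.mem_filter, Finset.mem_univ, true_and] at hq ⊢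
        refine ⟨fun i => ⟨hq.1, hy₂B i, ?_⟩, fun i => ?_⟩
        · have := hq.2 (Fin.natAdd 6 i)
          rwa [Fin.append_right] at this
        · have := (hq.2 (Fin.castAdd t₂ i)).2
          rwa [Fin.append_left] at this)
    (by
      intro q hq q' hq'
      have := hg₂ ![q, q'] (fun i j => by
        fin_cases j
        · exact (Finset.mem_filter.1 hq).2 i
        · exact (Finset.mem_filter.1 hq').2 i)
      rw [sum_unifOn, ← div_eq_mul_inv, le_div_iff₀ hBpos] at this
      refine this.trans ?_
      norm_cast
      refine Finset.card_le_card fun w hw => ?_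
      simp only [Finset.mem_filter] at hw ⊢
      exact ⟨hw.1, (hw.2 0).2.2.2, (hw.2 1).2.2.2⟩)
    (lt_of_le_of_lt (by gcongr) hQp) with h | h
  · have h1 : τ⁻¹ * #Q * (#B * M) ≤ τ := by
      calc τ⁻¹ * #Q * (#B * M) = τ⁻¹ * #Q * #B * M := by ring
        _ ≤ #(A - A) * M := by gcongr
        _ ≤ τ := hAM
    have h2 : τ ^ 420 ≤ τ ^ 204 := by
      calc τ ^ 420 = τ ^ 420 * 1 := by ring
        _ ≤ #Q * (τ ^ 202 * (#B * M)) := by gcongr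
        _ = τ ^ 203 * (τ⁻¹ * #Q * (#B * M)) := by field_simp
        _ ≤ τ ^ 203 * τ := by gcongr
        _ = _ := by ring
    have h3 : τ ^ 204 < τ ^ 420 := pow_lt_pow_right₀ (by linarith) (by norm_num)
    linarith
  · have h0 : (#(A - A) : ℝ) * #(4 • A - 4 • A) ≤ #(A - A) * (τ ^ 8 * #(A - A)) := by
      gcongr
      exact hplu.trans (by gcongr)
    have h1 : (τ ^ 2)⁻¹ * τ⁻¹ * #Q * (#B * M) ^ 2 ≤ τ ^ 10 := by
      calc (τ ^ 2)⁻¹ * τ⁻¹ * #Q * (#B * M) ^ 2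
          = ((τ ^ 2)⁻¹ * #B * (τ⁻¹ * #Q) * #B) * M ^ 2 := by ring
        _ ≤ (#(A - A) * (τ ^ 8 * #(A - A))) * M ^ 2 :=
          mul_le_mul_of_nonneg_right (h.trans h0) (by positivity)
        _ = τ ^ 8 * (#(A - A) * M) ^ 2 := by ring
        _ ≤ τ ^ 8 * τ ^ 2 := by gcongr
        _ = _ := by ring
    have h2 : τ ^ 420 ≤ τ ^ 417 := by
      calc τ ^ 420 = τ ^ 420 * 1 ^ 2 := by ring
        _ ≤ #Q * (τ ^ 202 * (#B * M)) ^ 2 := by gcongr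
        _ = τ ^ 407 * ((τ ^ 2)⁻¹ * τ⁻¹ * #Q * (#B * M) ^ 2) := by field_simp
        _ ≤ τ ^ 407 * τ ^ 10 := by gcongr
        _ = _ := by ring
    have h3 : τ ^ 417 < τ ^ 420 := pow_lt_pow_right₀ (by linarith) (by norm_num)
    linarith

end ProductCore

section MulConvolution

/-- The law of the product of two independent variables with laws `ν` and `π`. -/
noncomputable def mconv {p : ℕ} [NeZero p] (ν π : ZMod p → ℝ) (z : ZMod p) : ℝ :=
  ∑ x, ∑ y, if x * y = z then ν x * π y else 0

lemma sum_mconv_mul {p : ℕ} [NeZero p] (ν π φ : ZMod p → ℝ) :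
    ∑ z, mconv ν π z * φ z = ∑ x, ∑ y, ν x * π y * φ (x * y) := by
  simp_rw [mconv, Finset.sum_mul]
  rw [Finset.sum_comm]
  refine Finset.sum_congr rfl fun x _ => ?_
  rw [Finset.sum_comm]
  refine Finset.sum_congr rfl fun y _ => ?_
  simp [ite_mul]

lemma IsProb.mconv {p : ℕ} [NeZero p] {ν π : ZMod p → ℝ} (hν : IsProb ν) (hπ : IsProb π) :
    IsProb (mconv ν π) := by
  refine ⟨fun z => Finset.sum_nonneg fun x _ => Finset.sum_nonneg fun y _ => ?_, ?_⟩
  · split_ifs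
    · exact mul_nonneg (hν.nonneg _) (hπ.nonneg _)
    · exact le_rfl
  · have := sum_mconv_mul ν π fun _ => 1
    simp only [mul_one] at this
    rw [this, ← Finset.sum_mul_sum, hν.sum_eq_one, hπ.sum_eq_one, one_mul]

variable {p : ℕ} [Fact p.Prime]

lemma mconv_eq_sum_mul_inv {ν π : ZMod p → ℝ} (hπ : π 0 = 0) (z : ZMod p) :
    mconv ν π z = ∑ y, π y * ν (z * y⁻¹) := by
  rw [mconv, Finset.sum_comm]
  refine Finset.sum_congr rfl fun y _ => ?_
  by_cases hy : y = 0
  · simp [hy, hπ]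
  · simp_rw [← eq_mul_inv_iff_mul_eq₀ hy]
    simp [mul_comm]

lemma mconv_le {ν π : ZMod p → ℝ} (hν : IsProb ν) (hπp : IsProb π) (hπ : π 0 = 0) {S : ℝ}
    (hS : ∀ x, π x ≤ S) (hν0 : ν 0 ≤ S) (z : ZMod p) : mconv ν π z ≤ S := by
  by_cases hz : z = 0
  · rw [mconv_eq_sum_mul_inv hπ, hz]
    simp only [zero_mul]
    rw [← Finset.sum_mul, hπp.sum_eq_one, one_mul]
    exact hν0
  · have hS0 : 0 ≤ S := (hν.nonneg 0).trans hν0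
    calc mconv ν π z ≤ ∑ x, ν x * S := by
          refine Finset.sum_le_sum fun x _ => ?_
          by_cases hx : x = 0
          · simp only [hx, zero_mul, Ne.symm hz, if_false, Finset.sum_const_zero]
            exact mul_nonneg (hν.nonneg 0) hS0
          · have : ∀ y, x * y = z ↔ y = x⁻¹ * z := fun y => by
              rw [eq_inv_mul_iff_mul_eq₀ hx]
            simp_rw [this]
            simp only [Finset.sum_ite_eq', Finset.mem_univ, if_true]
            exact mul_le_mul_of_nonneg_left (hS _) (hν.nonneg x)
      _ = S := by rw [← Finset.sum_mul, hν.sum_eq_one, one_mul]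

lemma sum_sq_mconv_le {ν π : ZMod p → ℝ} (hπp : IsProb π) (hπ : π 0 = 0) :
    ∑ z, mconv ν π z ^ 2 ≤ ∑ z, ν z ^ 2 := by
  simp_rw [mconv_eq_sum_mul_inv hπ]
  calc ∑ z, (∑ y, π y * ν (z * y⁻¹)) ^ 2 ≤ ∑ z, ∑ y, π y * ν (z * y⁻¹) ^ 2 := by
        refine Finset.sum_le_sum fun z _ => ?_
        have := Finset.sum_mul_sq_le_sq_mul_sq Finset.univ (fun y => √(π y))
          fun y => √(π y) * ν (z * y⁻¹)
        simp_rw [mul_pow, Real.sq_sqrt (hπp.nonneg _), ← mul_assoc,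
          Real.mul_self_sqrt (hπp.nonneg _), hπp.sum_eq_one, one_mul] at this
        exact this
    _ = ∑ y, π y * ∑ z, ν (z * y⁻¹) ^ 2 := by
        rw [Finset.sum_comm]
        simp_rw [Finset.mul_sum]
    _ = ∑ y, π y * ∑ z, ν z ^ 2 := by
        refine Finset.sum_congr rfl fun y _ => ?_
        by_cases hy : y = 0
        · simp [hy, hπ]
        · congr 1
          exact Fintype.sum_equiv (Equiv.mulRight₀ y⁻¹ (inv_ne_zero hy)) _ _ fun x => by simp
    _ = _ := by rw [← Finset.sum_mul, hπp.sum_eq_one, one_mul]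

end MulConvolution

section Flattening
open scoped Pointwise

/-- A sequence of reals decreasing by a bounded total factor decreases slowly somewhere. -/
lemma exists_le_mul_succ {M : ℕ → ℝ} {κ : ℝ} (hκ : 0 ≤ κ) {r : ℕ} (h : M 0 < κ ^ r * M r) :
    ∃ j < r, M j ≤ κ * M (j + 1) := by
  by_contra! hcon
  have : ∀ j ≤ r, κ ^ j * M j ≤ M 0 := by
    intro j
    induction j with
    | zero => simp
    | succ j ih =>
      intro hj
      refine le_trans ?_ (ih (by omega))
      rw [pow_succ, mul_assoc]
      exact mul_le_mul_of_nonneg_left (hcon j (by omega)).le (by positivity)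
  exact absurd (this r le_rfl) (not_le.2 h)

set_option maxHeartbeats 800000 in
open scoped Classical in
/-- Multiplicative convolution with a spread-out law, followed by enough additive differencing,
decreases the `L²` norm. -/
theorem sum_sq_iterate_diffLaw_mconv_le {p : ℕ} [Fact p.Prime] {κ : ℝ} (hκ : 2 ≤ κ) {n E t₀ : ℕ}
    (hn : 20 ≤ n) (hE : 2 * (100 * n * (6 + (2 * (100 * n) + 1)) + 2) + 1 ≤ E)
    (ht₀ : t₀ = 2 * (E * (100 * n)) + 1) {τ : ℝ} (hτ : τ = (κ ^ (8 * t₀)) ^ E)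
    (hp : (p : ℝ) = τ ^ (100 * n)) {ν π : ZMod p → ℝ} (hν : IsProb ν) (hπ : IsProb π)
    (hν0 : ν 0 ≤ 2 * (τ ^ 500)⁻¹) (hπ0 : π 0 = 0) (hπS : ∀ x, π x ≤ 2 * (τ ^ 500)⁻¹) :
    ∑ z, diffLaw^[8 * t₀ * (200 * E)] (mconv ν π) z ^ 2 ≤
      max (τ ^ (55 * n))⁻¹ ((τ ^ 200)⁻¹ * ∑ z, ν z ^ 2) := by
  by_contra! hcon
  rw [max_lt_iff] at hcon
  set σ := κ ^ (8 * t₀) with hσ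
  have hκ0 : 0 < κ := by linarith
  have hσκ : κ ^ 8 ≤ σ := pow_le_pow_right₀ (by linarith) (by omega)
  have hκ8 : (2 : ℝ) ^ 8 ≤ κ ^ 8 := by gcongr
  have hσ256 : 256 ≤ σ := by linarith
  have hσ0 : 0 < σ := by linarith
  have hτσ : ∀ k ≤ E, σ ^ k ≤ τ := fun k hk => hτ ▸ pow_le_pow_right₀ (by linarith) hk
  have hτ1 : σ ≤ τ := by simpa using hτσ 1 (by omega)
  have hτ0 : 0 < τ := by linarith
  have hρ := hν.mconv hπ
  set ρ := mconv ν π with hρdef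
  set M : ℕ → ℝ := fun j => ∑ z, diffLaw^[j] ρ z ^ 2 with hMdef
  have hM0 : M 0 ≤ ∑ z, ν z ^ 2 := sum_sq_mconv_le hπ hπ0
  have hMr : M (8 * t₀ * (200 * E)) = ∑ z, diffLaw^[8 * t₀ * (200 * E)] ρ z ^ 2 := rfl
  rw [← hMr] at hcon
  have hνr : ∑ z, ν z ^ 2 < τ ^ 200 * M (8 * t₀ * (200 * E)) := by
    rw [← inv_mul_lt_iff₀ (by positivity)]; exact hcon.2
  obtain ⟨j, hj, hjM⟩ := exists_le_mul_succ (M := M) (κ := κ) hκ0.le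
    (r := 8 * t₀ * (200 * E)) (by
      refine hM0.trans_lt (hνr.trans_eq ?_)
      rw [hτ, hσ]
      ring)
  have hMj : M (8 * t₀ * (200 * E)) ≤ M j := hρ.sum_sq_iterate_antitone hj.le
  have hMjpos : 0 < M j := lt_of_lt_of_le (lt_trans (by positivity) hcon.1) hMj
  have hρj := hρ.iterate_diffLaw j
  have hκσ : σ⁻¹ ≤ (1 / (2 * κ ^ 2)) ^ t₀ / 2 := by
    rw [one_div, inv_pow, mul_pow, div_eq_mul_inv, ← mul_inv]
    refine inv_anti₀ (by positivity) ?_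
    have h1 : (2 : ℝ) ^ t₀ * 2 ≤ κ ^ (6 * t₀) := by
      rw [← pow_succ]
      calc (2 : ℝ) ^ (t₀ + 1) ≤ 2 ^ (6 * t₀) := pow_le_pow_right₀ (by norm_num) (by omega)
        _ ≤ _ := by gcongr
    calc 2 ^ t₀ * (κ ^ 2) ^ t₀ * 2 = (2 ^ t₀ * 2) * (κ ^ 2) ^ t₀ := by ring
      _ ≤ κ ^ (6 * t₀) * (κ ^ 2) ^ t₀ := by gcongr
      _ = σ := by rw [← pow_mul, ← pow_add, hσ]; congr 1; ring
  obtain ⟨H, hH1, hH2⟩ := hρj.exists_small_doubling hκ0 (θ := σ⁻¹) (by positivity) t₀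
    (by
      refine hjM.trans_eq ?_
      simp only [hMdef, Function.iterate_succ_apply']) (by
      refine le_trans (le_of_eq ?_) hκσ
      rw [ZMod.card, hp, hτ, ht₀, inv_pow]
      field_simp
      ring)
  replace hH2 : #(H - H) * (σ⁻¹ * M j) ≤ 4 * κ ^ 4 := by convert hH2
  replace hH1 := hκσ.trans hH1
  have hHM : #(H - H) * M j ≤ σ ^ 2 := by
    have h1 : 4 * κ ^ 4 ≤ σ := by
      refine le_trans ?_ hσκ
      have : (2 : ℝ) ^ 2 ≤ κ ^ 4 := by
        calc (2 : ℝ) ^ 2 ≤ 2 ^ 4 := by norm_num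
          _ ≤ _ := by gcongr
      calc 4 * κ ^ 4 = 2 ^ 2 * κ ^ 4 := by ring
        _ ≤ κ ^ 4 * κ ^ 4 := by gcongr
        _ = κ ^ 8 := by ring
    calc #(H - H) * M j = σ * (#(H - H) * (σ⁻¹ * M j)) := by field_simp
      _ ≤ σ * σ := by gcongr; exact hH2.trans h1
      _ = σ ^ 2 := by ring
  have hHc : σ⁻¹ ≤ #H * M j := by
    refine hH1.trans ?_
    rw [← nsmul_eq_mul]
    exact Finset.sum_le_card_nsmul _ _ _ fun x _ => diffLaw_le_sum_sq _ x
  obtain ⟨z, hz⟩ := hρ.exists_translate H (η := σ⁻¹) (j + 1) 0 (by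
    simpa only [Function.iterate_succ_apply', zero_add] using hH1)
  set A := H.image (z + ·) with hA
  have hAH : A - A = H - H := by
    rw [hA]
    ext x
    simp only [Finset.mem_sub, Finset.exists_mem_image, add_sub_add_left_eq_sub]
  have hAc : #A = #H := Finset.card_image_of_injective _ (add_right_injective z)
  have hAsum : σ⁻¹ ≤ ∑ a ∈ A, ρ a := by
    rw [hA, Finset.sum_image fun x _ y _ h => add_right_injective z h]
    exact hz
  -- pass to the popular factors
  set f : ZMod p → ℝ := fun q => ∑ b, if b ≠ 0 ∧ b * q ∈ A then ν b else 0 with hf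
  have hf1 : ∀ q, f q ≤ 1 := fun q => by
    rw [← hν.sum_eq_one]
    refine Finset.sum_le_sum fun b _ => ?_
    split_ifs
    · exact le_rfl
    · exact hν.nonneg b
  have hsum : ∑ a ∈ A, ρ a ≤ ν 0 + ∑ q, π q * f q := by
    have h1 : ∑ a ∈ A, ρ a = ∑ x, ∑ y, ν x * π y * if x * y ∈ A then 1 else 0 := by
      rw [← sum_mconv_mul ν π fun a => if a ∈ A then 1 else 0]
      simp [hρdef]
    rw [h1, Finset.sum_comm]
    have h2 : ν 0 = ∑ q, π q * ν 0 := by rw [← Finset.sum_mul, hπ.sum_eq_one, one_mul]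
    rw [h2, ← Finset.sum_add_distrib]
    refine Finset.sum_le_sum fun q _ => ?_
    rw [← mul_add, hf]
    have h3 : ∑ x, ν x * π q * (if x * q ∈ A then 1 else 0) =
        π q * ∑ x, if x * q ∈ A then ν x else 0 := by
      rw [Finset.mul_sum]
      refine Finset.sum_congr rfl fun x _ => ?_
      split_ifs <;> ring
    rw [h3]
    refine mul_le_mul_of_nonneg_left ?_ (hπ.nonneg q)
    have h4 : ν 0 = ∑ x, if x = 0 then ν x else 0 := by simp
    rw [h4, ← Finset.sum_add_distrib]
    refine Finset.sum_le_sum fun x _ => ?_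
    have := hν.nonneg x
    by_cases hx : x = 0
    · simp only [hx, if_true, ne_eq, not_true, false_and, if_false, add_zero]
      split_ifs
      · exact le_rfl
      · exact hν.nonneg 0
    · by_cases hxA : x * q ∈ A <;> simp [hx, hxA]
  have hτ500 : 2 * (τ ^ 500)⁻¹ ≤ σ⁻¹ / 2 := by
    have h1 : 4 * σ ≤ τ ^ 500 := by
      calc 4 * σ ≤ τ * τ := by gcongr; linarith
        _ = τ ^ 2 := by ring
        _ ≤ τ ^ 500 := pow_le_pow_right₀ (by linarith) (by norm_num)
    have h2 : (τ ^ 500)⁻¹ ≤ (4 * σ)⁻¹ := inv_anti₀ (by positivity) h1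
    calc 2 * (τ ^ 500)⁻¹ ≤ 2 * (4 * σ)⁻¹ := by gcongr
      _ = _ := by rw [mul_inv]; ring
  have hpf : σ⁻¹ / 2 ≤ ∑ q, π q * f q := by linarith
  set Q₀ := Finset.univ.filter fun q => q ≠ 0 ∧ σ⁻¹ / 4 ≤ f q with hQ₀
  have hQ₀π : σ⁻¹ / 4 ≤ ∑ q ∈ Q₀, π q := by
    have h1 : ∑ q, π q * f q ≤ ∑ q ∈ Q₀, π q + ∑ q, π q * (σ⁻¹ / 4) := by
      rw [hQ₀, Finset.sum_filter, ← Finset.sum_add_distrib]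
      refine Finset.sum_le_sum fun q _ => ?_
      have hq := hπ.nonneg q
      by_cases hq0 : q = 0
      · simp [hq0, hπ0]
      by_cases h : σ⁻¹ / 4 ≤ f q
      · rw [if_pos ⟨hq0, h⟩]
        have : 0 ≤ π q * (σ⁻¹ / 4) := by positivity
        nlinarith [hf1 q]
      · rw [if_neg fun h' => h h'.2, zero_add]
        exact mul_le_mul_of_nonneg_left (not_le.1 h).le hq
    rw [← Finset.sum_mul, hπ.sum_eq_one, one_mul] at h1
    linarith
  have hQ₀c : τ ^ 421 ≤ #Q₀ := by
    have h1 : ∑ q ∈ Q₀, π q ≤ #Q₀ * (2 * (τ ^ 500)⁻¹) := by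
      rw [← nsmul_eq_mul]
      exact Finset.sum_le_card_nsmul _ _ _ fun x _ => hπS x
    have h2 : σ⁻¹ / 4 ≤ #Q₀ * (2 * (τ ^ 500)⁻¹) := hQ₀π.trans h1
    have h3 : τ ^ 500 ≤ 8 * σ * #Q₀ := by
      calc τ ^ 500 = 4 * σ * τ ^ 500 * (σ⁻¹ / 4) := by field_simp
        _ ≤ 4 * σ * τ ^ 500 * (#Q₀ * (2 * (τ ^ 500)⁻¹)) := by gcongr
        _ = _ := by field_simp; ring
    have h4 : 8 * σ ≤ τ ^ 79 := by
      calc 8 * σ ≤ τ * τ := by gcongr; linarith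
        _ = τ ^ 2 := by ring
        _ ≤ τ ^ 79 := pow_le_pow_right₀ (by linarith) (by norm_num)
    have h5 : τ ^ 79 * τ ^ 421 ≤ τ ^ 79 * #Q₀ := by
      calc τ ^ 79 * τ ^ 421 = τ ^ 500 := by ring
        _ ≤ 8 * σ * #Q₀ := h3
        _ ≤ _ := by gcongr
    exact le_of_mul_le_mul_left h5 (by positivity)
  have hceil : (⌈τ ^ 420⌉₊ : ℝ) ≤ τ ^ 421 := by
    have h1 := (Nat.ceil_lt_add_one (show 0 ≤ τ ^ 420 by positivity)).le
    have h2 : 1 ≤ τ ^ 420 := one_le_pow₀ (by linarith)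
    calc (⌈τ ^ 420⌉₊ : ℝ) ≤ τ ^ 420 + 1 := h1
      _ ≤ τ ^ 420 + τ ^ 420 := by linarith only [h2]
      _ = τ ^ 420 * 2 := by ring
      _ ≤ τ ^ 420 * τ := by gcongr; linarith only [hτ1, hσ256]
      _ = τ ^ 421 := by ring
  obtain ⟨Q, hQQ₀, hQc⟩ := Finset.exists_subset_card_eq (s := Q₀) (n := ⌈τ ^ 420⌉₊)
    (by exact_mod_cast hceil.trans hQ₀c)
  have hQτ : τ ^ 420 ≤ #Q := by rw [hQc]; exact Nat.le_ceil _
  have hQτ' : (#Q : ℝ) ≤ τ ^ 421 := by rw [hQc]; exact hceil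
  have hQpos : (0 : ℝ) < #Q := lt_of_lt_of_le (by positivity) hQτ
  have hσE : σ ^ (2 * (100 * n * (6 + (2 * (100 * n) + 1)) + 2) + 1) ≤ τ := hτσ _ hE
  have hAM : #(A - A) * M j ≤ τ := by
    rw [hAH]; exact hHM.trans (hτσ 2 (by omega))
  have hστ' : σ * σ ^ 2 ≤ τ := by
    rw [← pow_succ']; exact hτσ 3 (by omega)
  refine false_of_mul_mem_small_doubling A Q hν (τ := τ) (M := M j) (η := (σ ^ 2)⁻¹)
    (fun h => (Finset.mem_filter.1 (hQQ₀ h)).2.1 rfl) (by linarith) hMjpos (by positivity)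
    (100 * n) hp.le ?_ ?_ hAM ?_ ?_ ?_ hQτ
  · set t := 100 * n * (6 + (2 * (100 * n) + 1)) + 2
    rw [inv_pow, ← pow_mul]
    have h1 : σ ^ (2 * t) * 2 ≤ τ := by
      refine le_trans ?_ hσE
      rw [pow_succ]
      gcongr
      linarith
    calc (1 : ℝ) = (σ ^ (2 * t) * 2) * ((σ ^ (2 * t))⁻¹ / 2) := by field_simp
      _ ≤ _ := by gcongr
  · have h1 : ∑ b, ν b * (#(Q.filter fun q => b ≠ 0 ∧ b * q ∈ A) * (#Q : ℝ)⁻¹) =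
        (∑ q ∈ Q, f q) * (#Q : ℝ)⁻¹ := by
      rw [hf, Finset.sum_comm, Finset.sum_mul]
      refine Finset.sum_congr rfl fun b _ => ?_
      rw [← mul_assoc]
      congr 1
      rw [← Finset.sum_filter, Finset.sum_const, nsmul_eq_mul, mul_comm]
    rw [h1, ← div_eq_mul_inv, le_div_iff₀ hQpos]
    have h2 : #Q • (σ⁻¹ / 4) ≤ ∑ q ∈ Q, f q :=
      Finset.card_nsmul_le_sum _ _ _ fun q hq => (Finset.mem_filter.1 (hQQ₀ hq)).2.2
    refine le_trans ?_ h2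
    rw [nsmul_eq_mul, mul_comm]
    gcongr
    rw [pow_two, mul_inv, div_eq_mul_inv]
    gcongr
    linarith
  · rw [hAH, hAc]
    refine le_of_mul_le_mul_right ?_ hMjpos
    calc #(H - H) * M j ≤ σ ^ 2 := hHM
      _ = σ * σ ^ 2 * σ⁻¹ := by field_simp
      _ ≤ τ * (#H * M j) := by gcongr
      _ = _ := by ring
  · exact hνr.le.trans (by gcongr)
  · have h1 : (#(A - A) : ℝ) * #Q ^ 2 < p := by
      have h2 : (τ ^ (55 * n))⁻¹ < M j := hcon.1.trans_le hMj
      have h3 : (#(A - A) : ℝ) ≤ τ * τ ^ (55 * n) := by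
        have : (#(A - A) : ℝ) * (τ ^ (55 * n))⁻¹ ≤ τ := le_trans (by gcongr) hAM
        rwa [← div_eq_mul_inv, div_le_iff₀ (by positivity)] at this
      calc (#(A - A) : ℝ) * #Q ^ 2 ≤ τ * τ ^ (55 * n) * (τ ^ 421) ^ 2 := by gcongr
        _ = τ ^ (1 + 55 * n + 421 * 2) := by ring
        _ < τ ^ (100 * n) := pow_lt_pow_right₀ (by linarith) (by omega)
        _ = p := hp.symm
    exact_mod_cast h1

end Flattening

section Fourier

variable {p : ℕ} [Fact p.Prime]

/-- The (unnormalised) Fourier transform on `ZMod p`. -/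
noncomputable def ft (W : ZMod p → ℂ) (c : ZMod p) : ℂ := ∑ y, W y * ZMod.stdAddChar (c * y)

lemma norm_stdAddChar (x : ZMod p) : ‖(ZMod.stdAddChar x : ℂ)‖ = 1 := by
  rw [ZMod.stdAddChar_apply]; exact Circle.norm_coe _

lemma conj_stdAddChar (x : ZMod p) :
    (starRingEnd ℂ) (ZMod.stdAddChar x : ℂ) = ZMod.stdAddChar (-x) := by
  rw [AddChar.map_neg_eq_conj]

lemma norm_ft_le_one {T : ZMod p → ℝ} (hT : IsProb T) {W : ZMod p → ℂ} (hW : ∀ x, ‖W x‖ ≤ T x)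
    (c : ZMod p) : ‖ft W c‖ ≤ 1 := by
  rw [ft, ← hT.sum_eq_one]
  refine (norm_sum_le _ _).trans (Finset.sum_le_sum fun y _ => ?_)
  rw [norm_mul, norm_stdAddChar, mul_one]
  exact hW y

/-- A number of norm at most one rotating `z` onto the positive real axis. -/
lemma exists_mul_eq_norm (z : ℂ) : ∃ c : ℂ, ‖c‖ ≤ 1 ∧ c * z = ‖z‖ := by
  by_cases hz : z = 0
  · exact ⟨0, by simp, by simp [hz]⟩
  · refine ⟨(starRingEnd ℂ) z / ‖z‖, by simp [hz], ?_⟩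
    have : (‖z‖ : ℂ) ≠ 0 := by simpa using hz
    rw [div_mul_eq_mul_div, Complex.conj_mul']
    field_simp

lemma sq_sum_norm_ft_le {lam T : ZMod p → ℝ} (hl : IsProb lam) (hT : IsProb T) {W : ZMod p → ℂ}
    (hW : ∀ x, ‖W x‖ ≤ T x) (b : ZMod p) :
    (∑ x, lam x * ‖ft W (b * x)‖) ^ 2 ≤ ∑ q, diffLaw lam q * ‖ft (fun y => (T y : ℂ)) (b * q)‖ := by
  choose c hc1 hc using fun x => exists_mul_eq_norm (ft W (b * x))
  set g : ZMod p → ℂ := fun y => ∑ x, lam x * c x * ZMod.stdAddChar (b * x * y) with hg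
  have h1 : ((∑ x, lam x * ‖ft W (b * x)‖ : ℝ) : ℂ) = ∑ y, W y * g y := by
    push_cast
    simp_rw [← hc, hg, ft, Finset.mul_sum]
    rw [Finset.sum_comm]
    exact Finset.sum_congr rfl fun y _ => Finset.sum_congr rfl fun x _ => by ring
  have h0 : 0 ≤ ∑ x, lam x * ‖ft W (b * x)‖ :=
    Finset.sum_nonneg fun x _ => mul_nonneg (hl.nonneg x) (norm_nonneg _)
  have h2 : ∑ x, lam x * ‖ft W (b * x)‖ ≤ ∑ y, T y * ‖g y‖ := by
    have : ∑ x, lam x * ‖ft W (b * x)‖ = ‖∑ y, W y * g y‖ := by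
      rw [← h1, Complex.norm_real, Real.norm_of_nonneg h0]
    rw [this]
    refine (norm_sum_le _ _).trans (Finset.sum_le_sum fun y _ => ?_)
    rw [norm_mul]
    exact mul_le_mul_of_nonneg_right (hW y) (norm_nonneg _)
  have h3 : (∑ y, T y * ‖g y‖) ^ 2 ≤ ∑ y, T y * ‖g y‖ ^ 2 := by
    have := Finset.sum_mul_sq_le_sq_mul_sq Finset.univ (fun y => √(T y))
      fun y => √(T y) * ‖g y‖
    simp_rw [mul_pow, Real.sq_sqrt (hT.nonneg _), ← mul_assoc,
      Real.mul_self_sqrt (hT.nonneg _), hT.sum_eq_one, one_mul] at this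
    exact this
  have h4 : ((∑ y, T y * ‖g y‖ ^ 2 : ℝ) : ℂ) = ∑ s, ∑ x, (lam s * lam x : ℂ) *
      (c x * (starRingEnd ℂ) (c s)) * ft (fun y => (T y : ℂ)) (b * (x - s)) := by
    push_cast
    have h5 : ∀ y, (T y : ℂ) * (‖g y‖ : ℂ) ^ 2 = ∑ s, ∑ x, (lam s * lam x : ℂ) *
        (c x * (starRingEnd ℂ) (c s)) * (T y * ZMod.stdAddChar (b * (x - s) * y)) := by
      intro y
      rw [← Complex.mul_conj', hg, map_sum, Finset.sum_mul_sum, Finset.sum_comm, Finset.mul_sum]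
      refine Finset.sum_congr rfl fun s _ => ?_
      rw [Finset.mul_sum]
      refine Finset.sum_congr rfl fun x _ => ?_
      have : b * (x - s) * y = b * x * y + -(b * s * y) := by ring
      rw [this, AddChar.map_add_eq_mul]
      simp only [map_mul, Complex.conj_ofReal, conj_stdAddChar]
      ring
    simp_rw [h5, ft, Finset.mul_sum]
    rw [Finset.sum_comm]
    refine Finset.sum_congr rfl fun s _ => ?_
    rw [Finset.sum_comm]
  have h6 : ∑ y, T y * ‖g y‖ ^ 2 ≤ ∑ q, diffLaw lam q * ‖ft (fun y => (T y : ℂ)) (b * q)‖ := by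
    rw [sum_diffLaw_mul]
    have h7 : 0 ≤ ∑ y, T y * ‖g y‖ ^ 2 :=
      Finset.sum_nonneg fun y _ => mul_nonneg (hT.nonneg y) (sq_nonneg _)
    rw [← Real.norm_of_nonneg h7, ← Complex.norm_real, h4]
    refine (norm_sum_le _ _).trans (Finset.sum_le_sum fun s _ => ?_)
    refine (norm_sum_le _ _).trans (Finset.sum_le_sum fun x _ => ?_)
    simp only [norm_mul, Complex.norm_real, Real.norm_of_nonneg (hl.nonneg _), RCLike.norm_conj]
    refine mul_le_mul_of_nonneg_right ?_ (norm_nonneg _)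
    have := mul_le_one₀ (hc1 x) (norm_nonneg (c s)) (hc1 s)
    exact mul_le_of_le_one_right (mul_nonneg (hl.nonneg s) (hl.nonneg x)) this
  exact (pow_le_pow_left₀ h0 h2 2).trans (h3.trans h6)

lemma pow_sum_norm_ft_le {lam T : ZMod p → ℝ} (hl : IsProb lam) (hT : IsProb T) {W : ZMod p → ℂ}
    (hW : ∀ x, ‖W x‖ ≤ T x) (b : ZMod p) (s : ℕ) :
    (∑ x, lam x * ‖ft W (b * x)‖) ^ 2 ^ (s + 1) ≤
      ∑ q, diffLaw^[s + 1] lam q * ‖ft (fun y => (T y : ℂ)) (b * q)‖ := by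
  induction s with
  | zero => simpa using sq_sum_norm_ft_le hl hT hW b
  | succ s ih =>
    rw [pow_succ, pow_mul]
    refine (pow_le_pow_left₀ (pow_nonneg (Finset.sum_nonneg fun x _ =>
      mul_nonneg (hl.nonneg x) (norm_nonneg _)) _) ih 2).trans ?_
    rw [Function.iterate_succ_apply' _ (s + 1)]
    refine sq_sum_norm_ft_le (hl.iterate_diffLaw _) hT (fun x => ?_) b
    rw [Complex.norm_real, Real.norm_of_nonneg (hT.nonneg x)]

lemma pow_sum_norm_ft_self_le {lam T : ZMod p → ℝ} (hl : IsProb lam) (hT : IsProb T) (r : ℕ) :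
    (∑ x, lam x * ‖ft (fun y => (T y : ℂ)) x‖) ^ 2 ^ r ≤
      ∑ q, diffLaw^[r] lam q * ‖ft (fun y => (T y : ℂ)) q‖ := by
  cases r with
  | zero => simp
  | succ r =>
    have := pow_sum_norm_ft_le hl hT (W := fun y => (T y : ℂ)) (fun x => by
      rw [Complex.norm_real, Real.norm_of_nonneg (hT.nonneg x)]) 1 r
    simpa only [one_mul] using this

lemma sum_norm_sq_ft (W : ZMod p → ℂ) : ∑ c, ‖ft W c‖ ^ 2 = p * ∑ y, ‖W y‖ ^ 2 := by
  have h : ((∑ c, ‖ft W c‖ ^ 2 : ℝ) : ℂ) = ((p * ∑ y, ‖W y‖ ^ 2 : ℝ) : ℂ) := by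
    push_cast
    have h1 : ∀ c, (‖ft W c‖ : ℂ) ^ 2 = ∑ y, ∑ z, W y * (starRingEnd ℂ) (W z) *
        ZMod.stdAddChar (c * (y - z)) := by
      intro c
      rw [← Complex.mul_conj', ft, map_sum, Finset.sum_mul_sum]
      refine Finset.sum_congr rfl fun y _ => Finset.sum_congr rfl fun z _ => ?_
      have : c * (y - z) = c * y + -(c * z) := by ring
      rw [this, AddChar.map_add_eq_mul, map_mul (starRingEnd ℂ), conj_stdAddChar]
      ring
    simp_rw [h1]
    rw [Finset.sum_comm, Finset.mul_sum]
    refine Finset.sum_congr rfl fun y _ => ?_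
    rw [Finset.sum_comm]
    simp_rw [← Finset.mul_sum]
    simp_rw [AddChar.sum_mulShift _ (ZMod.isPrimitive_stdAddChar p), sub_eq_zero]
    simp only [Nat.cast_ite, Nat.cast_zero, mul_ite, mul_zero, Finset.sum_ite_eq,
      Finset.mem_univ, if_true, ZMod.card]
    rw [← Complex.mul_conj']
    ring
  exact_mod_cast h

lemma sum_mul_norm_ft_le (ν : ZMod p → ℝ) (W : ZMod p → ℂ) :
    (∑ c, ν c * ‖ft W c‖) ^ 2 ≤ (∑ c, ν c ^ 2) * (p * ∑ y, ‖W y‖ ^ 2) := by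
  rw [← sum_norm_sq_ft]
  exact Finset.sum_mul_sq_le_sq_mul_sq _ _ _

/-- Multiplicative convolution of complex weights. -/
noncomputable def cconv (f g : ZMod p → ℂ) (z : ZMod p) : ℂ :=
  ∑ x, ∑ y, if x * y = z then f x * g y else 0

lemma ft_cconv (f g : ZMod p → ℂ) (c : ZMod p) : ft (cconv f g) c = ∑ x, f x * ft g (c * x) := by
  simp_rw [ft, cconv, Finset.sum_mul]
  rw [Finset.sum_comm]
  refine Finset.sum_congr rfl fun x _ => ?_
  rw [Finset.sum_comm, Finset.mul_sum]
  refine Finset.sum_congr rfl fun y _ => ?_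
  simp only [ite_mul, zero_mul, Finset.sum_ite_eq, Finset.mem_univ, if_true]
  rw [mul_assoc c, mul_assoc]

lemma norm_cconv_le {f g : ZMod p → ℂ} {μ ν : ZMod p → ℝ} (hf : ∀ x, ‖f x‖ ≤ μ x)
    (hg : ∀ x, ‖g x‖ ≤ ν x) (z : ZMod p) : ‖cconv f g z‖ ≤ mconv μ ν z := by
  refine (norm_sum_le _ _).trans (Finset.sum_le_sum fun x _ => ?_)
  refine (norm_sum_le _ _).trans (Finset.sum_le_sum fun y _ => ?_)
  split_ifs
  · rw [norm_mul]
    exact mul_le_mul (hf x) (hg y) (norm_nonneg _) ((norm_nonneg _).trans (hf x))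
  · simp

lemma ofReal_mconv (μ ν : ZMod p → ℝ) :
    (fun z => (mconv μ ν z : ℂ)) = cconv (fun x => (μ x : ℂ)) fun x => (ν x : ℂ) := by
  ext z
  simp only [mconv, cconv]
  push_cast
  refine Finset.sum_congr rfl fun x _ => Finset.sum_congr rfl fun y _ => ?_
  split_ifs <;> simp

lemma sum_single_sq (b : ZMod p) : ∑ x, (Pi.single b (1 : ℝ) : ZMod p → ℝ) x ^ 2 = 1 := by
  simp [Pi.single_apply]

lemma isProb_single (b : ZMod p) : IsProb (Pi.single b (1 : ℝ) : ZMod p → ℝ) :=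
  ⟨fun x => by by_cases h : x = b <;> simp [h], by simp⟩

/-- The law `π` with its mass at `0` moved to `1`. -/
noncomputable def moveZero (π : ZMod p → ℝ) (x : ZMod p) : ℝ :=
  if x = 0 then 0 else π x + if x = 1 then π 0 else 0

lemma sum_moveZero_mul (π F : ZMod p → ℝ) :
    ∑ x, moveZero π x * F x = ∑ x, π x * F x - π 0 * F 0 + π 0 * F 1 := by
  have h : ∀ x, moveZero π x * F x =
      π x * F x - (if x = 0 then π 0 * F 0 else 0) + if x = 1 then π 0 * F 1 else 0 := by
    intro x
    unfold moveZero
    by_cases h0 : x = 0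
    · simp [h0]
    · by_cases h1 : x = 1
      · simp [h1]; ring
      · simp [h0, h1]
  simp_rw [h, Finset.sum_add_distrib, Finset.sum_sub_distrib]
  simp

lemma isProb_moveZero {π : ZMod p → ℝ} (h : IsProb π) : IsProb (moveZero π) := by
  refine ⟨fun x => ?_, ?_⟩
  · unfold moveZero
    have := h.nonneg x
    have := h.nonneg 0
    split_ifs <;> linarith
  · have := sum_moveZero_mul π fun _ => 1
    simp only [mul_one] at this
    rw [this, h.sum_eq_one]; ring

lemma moveZero_le {π : ZMod p → ℝ} (h : IsProb π) {P : ℝ} (hP : ∀ x, π x ≤ P) (x : ZMod p) :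
    moveZero π x ≤ 2 * P := by
  have h0 := h.nonneg 0
  have := hP 0
  have := hP x
  unfold moveZero
  split_ifs <;> linarith

end Fourier

section Amplification

variable {p : ℕ} [Fact p.Prime]

/-- Convolution by a law with sup norm at most `2 * P` followed by `r` differencings flattens. -/
def Flattens (p : ℕ) [Fact p.Prime] (r : ℕ) (P A K : ℝ) : Prop :=
  ∀ ν π : ZMod p → ℝ, IsProb ν → IsProb π → ν 0 ≤ 2 * P → π 0 = 0 → (∀ x, π x ≤ 2 * P) →
    ∑ z, diffLaw^[r] (mconv ν π) z ^ 2 ≤ max A (K⁻¹ * ∑ z, ν z ^ 2)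

/-- A law whose iterated additive differences are uniformly at most `P`. -/
structure IsSpread (s : ℕ) (P : ℝ) (lam : ZMod p → ℝ) : Prop where
  isProb : IsProb lam
  iterate_le : ∀ x, diffLaw^[s] lam x ≤ P

lemma Flattens.exists_step {s r : ℕ} {P A K : ℝ} (hFL : Flattens p r P A K) (hs : 1 ≤ s)
    {lam : ZMod p → ℝ} (hl : IsSpread s P lam) {ν : ZMod p → ℝ} (hν : IsProb ν)
    (hν0 : ν 0 ≤ 2 * P) {W : ZMod p → ℂ} {T : ZMod p → ℝ} (hT : IsProb T)
    (hW : ∀ x, ‖W x‖ ≤ T x) {β : ℝ} (hβ0 : 0 ≤ β) (hβ1 : β ≤ 1 / 2)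
    (hPβ : 2 * P ≤ β ^ 2 ^ (s + 1 + r))
    (h : β ≤ ∑ b, ν b * ∑ x, lam x * ‖ft W (b * x)‖) :
    ∃ ν' : ZMod p → ℝ, IsProb ν' ∧ ν' 0 ≤ 2 * P ∧
      ∑ z, ν' z ^ 2 ≤ max A (K⁻¹ * ∑ z, ν z ^ 2) ∧
      β ^ 2 ^ (s + 1 + r) ≤ ∑ b, ν' b * ‖ft (fun y => (T y : ℂ)) b‖ := by
  obtain ⟨s, rfl⟩ : ∃ s', s = s' + 1 := ⟨s - 1, by omega⟩
  set π := diffLaw^[s + 1] lam with hπ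
  have hπp : IsProb π := hl.isProb.iterate_diffLaw _
  set F : ZMod p → ℝ := fun c => ‖ft (fun y => (T y : ℂ)) c‖ with hF
  have hF1 : ∀ c, F c ≤ 1 := norm_ft_le_one hT fun x => by
    rw [Complex.norm_real, Real.norm_of_nonneg (hT.nonneg x)]
  have hF0 : ∀ c, 0 ≤ F c := fun c => norm_nonneg _
  have hin0 : ∀ b, 0 ≤ ∑ x, lam x * ‖ft W (b * x)‖ := fun b =>
    Finset.sum_nonneg fun x _ => mul_nonneg (hl.isProb.nonneg x) (norm_nonneg _)
  have h1 : β ^ 2 ^ (s + 1) ≤ ∑ b, ν b * ∑ q, π q * F (b * q) := by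
    refine (pow_le_pow_left₀ hβ0 h _).trans ?_
    refine (Real.pow_arith_mean_le_arith_mean_pow _ _ _ (fun x _ => hν.nonneg x) hν.sum_eq_one
      (fun b _ => hin0 b) _).trans ?_
    exact Finset.sum_le_sum fun b _ => mul_le_mul_of_nonneg_left
      (pow_sum_norm_ft_le hl.isProb hT hW b s) (hν.nonneg b)
  have h2 : ∑ b, ν b * ∑ q, π q * F (b * q) ≤ P + ∑ z, mconv ν (moveZero π) z * F z := by
    rw [sum_mconv_mul]
    have : P = ∑ b, ν b * P := by rw [← Finset.sum_mul, hν.sum_eq_one, one_mul]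
    rw [this, ← Finset.sum_add_distrib]
    refine Finset.sum_le_sum fun b _ => ?_
    simp_rw [mul_assoc]
    rw [← Finset.mul_sum, ← mul_add]
    refine mul_le_mul_of_nonneg_left ?_ (hν.nonneg b)
    rw [sum_moveZero_mul π fun q => F (b * q)]
    have h3 := mul_le_mul (hl.iterate_le 0) (hF1 (b * 0)) (hF0 _)
      ((hπp.nonneg 0).trans (hl.iterate_le 0))
    have h4 := mul_nonneg (hπp.nonneg 0) (hF0 (b * 1))
    linarith
  have hm := isProb_moveZero hπp
  have hmS := moveZero_le hπp hl.iterate_le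
  have hm0 : moveZero π 0 = 0 := by simp [moveZero]
  have hρ := hν.mconv hm
  refine ⟨diffLaw^[r] (mconv ν (moveZero π)), hρ.iterate_diffLaw r,
    hρ.iterate_diffLaw_le (mconv_le hν hm hm0 hmS hν0) r 0, hFL _ _ hν hm hν0 hm0 hmS, ?_⟩
  refine le_trans ?_ (pow_sum_norm_ft_self_le hρ hT r)
  have h5 : β ^ 2 ^ (s + 1 + 1 + r) ≤ β ^ 2 ^ (s + 1 + 1) :=
    pow_le_pow_of_le_one hβ0 (by linarith) (Nat.pow_le_pow_right (by norm_num) (by omega))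
  have h6 : β ^ 2 ^ (s + 1 + 1) ≤ β ^ 2 ^ (s + 1) / 2 := by
    rw [pow_succ 2 (s + 1), pow_mul, sq, div_eq_mul_one_div]
    gcongr
    calc β ^ 2 ^ (s + 1) ≤ β ^ 1 :=
          pow_le_pow_of_le_one hβ0 (by linarith) Nat.one_le_two_pow
      _ ≤ 1 / 2 := by simpa using hβ1
  have h7 : β ^ 2 ^ (s + 1 + 1) ≤ ∑ z, mconv ν (moveZero π) z * F z := by
    have : 0 ≤ β ^ 2 ^ (s + 1 + 1) := by positivity
    linarith
  calc β ^ 2 ^ (s + 1 + 1 + r) = (β ^ 2 ^ (s + 1 + 1)) ^ 2 ^ r := by rw [← pow_mul, ← pow_add]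
    _ ≤ _ := by gcongr

/-- The law of a product of independent variables with laws in the list, and a last one. -/
noncomputable def mfold (L : List (ZMod p → ℝ)) (T : ZMod p → ℝ) : ZMod p → ℝ := L.foldr mconv T

/-- Complex version of `mfold`. -/
noncomputable def cfold (L : List (ZMod p → ℂ)) (W : ZMod p → ℂ) : ZMod p → ℂ := L.foldr cconv W

lemma isProb_mfold {L : List (ZMod p → ℝ)} (hL : ∀ l ∈ L, IsProb l) {T : ZMod p → ℝ}
    (hT : IsProb T) : IsProb (mfold L T) := by
  induction L with
  | nil => exact hT
  | cons l L ih =>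
    exact (hL l (by simp)).mconv (ih fun l' h => hL l' (by simp [h]))

lemma norm_cfold_le {ws : List (ZMod p → ℂ)} {L : List (ZMod p → ℝ)}
    (h : List.Forall₂ (fun w l => ∀ x, ‖w x‖ ≤ l x) ws L) {W : ZMod p → ℂ} {T : ZMod p → ℝ}
    (hW : ∀ x, ‖W x‖ ≤ T x) (x : ZMod p) : ‖cfold ws W x‖ ≤ mfold L T x := by
  induction h generalizing x with
  | nil => exact hW x
  | cons hw _ ih => exact norm_cconv_le hw ih x

lemma ofReal_mfold (L : List (ZMod p → ℝ)) (T : ZMod p → ℝ) :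
    (fun z => (mfold L T z : ℂ)) = cfold (L.map fun l x => (l x : ℂ)) fun x => (T x : ℂ) := by
  induction L with
  | nil => rfl
  | cons l L ih =>
    simp only [List.map_cons, mfold, cfold, List.foldr_cons] at ih ⊢
    rw [ofReal_mconv, ih]

lemma ft_cfold (L : List (ZMod p → ℂ)) (V : ZMod p → ℂ) (c : ZMod p) :
    ft (cfold L V) c = ∑ v, V v * ft (cfold L (Pi.single 1 1)) (c * v) := by
  induction L generalizing c with
  | nil => simp [cfold, ft, Pi.single_apply]
  | cons f L ih =>
    simp only [cfold, List.foldr_cons] at ih ⊢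
    simp_rw [ft_cconv, ih _, Finset.mul_sum]
    rw [Finset.sum_comm]
    refine Finset.sum_congr rfl fun v _ => Finset.sum_congr rfl fun x _ => ?_
    rw [mul_right_comm c x v]
    ring

lemma sum_norm_ft_cconv_le {ν : ZMod p → ℝ} (hν : IsProb ν) {w W : ZMod p → ℂ} {l : ZMod p → ℝ}
    (hw : ∀ x, ‖w x‖ ≤ l x) :
    ∑ b, ν b * ‖ft (cconv w W) b‖ ≤ ∑ b, ν b * ∑ x, l x * ‖ft W (b * x)‖ := by
  refine Finset.sum_le_sum fun b _ => mul_le_mul_of_nonneg_left ?_ (hν.nonneg b)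
  rw [ft_cconv]
  refine (norm_sum_le _ _).trans (Finset.sum_le_sum fun x _ => ?_)
  rw [norm_mul]
  exact mul_le_mul_of_nonneg_right (hw x) (norm_nonneg _)

lemma Flattens.exists_fold {s r : ℕ} {P A K : ℝ} (hFL : Flattens p r P A K) (hs : 1 ≤ s)
    (hA : 0 ≤ A) (hK : 1 ≤ K) {T : ZMod p → ℝ} (hT : IsProb T) {L : List (ZMod p → ℝ)}
    (hL : ∀ l ∈ L, IsSpread s P l) {ν : ZMod p → ℝ} (hν : IsProb ν) (hν0 : ν 0 ≤ 2 * P)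
    {β : ℝ} (hβ0 : 0 ≤ β) (hβ1 : β ≤ 1 / 2)
    (hPβ : 2 * P ≤ β ^ (2 ^ (s + 1 + r)) ^ L.length)
    (h : β ≤ ∑ b, ν b * ‖ft (fun y => (mfold L T y : ℂ)) b‖) :
    ∃ ν' : ZMod p → ℝ, IsProb ν' ∧ ν' 0 ≤ 2 * P ∧
      ∑ z, ν' z ^ 2 ≤ max A ((K ^ L.length)⁻¹ * ∑ z, ν z ^ 2) ∧
      β ^ (2 ^ (s + 1 + r)) ^ L.length ≤ ∑ b, ν' b * ‖ft (fun y => (T y : ℂ)) b‖ := by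
  induction L generalizing ν β with
  | nil => exact ⟨ν, hν, hν0, by simp, by simpa [mfold] using h⟩
  | cons l L ih =>
    set D := 2 ^ (s + 1 + r) with hD
    have hD1 : 1 ≤ D := Nat.one_le_two_pow
    have hl := hL l (by simp)
    have hL' : ∀ l ∈ L, IsSpread s P l := fun l' h' => hL l' (by simp [h'])
    have hfold := isProb_mfold (fun l h => (hL' l h).isProb) hT
    have hlen : β ^ D ^ (L.length + 1) = (β ^ D) ^ D ^ L.length := by rw [pow_succ', pow_mul]
    rw [List.length_cons, hlen] at hPβ ⊢
    have hβD : β ^ D ≤ β := by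
      calc β ^ D ≤ β ^ 1 := pow_le_pow_of_le_one hβ0 (by linarith) hD1
        _ = β := pow_one β
    have hβD0 : 0 ≤ β ^ D := by positivity
    have hdd : (β ^ D) ^ D ^ L.length ≤ β ^ D := by
      calc (β ^ D) ^ D ^ L.length ≤ (β ^ D) ^ 1 :=
            pow_le_pow_of_le_one hβD0 (by linarith) (Nat.one_le_pow _ _ hD1)
        _ = β ^ D := pow_one _
    obtain ⟨ν₁, h1, h2, h3, h4⟩ := hFL.exists_step hs hl hν hν0
      (W := fun y => (mfold L T y : ℂ)) hfold (fun x => by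
        rw [Complex.norm_real, Real.norm_of_nonneg (hfold.nonneg x)]) hβ0 hβ1
      (hPβ.trans hdd) (by
        refine h.trans ?_
        change ∑ b, ν b * ‖ft (fun y => (mconv l (mfold L T) y : ℂ)) b‖ ≤ _
        rw [ofReal_mconv]
        exact sum_norm_ft_cconv_le hν fun x => by
          rw [Complex.norm_real, Real.norm_of_nonneg (hl.isProb.nonneg x)])
    obtain ⟨ν₂, k1, k2, k3, k4⟩ := ih hL' h1 h2 hβD0 (hβD.trans hβ1) hPβ h4
    refine ⟨ν₂, k1, k2, k3.trans (max_le (le_max_left _ _) ?_), k4⟩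
    have hKL : 1 ≤ K ^ L.length := one_le_pow₀ hK
    have hKi : (K ^ L.length)⁻¹ ≤ 1 := inv_le_one_of_one_le₀ hKL
    have hKi0 : 0 ≤ (K ^ L.length)⁻¹ := by positivity
    refine (mul_le_mul_of_nonneg_left h3 hKi0).trans ?_
    rw [mul_max_of_nonneg _ _ hKi0]
    refine max_le_max (mul_le_of_le_one_left hA hKi) (le_of_eq ?_)
    rw [pow_succ, mul_inv, mul_assoc]

lemma ofReal_single {p : ℕ} (b : ZMod p) :
    (fun x => (((Pi.single b (1 : ℝ) : ZMod p → ℝ) x : ℝ) : ℂ)) = Pi.single b 1 := by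
  ext x
  by_cases h : x = b
  · subst h; simp
  · simp [h]

/-- Two rounds of flattening, with the roles of the variables exchanged in between, leave no room
for a large multilinear exponential sum. -/
theorem Flattens.false_of_le_norm {s r : ℕ} {P A K : ℝ} (hFL : Flattens p r P A K) (hs : 1 ≤ s)
    (hP : 0 ≤ P) (hA : 0 ≤ A) (hK : 1 ≤ K) {l₁ l₂ : ZMod p → ℝ} {L₁ L₂ : List (ZMod p → ℝ)}
    (hl₁ : IsSpread s P l₁) (hl₂ : IsSpread s P l₂) (hL₁ : ∀ l ∈ L₁, IsSpread s P l)
    (hL₂ : ∀ l ∈ L₂, IsSpread s P l) {ws : List (ZMod p → ℂ)}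
    (hws : List.Forall₂ (fun w l => ∀ x, ‖w x‖ ≤ l x) ws (l₁ :: (L₁ ++ l₂ :: L₂)))
    {b : ZMod p} (hb : b ≠ 0) {β : ℝ} (hβ0 : 0 ≤ β) (hβ1 : β ≤ 1 / 2)
    (hPβ : 2 * P ≤ β ^ (2 ^ (s + 1 + r)) ^ (L₁.length + L₂.length + 2))
    (hfin : max A (K ^ (L₁.length + 1))⁻¹ * max A (K ^ (L₂.length + 1))⁻¹ * p <
      (β ^ (2 ^ (s + 1 + r)) ^ (L₁.length + L₂.length + 2)) ^ 2)
    (h : β ≤ ‖ft (cfold ws (Pi.single 1 1)) b‖) : False := by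
  set D := 2 ^ (s + 1 + r) with hD
  have hD1 : 1 ≤ D := Nat.one_le_two_pow
  have hmono : ∀ i j, i ≤ j → β ^ D ^ j ≤ β ^ D ^ i := fun i j hij =>
    pow_le_pow_of_le_one hβ0 (by linarith) (Nat.pow_le_pow_right hD1 hij)
  have hhalf : ∀ i, β ^ D ^ i ≤ 1 / 2 := fun i => by
    have := hmono 0 i (Nat.zero_le _)
    rw [pow_zero, pow_one] at this
    linarith
  have hpos : ∀ i, 0 ≤ β ^ D ^ i := fun i => by positivity
  have hpp : ∀ i j, (β ^ D ^ i) ^ D ^ j = β ^ D ^ (i + j) := fun i j => by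
    rw [← pow_mul, ← pow_add]
  have hone := isProb_single (p := p) 1
  obtain _ | ⟨hw, hws'⟩ := hws
  rename_i w ws'
  have hT₂ : IsProb (mfold (l₂ :: L₂) (Pi.single 1 1 : ZMod p → ℝ)) := by
    refine isProb_mfold (fun l hl => ?_) hone
    rcases List.mem_cons.1 hl with rfl | hl
    exacts [hl₂.isProb, (hL₂ l hl).isProb]
  have hT₁ : IsProb (mfold (L₁ ++ l₂ :: L₂) (Pi.single 1 1 : ZMod p → ℝ)) := by
    rw [mfold, List.foldr_append]
    exact isProb_mfold (fun l hl => (hL₁ l hl).isProb) hT₂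
  have hKinv : ∀ i, (0 : ℝ) ≤ (K ^ i)⁻¹ := fun i => by positivity
  have hKinv1 : ∀ i, (K ^ i)⁻¹ ≤ 1 := fun i => inv_le_one_of_one_le₀ (one_le_pow₀ hK)
  have hcomb : ∀ i : ℕ, ∀ x y : ℝ, x ≤ max A (K⁻¹ * 1) → y ≤ max A ((K ^ i)⁻¹ * x) →
      y ≤ max A (K ^ (i + 1))⁻¹ := by
    intro i x y hx hy
    refine hy.trans (max_le (le_max_left _ _) ?_)
    refine (mul_le_mul_of_nonneg_left hx (hKinv i)).trans ?_
    rw [mul_max_of_nonneg _ _ (hKinv i)]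
    refine max_le_max (mul_le_of_le_one_left hA (hKinv1 i)) (le_of_eq ?_)
    rw [pow_succ, mul_inv, mul_one]
  have hsb : ∀ (c : ZMod p) (F : ZMod p → ℝ),
      ∑ x, (Pi.single c (1 : ℝ) : ZMod p → ℝ) x * F x = F c := fun c F => by
    simp [Pi.single_apply]
  obtain ⟨ν₁, hν₁, hν₁0, hν₁s, hν₁β⟩ := hFL.exists_step hs hl₁ (isProb_single b)
    (by simp [hb.symm, hP]) (W := cfold ws' (Pi.single 1 1)) hT₁
    (norm_cfold_le hws' fun x => by
      by_cases hx : x = 1 <;> simp [hx]) hβ0 hβ1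
    (hPβ.trans (by simpa using hmono 1 _ (by omega))) (by
      refine le_trans ?_ (sum_norm_ft_cconv_le (isProb_single b) hw)
      rw [hsb]
      exact h)
  rw [sum_single_sq] at hν₁s
  have hν₁β' : β ^ D ^ 1 ≤ ∑ b, ν₁ b * ‖ft (fun y => (mfold L₁ (mfold (l₂ :: L₂)
      (Pi.single 1 1 : ZMod p → ℝ)) y : ℂ)) b‖ := by
    rw [pow_one]
    simpa only [mfold, List.foldr_append] using hν₁β
  obtain ⟨ν₂, hν₂, hν₂0, hν₂s, hν₂β⟩ := hFL.exists_fold hs hA hK hT₂ hL₁ hν₁ hν₁0 (hpos 1)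
    (hhalf 1) (by rw [hpp]; exact hPβ.trans (hmono _ _ (by omega))) hν₁β'
  replace hν₂s := hcomb _ _ _ hν₁s hν₂s
  rw [hpp] at hν₂β
  choose c hc1 hc using fun b => exists_mul_eq_norm
    (ft (fun y => (mfold (l₂ :: L₂) (Pi.single 1 1 : ZMod p → ℝ) y : ℂ)) b)
  set V : ZMod p → ℂ := fun b => ν₂ b * c b with hV
  have hVn : ∀ x, ‖V x‖ ≤ ν₂ x := fun x => by
    rw [hV, norm_mul, Complex.norm_real, Real.norm_of_nonneg (hν₂.nonneg x)]
    exact mul_le_of_le_one_right (hν₂.nonneg x) (hc1 x)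
  set cs : List (ZMod p → ℂ) := L₂.map fun l x => (l x : ℂ) with hcs
  have hswap : ((∑ b, ν₂ b * ‖ft (fun y => (mfold (l₂ :: L₂)
      (Pi.single 1 1 : ZMod p → ℝ) y : ℂ)) b‖ : ℝ) : ℂ) =
      ft (cconv (fun x => (l₂ x : ℂ)) (cfold cs V)) 1 := by
    have := ft_cfold ((fun x => (l₂ x : ℂ)) :: cs) V 1
    simp only [cfold, List.foldr_cons] at this ⊢
    rw [this]
    push_cast
    refine Finset.sum_congr rfl fun v _ => ?_
    rw [← hc, ofReal_mfold, ofReal_single, one_mul, hV]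
    simp only [cfold, List.map_cons, List.foldr_cons, ← hcs]
    ring
  have hcsF : List.Forall₂ (fun (w : ZMod p → ℂ) (l : ZMod p → ℝ) => ∀ x, ‖w x‖ ≤ l x) cs L₂ := by
    rw [hcs, List.forall₂_map_left_iff, List.forall₂_same]
    intro l hl x
    rw [Complex.norm_real, Real.norm_of_nonneg ((hL₂ l hl).isProb.nonneg x)]
  obtain ⟨ν₃, hν₃, hν₃0, hν₃s, hν₃β⟩ := hFL.exists_step hs hl₂ (isProb_single 1)
    (by simp [hP]) (W := cfold cs V)
    (isProb_mfold (fun l hl => (hL₂ l hl).isProb) hν₂) (norm_cfold_le hcsF hVn)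
    (hpos (1 + L₁.length)) (hhalf _) (by
      have := hpp (1 + L₁.length) 1
      rw [pow_one] at this
      rw [this]
      exact hPβ.trans (hmono _ _ (by omega))) (by
      refine hν₂β.trans (le_trans ?_ (sum_norm_ft_cconv_le (isProb_single 1) (w := fun x => (l₂ x : ℂ))
        fun x => by rw [Complex.norm_real, Real.norm_of_nonneg (hl₂.isProb.nonneg x)]))
      rw [hsb, ← hswap, Complex.norm_real]
      exact le_abs_self _)
  rw [sum_single_sq] at hν₃s
  have e := hpp (1 + L₁.length) 1
  rw [pow_one] at e
  rw [e] at hν₃β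
  obtain ⟨ν₄, hν₄, hν₄0, hν₄s, hν₄β⟩ := hFL.exists_fold hs hA hK hν₂ hL₂ hν₃ hν₃0 (hpos _)
    (hhalf _) (by rw [hpp]; exact hPβ.trans (hmono _ _ (by omega))) hν₃β
  replace hν₄s := hcomb _ _ _ hν₃s hν₄s
  rw [hpp] at hν₄β
  have e2 : 1 + L₁.length + 1 + L₂.length = L₁.length + L₂.length + 2 := by ring
  rw [e2] at hν₄β
  have h1 := pow_le_pow_left₀ (hpos _) hν₄β 2
  have h2 := sum_mul_norm_ft_le ν₄ fun y => (ν₂ y : ℂ)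
  simp only [Complex.norm_real, Real.norm_eq_abs, sq_abs] at h1 h2
  have h3 : (∑ c, ν₄ c ^ 2) * (p * ∑ y, ν₂ y ^ 2) ≤
      max A (K ^ (L₂.length + 1))⁻¹ * (p * max A (K ^ (L₁.length + 1))⁻¹) := by
    gcongr
  have h4 : max A (K ^ (L₂.length + 1))⁻¹ * (p * max A (K ^ (L₁.length + 1))⁻¹) =
      max A (K ^ (L₁.length + 1))⁻¹ * max A (K ^ (L₂.length + 1))⁻¹ * p := by ring
  linarith

end Amplification

section Divisors

/-- The divisor bound `d(n) ≪ n ^ ε`. -/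
theorem exists_card_divisors_le {ε : ℝ} (hε : 0 < ε) :
    ∃ C : ℝ, 1 ≤ C ∧ ∀ n : ℕ, n ≠ 0 → (#n.divisors : ℝ) ≤ C * (n : ℝ) ^ ε := by
  set B : ℝ := 1 + 1 / (ε * Real.log 2) with hB
  have hlog : 0 < Real.log 2 := Real.log_pos (by norm_num)
  have hB1 : 1 ≤ B := by
    have : 0 ≤ 1 / (ε * Real.log 2) := by positivity
    linarith
  obtain ⟨Q, hQ⟩ := exists_nat_ge ((2 : ℝ) ^ (1 / ε))
  refine ⟨B ^ Q, one_le_pow₀ hB1, fun n hn => ?_⟩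
  have hk : ∀ q : ℕ, q.Prime → ∀ k : ℕ,
      ((k + 1 : ℕ) : ℝ) ≤ (if q < Q then B else 1) * ((q : ℝ) ^ k) ^ ε := by
    intro q hq k
    have hq2 : (2 : ℝ) ≤ q := by exact_mod_cast hq.two_le
    have hcomm : ((q : ℝ) ^ k) ^ ε = ((q : ℝ) ^ ε) ^ k := by
      rw [← Real.rpow_natCast, ← Real.rpow_mul (by positivity), mul_comm,
        Real.rpow_mul (by positivity), Real.rpow_natCast]
    split_ifs with hqQ
    · have h1 : 1 + k * (ε * Real.log 2) ≤ ((q : ℝ) ^ k) ^ ε := by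
        calc 1 + k * (ε * Real.log 2) ≤ Real.exp (k * (ε * Real.log 2)) := by
              linarith [Real.add_one_le_exp (k * (ε * Real.log 2))]
          _ = ((2 : ℝ) ^ k) ^ ε := by
              rw [Real.rpow_def_of_pos (by positivity), Real.log_pow]
              ring_nf
          _ ≤ _ := by gcongr
      push_cast
      calc (k : ℝ) + 1 ≤ B * (1 + k * (ε * Real.log 2)) := by
            rw [hB]
            have h2 : 0 ≤ 1 / (ε * Real.log 2) := by positivity
            have h3 : 1 / (ε * Real.log 2) * (k * (ε * Real.log 2)) = k := by field_simp
            have h4 : 0 ≤ k * (ε * Real.log 2) := by positivity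
            linarith
        _ ≤ _ := by gcongr
    · have h2 : (2 : ℝ) ≤ (q : ℝ) ^ ε := by
        calc (2 : ℝ) = ((2 : ℝ) ^ (1 / ε)) ^ ε := by
              rw [← Real.rpow_mul (by norm_num), one_div_mul_cancel hε.ne', Real.rpow_one]
          _ ≤ (q : ℝ) ^ ε := by
              gcongr
              exact hQ.trans (by exact_mod_cast not_lt.1 hqQ)
      rw [one_mul, hcomm]
      calc ((k + 1 : ℕ) : ℝ) ≤ ((2 ^ k : ℕ) : ℝ) := by exact_mod_cast Nat.lt_two_pow_self
        _ = (2 : ℝ) ^ k := by push_cast; rfl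
        _ ≤ _ := by gcongr
  rw [Nat.card_divisors hn]
  push_cast
  have h1 : ∏ q ∈ n.primeFactors, ((n.factorization q : ℝ) + 1) ≤
      ∏ q ∈ n.primeFactors, ((if q < Q then B else 1) * ((q : ℝ) ^ n.factorization q) ^ ε) := by
    refine Finset.prod_le_prod (fun q _ => by positivity) fun q hq => ?_
    exact_mod_cast hk q (Nat.prime_of_mem_primeFactors hq) _
  refine h1.trans ?_
  rw [Finset.prod_mul_distrib]
  have h2 : ∏ q ∈ n.primeFactors, ((q : ℝ) ^ n.factorization q) ^ ε = (n : ℝ) ^ ε := by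
    rw [Real.finsetProd_rpow _ _ fun q _ => by positivity]
    congr 1
    exact_mod_cast Nat.prod_factorization_pow_eq_self hn
  rw [h2]
  gcongr
  rw [Finset.prod_ite]
  simp only [Finset.prod_const, one_pow, mul_one]
  refine pow_le_pow_right₀ hB1 ?_
  calc #(n.primeFactors.filter (· < Q)) ≤ #(Finset.range Q) :=
        Finset.card_le_card fun q hq => Finset.mem_range.2 (Finset.mem_filter.1 hq).2
    _ = Q := Finset.card_range Q

/-- Integers of polynomial size in `N` have at most `N ^ ε` divisors. -/
theorem exists_card_divisors_le_rpow (K : ℕ) {ε : ℝ} (hε : 0 < ε) :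
    ∃ N₀ : ℕ, ∀ N : ℕ, N₀ ≤ N → ∀ n : ℕ, n ≠ 0 → n ≤ N ^ K → (#n.divisors : ℝ) ≤ (N : ℝ) ^ ε := by
  obtain ⟨C, hC1, hC⟩ := exists_card_divisors_le (ε := ε / (2 * (K + 1))) (by positivity)
  obtain ⟨N₀, hN₀⟩ := exists_nat_ge (C ^ (2 / ε))
  refine ⟨N₀ + 1, fun N hN n hn hnN => (hC n hn).trans ?_⟩
  have hN1 : (1 : ℝ) ≤ N := by exact_mod_cast (by omega : 1 ≤ N)
  have h1 : C ≤ (N : ℝ) ^ (ε / 2) := by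
    calc C = (C ^ (2 / ε)) ^ (ε / 2) := by
          rw [← Real.rpow_mul (by linarith), show 2 / ε * (ε / 2) = 1 by field_simp, Real.rpow_one]
      _ ≤ _ := by
          gcongr
          exact hN₀.trans (by exact_mod_cast (by omega : N₀ ≤ N))
  have h2 : (n : ℝ) ^ (ε / (2 * (K + 1))) ≤ (N : ℝ) ^ (ε / 2) := by
    calc (n : ℝ) ^ (ε / (2 * (K + 1))) ≤ ((N : ℝ) ^ K) ^ (ε / (2 * (K + 1))) := by
          gcongr
          exact_mod_cast hnN
      _ = (N : ℝ) ^ (K * (ε / (2 * (K + 1)))) := by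
          rw [← Real.rpow_natCast, ← Real.rpow_mul (by linarith)]
      _ ≤ _ := by
          refine Real.rpow_le_rpow_of_exponent_le hN1 ?_
          rw [← mul_div_assoc, div_le_div_iff₀ (by positivity) (by norm_num)]
          nlinarith
  calc C * (n : ℝ) ^ (ε / (2 * (K + 1))) ≤ (N : ℝ) ^ (ε / 2) * (N : ℝ) ^ (ε / 2) := by gcongr
    _ = (N : ℝ) ^ ε := by rw [← Real.rpow_add (by linarith)]; ring_nf

end Divisors

section Counting
open Polynomial

/-- Counting tuples whose entries are confined to few choices, given the preceding entries. -/
lemma card_le_prod_of_initial {α : Type*} [DecidableEq α] [Inhabited α] {m : ℕ}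
    (S : Finset (Fin m → α)) (F : (Fin m → α) → Fin m → Finset α) (b : Fin m → ℝ)
    (hb0 : ∀ i, 0 ≤ b i)
    (hF : ∀ h ∈ S, ∀ i, h i ∈ F h i) (hb : ∀ h ∈ S, ∀ i, (#(F h i) : ℝ) ≤ b i)
    (hpre : ∀ h ∈ S, ∀ h' ∈ S, ∀ i, (∀ j < i, h j = h' j) → F h i = F h' i) :
    (#S : ℝ) ≤ ∏ i, b i := by
  set r : ℕ → (Fin m → α) → Fin m → α := fun k h i => if (i : ℕ) < k then h i else default with hr
  have key : ∀ k ≤ m, (#(S.image (r k)) : ℝ) ≤ ∏ i with (i : Fin m).val < k, b i := by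
    intro k
    induction k with
    | zero =>
      intro _
      have : S.image (r 0) ⊆ {fun _ => default} := by
        intro u hu
        obtain ⟨h, _, rfl⟩ := Finset.mem_image.1 hu
        simp [hr]
      simpa using Finset.card_le_card this
    | succ k ih =>
      intro hk
      have hprod : ∏ i with (i : Fin m).val < k + 1, b i =
          b ⟨k, hk⟩ * ∏ i with (i : Fin m).val < k, b i := by
        rw [← Finset.prod_insert (by simp)]
        refine Finset.prod_congr ?_ fun _ _ => rfl
        ext i
        simp only [Finset.mem_filter, Finset.mem_univ, true_and, Finset.mem_insert, Fin.ext_iff]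
        omega
      have hfib : ∀ v ∈ S.image (r k), ∀ _ : True,
          (#((S.image (r (k + 1))).filter fun u => r k u = v) : ℝ) ≤ b ⟨k, hk⟩ := by
        intro v hv _
        obtain ⟨h₁, hh₁, rfl⟩ := Finset.mem_image.1 hv
        refine le_trans ?_ (hb h₁ hh₁ ⟨k, hk⟩)
        norm_cast
        refine Finset.card_le_card_of_injOn (fun u => u ⟨k, hk⟩) ?_ ?_
        · intro u hu
          obtain ⟨hu1, hu2⟩ := Finset.mem_filter.1 hu
          obtain ⟨h, hh, rfl⟩ := Finset.mem_image.1 hu1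
          have hagree : ∀ j < (⟨k, hk⟩ : Fin m), h₁ j = h j := by
            intro j hj
            have hjk : (j : ℕ) < k := hj
            have := congrFun hu2 j
            simp only [hr, hjk, if_true, Nat.lt_succ_of_lt hjk] at this
            exact this.symm
          rw [Finset.mem_coe, hpre h₁ hh₁ h hh _ hagree]
          simpa [hr] using hF h hh ⟨k, hk⟩
        · intro u hu u' hu' huu
          obtain ⟨hu1, hu2⟩ := Finset.mem_filter.1 hu
          obtain ⟨hu1', hu2'⟩ := Finset.mem_filter.1 hu'
          obtain ⟨h, hh, rfl⟩ := Finset.mem_image.1 hu1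
          obtain ⟨h', hh', rfl⟩ := Finset.mem_image.1 hu1'
          ext i
          by_cases hi : (i : ℕ) < k
          · have := congrFun (hu2.trans hu2'.symm) i
            simpa [hr, hi] using this
          · by_cases hi' : (i : ℕ) = k
            · have : i = ⟨k, hk⟩ := Fin.ext hi'
              rw [this]; exact huu
            · have : ¬ (i : ℕ) < k + 1 := by omega
              simp [hr, this]
      have hmaps : ∀ u ∈ S.image (r (k + 1)), r k u ∈ S.image (r k) := by
        intro u hu
        obtain ⟨h, hh, rfl⟩ := Finset.mem_image.1 hu
        refine Finset.mem_image.2 ⟨h, hh, ?_⟩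
        ext i
        by_cases hi : (i : ℕ) < k
        · simp only [hr, hi, if_true, Nat.lt_succ_of_lt hi]
        · simp [hr, hi]
      rw [Finset.card_eq_sum_card_fiberwise hmaps, hprod]
      push_cast
      calc ∑ v ∈ S.image (r k), (#((S.image (r (k + 1))).filter fun u => r k u = v) : ℝ)
          ≤ #(S.image (r k)) • b ⟨k, hk⟩ :=
            Finset.sum_le_card_nsmul _ _ _ fun v hv => hfib v hv trivial
        _ = b ⟨k, hk⟩ * #(S.image (r k)) := by rw [nsmul_eq_mul, mul_comm]
        _ ≤ _ := mul_le_mul_of_nonneg_left (ih (by omega)) (hb0 _)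
  have hid : S.image (r m) = S := by
    have : r m = id := by ext h i; simp [hr]
    rw [this, Finset.image_id]
  have hall : (Finset.univ.filter fun i : Fin m => i.val < m) = Finset.univ := by
    ext i; simp
  have := key m le_rfl
  rwa [hid, hall] at this

lemma dvd_pow_card_mul {ι : Type*} [DecidableEq ι] (s : Finset ι) (a : ℤ) (b : ι → ℤ) (L : ℤ)
    (hL : ∀ j ∈ s, ((Int.gcd a (b j) : ℕ) : ℤ) ∣ L) (c : ℤ) (h : a ∣ (∏ j ∈ s, b j) * c) :
    a ∣ L ^ #s * c := by
  induction s using Finset.induction_on generalizing c with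
  | empty => simpa using h
  | insert j s hj ih =>
    rw [Finset.prod_insert hj, mul_assoc] at h
    have h1 : a ∣ L * ((∏ j ∈ s, b j) * c) := by
      have h2 : a ∣ ((Int.gcd a (b j) : ℕ) : ℤ) * ((∏ j ∈ s, b j) * c) := by
        have := dvd_gcd_mul_of_dvd_mul h
        rwa [← Int.coe_gcd] at this
      exact h2.trans (mul_dvd_mul_right (hL j (by simp)) _)
    rw [Finset.card_insert_of_notMem hj, pow_succ, mul_assoc]
    refine ih (fun j hj => hL j (by simp [hj])) (L * c) ?_
    convert h1 using 1
    ring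

/-- Divisors of powers of small numbers. -/
def IsSmallRadical (m N : ℕ) (v : ℤ) : Prop := ∃ L : ℕ, 0 < L ∧ L ^ 2 ≤ N ∧ v ∣ (L : ℤ) ^ m

/-- The `i`-th entry is strongly constrained by the preceding ones. -/
def IsConstrained {m : ℕ} (g : ℤ[X]) (N : ℕ) (h : Fin m → ℤ) (i : Fin m) : Prop :=
  IsSmallRadical m N (g.eval (h i)) ∨
    N < ((Finset.univ.filter (· < i)).lcm fun j => Int.gcd (g.eval (h i)) (h i - h j)) ^ 4

lemma isConstrained_or_rev {m : ℕ} {g : ℤ[X]} {N : ℕ} {h : Fin m → ℤ} {i : Fin m}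
    (hg : g.eval (h i) ≠ 0)
    (hdvd : g.eval (h i) ∣ ∏ j ∈ Finset.univ.erase i, (h j - h i)) :
    IsConstrained g N h i ∨ IsConstrained g N (h ∘ Fin.rev) (Fin.rev i) := by
  by_contra! hcon
  obtain ⟨h1, h2⟩ := hcon
  rw [IsConstrained] at h1 h2
  push Not at h1 h2
  obtain ⟨h1, h1'⟩ := h1
  obtain ⟨-, h2'⟩ := h2
  set L₁ := (Finset.univ.filter (· < i)).lcm fun j => Int.gcd (g.eval (h i)) (h i - h j) with hL₁
  set L₂ := (Finset.univ.filter (· < Fin.rev i)).lcm fun j =>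
    Int.gcd (g.eval ((h ∘ Fin.rev) (Fin.rev i))) ((h ∘ Fin.rev) (Fin.rev i) - (h ∘ Fin.rev) j)
    with hL₂
  have hgcd : ∀ x, Int.gcd (g.eval (h i)) x ≠ 0 := fun x => by
    rw [Ne, Int.gcd_eq_zero_iff]; tauto
  have hL₁0 : L₁ ≠ 0 := by
    rw [hL₁, Ne, Finset.lcm_eq_zero_iff]
    simp [hg]
  have hL₂0 : L₂ ≠ 0 := by
    rw [hL₂, Ne, Finset.lcm_eq_zero_iff]
    simp [hg]
  refine h1 ⟨L₁ * L₂, Nat.pos_of_ne_zero (mul_ne_zero hL₁0 hL₂0), ?_, ?_⟩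
  · have : ((L₁ * L₂) ^ 2) ^ 2 ≤ N ^ 2 := by
      calc ((L₁ * L₂) ^ 2) ^ 2 = L₁ ^ 4 * L₂ ^ 4 := by ring
        _ ≤ N * N := Nat.mul_le_mul h1' h2'
        _ = N ^ 2 := by ring
    exact (Nat.pow_le_pow_iff_left (by norm_num)).1 this
  · have h3 := dvd_pow_card_mul (Finset.univ.erase i) (g.eval (h i)) (fun j => h j - h i)
      ((L₁ * L₂ : ℕ) : ℤ) (fun j hj => by
        rw [Int.natCast_dvd_natCast]
        have hgs : Int.gcd (g.eval (h i)) (h j - h i) = Int.gcd (g.eval (h i)) (h i - h j) := by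
          rw [← Int.gcd_neg, neg_sub]
        rw [hgs]
        rcases lt_or_gt_of_ne (Finset.ne_of_mem_erase hj) with hlt | hgt
        · exact Dvd.dvd.mul_right (Finset.dvd_lcm (f := fun j => Int.gcd (g.eval (h i)) (h i - h j))
            (by simpa using hlt)) _
        · refine Dvd.dvd.mul_left ?_ _
          have := Finset.dvd_lcm (s := Finset.univ.filter (· < Fin.rev i)) (f := fun j =>
            Int.gcd (g.eval ((h ∘ Fin.rev) (Fin.rev i)))
              ((h ∘ Fin.rev) (Fin.rev i) - (h ∘ Fin.rev) j)) (b := Fin.rev j)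
            (by simpa using hgt)
          simpa [hL₂] using this) 1 (by simpa using hdvd)
    rw [mul_one] at h3
    refine h3.trans (pow_dvd_pow _ ?_)
    simp

/-- Integers of `[1, N]` in a single class modulo `E`. -/
lemma card_le_div_add_one {N E : ℕ} (hE : 0 < E) (T : Finset ℤ) (hT : ∀ x ∈ T, x ∈ Finset.Icc (1 : ℤ) N)
    (hmod : ∀ x ∈ T, ∀ y ∈ T, (E : ℤ) ∣ x - y) : #T ≤ N / E + 1 := by
  have h1 : #T ≤ #(Finset.Icc (0 : ℤ) ((N / E : ℕ) : ℤ)) := by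
    refine Finset.card_le_card_of_injOn (fun x => x / (E : ℤ)) ?_ ?_
    · intro x hx
      have := Finset.mem_Icc.1 (hT x hx)
      simp only [Finset.coe_Icc, Set.mem_Icc]
      refine ⟨Int.ediv_nonneg (by omega) (by omega), ?_⟩
      push_cast
      exact Int.ediv_le_ediv (by exact_mod_cast hE) this.2
    · intro x hx y hy hxy
      have h3 : x % E = y % E := Int.ModEq.symm (Int.modEq_iff_dvd.2 (hmod x hx y hy))
      have h4 := Int.mul_ediv_add_emod x E
      have h5 := Int.mul_ediv_add_emod y E
      simp only at hxy
      rw [hxy, h3] at h4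
      exact h4.symm.trans h5
  refine h1.trans ?_
  simp

lemma card_eval_eq_le {g : ℤ[X]} (hg : 1 ≤ g.natDegree) (v : ℤ) (T : Finset ℤ)
    (hT : ∀ x ∈ T, g.eval x = v) : #T ≤ g.natDegree := by
  have h0 : g - C v ≠ 0 := by
    intro h
    rw [sub_eq_zero] at h
    rw [h, natDegree_C] at hg
    omega
  have h1 : T ⊆ (g - C v).roots.toFinset := by
    intro x hx
    rw [Multiset.mem_toFinset, mem_roots h0]
    simp [hT x hx]
  calc #T ≤ #(g - C v).roots.toFinset := Finset.card_le_card h1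
    _ ≤ Multiset.card (g - C v).roots := Multiset.toFinset_card_le _
    _ ≤ (g - C v).natDegree := card_roots' _
    _ = g.natDegree := natDegree_sub_C

end Counting

section CountingBound
open Polynomial

lemma card_isSmallRadical_le {m N : ℕ} {g : ℤ[X]} (hg : 1 ≤ g.natDegree) (hgm : g.natDegree ≤ m)
    {D : ℝ} (hD : ∀ n : ℕ, n ≠ 0 → n ≤ N ^ (5 * m) → (#n.divisors : ℝ) ≤ D)
    (T : Finset ℤ) (hT : ∀ x ∈ T, IsSmallRadical m N (g.eval x)) :
    (#T : ℝ) ≤ N.sqrt * (D * (2 * m)) := by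
  classical
  have hsub : T ⊆ (Finset.Icc 1 N.sqrt).biUnion fun L => (L ^ m).divisors.biUnion fun d =>
      T.filter fun x => (g.eval x).natAbs = d := by
    intro x hx
    obtain ⟨L, hL0, hLN, hdvd⟩ := hT x hx
    simp only [Finset.mem_biUnion, Finset.mem_Icc, Finset.mem_filter, Nat.mem_divisors]
    refine ⟨L, ⟨hL0, Nat.le_sqrt'.2 hLN⟩, _, ⟨?_, by positivity⟩, hx, rfl⟩
    have := Int.natAbs_dvd_natAbs.2 hdvd
    simpa [Int.natAbs_pow] using this
  have h1 : ∀ d : ℕ, #(T.filter fun x => (g.eval x).natAbs = d) ≤ 2 * m := by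
    intro d
    have hs : (T.filter fun x => (g.eval x).natAbs = d) ⊆
        (T.filter fun x => g.eval x = d) ∪ (T.filter fun x => g.eval x = -d) := by
      intro x hx
      simp only [Finset.mem_filter, Finset.mem_union] at hx ⊢
      rcases Int.natAbs_eq_iff.1 hx.2 with h | h <;> tauto
    have ha := card_eval_eq_le hg d (T.filter fun x => g.eval x = d) fun x hx =>
      (Finset.mem_filter.1 hx).2
    have hb := card_eval_eq_le hg (-d) (T.filter fun x => g.eval x = -d) fun x hx =>
      (Finset.mem_filter.1 hx).2
    have := (Finset.card_le_card hs).trans (Finset.card_union_le _ _)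
    omega
  have hLm : ∀ L ∈ Finset.Icc 1 N.sqrt, L ^ m ≤ N ^ (5 * m) := by
    intro L hL
    have hLN : L ≤ N := (Finset.mem_Icc.1 hL).2.trans (Nat.sqrt_le_self N)
    have hN : 1 ≤ N := (Finset.mem_Icc.1 hL).1.trans hLN
    exact (Nat.pow_le_pow_left hLN m).trans (Nat.pow_le_pow_right hN (by omega))
  calc (#T : ℝ) ≤ ((∑ L ∈ Finset.Icc 1 N.sqrt, #((L ^ m).divisors.biUnion fun d =>
      T.filter fun x => (g.eval x).natAbs = d) : ℕ) : ℝ) := by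
        exact_mod_cast (Finset.card_le_card hsub).trans Finset.card_biUnion_le
    _ = ∑ L ∈ Finset.Icc 1 N.sqrt, ((#((L ^ m).divisors.biUnion fun d =>
      T.filter fun x => (g.eval x).natAbs = d) : ℕ) : ℝ) := by push_cast; rfl
    _ ≤ #(Finset.Icc 1 N.sqrt) • (D * (2 * m)) := by
        refine Finset.sum_le_card_nsmul _ _ _ fun L hL => ?_
        have h2 : #((L ^ m).divisors.biUnion fun d => T.filter fun x => (g.eval x).natAbs = d) ≤
            #(L ^ m).divisors * (2 * m) := Finset.card_biUnion_le_card_mul _ _ _ fun d _ => h1 d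
        have h3 := hD (L ^ m) (by have := (Finset.mem_Icc.1 hL).1; positivity) (hLm L hL)
        calc _ ≤ ((#(L ^ m).divisors * (2 * m) : ℕ) : ℝ) := by exact_mod_cast h2
          _ = (#(L ^ m).divisors : ℝ) * (2 * m) := by push_cast; ring
          _ ≤ _ := by gcongr
    _ = _ := by simp

lemma card_lt_lcm_le {m N : ℕ} (hN : 1 ≤ N) {g : ℤ[X]}
    (hgN : ∀ x ∈ Finset.Icc (1 : ℤ) N, g.eval x ≠ 0 ∧ |g.eval x| ≤ (N : ℤ) ^ (5 * m))
    {D : ℝ} (hD : ∀ n : ℕ, n ≠ 0 → n ≤ N ^ (5 * m) → (#n.divisors : ℝ) ≤ D)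
    {h : Fin m → ℤ} (hh : ∀ i, h i ∈ Finset.Icc (1 : ℤ) N) (i : Fin m)
    (T : Finset ℤ) (hT : ∀ x ∈ T, x ∈ Finset.Icc (1 : ℤ) N)
    (hT' : ∀ x ∈ T, N < ((Finset.univ.filter (· < i)).lcm
      fun j => Int.gcd (g.eval x) (x - h j)) ^ 4) :
    (#T : ℝ) ≤ D ^ m * (2 * (N : ℝ) ^ (3 / 4 : ℝ)) := by
  classical
  set φ : ℤ → Fin m → ℕ := fun x j => if j < i then Int.gcd (g.eval x) (x - h j) else 1 with hφ
  set R := Fintype.piFinset fun j => (g.eval (h j)).natAbs.divisors with hR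
  have hmaps : ∀ x ∈ T, φ x ∈ R := by
    intro x hx
    rw [hR, Fintype.mem_piFinset]
    intro j
    rw [Nat.mem_divisors, Ne, Int.natAbs_eq_zero]
    refine ⟨?_, (hgN _ (hh j)).1⟩
    simp only [hφ]
    split_ifs
    · rw [← Int.natCast_dvd]
      have h1 : ((Int.gcd (g.eval x) (x - h j) : ℕ) : ℤ) ∣ g.eval x - g.eval (h j) :=
        (Int.gcd_dvd_right _ _).trans (sub_dvd_eval_sub _ _ _)
      have h2 : ((Int.gcd (g.eval x) (x - h j) : ℕ) : ℤ) ∣ g.eval x := Int.gcd_dvd_left _ _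
      have := dvd_sub h2 h1
      rwa [sub_sub_cancel] at this
    · exact one_dvd _
  have hR' : (#R : ℝ) ≤ D ^ m := by
    rw [hR, Fintype.card_piFinset]
    push_cast
    calc ∏ j, (#(g.eval (h j)).natAbs.divisors : ℝ) ≤ ∏ _j : Fin m, D := by
          refine Finset.prod_le_prod (fun _ _ => Nat.cast_nonneg _) fun j _ => ?_
          refine hD _ (by simpa using (hgN _ (hh j)).1) ?_
          have := (hgN _ (hh j)).2
          zify
          exact this
      _ = D ^ m := by simp
  have hNpos : (0 : ℝ) < N := by exact_mod_cast hN
  have hfib : ∀ u ∈ R, (#(T.filter fun x => φ x = u) : ℝ) ≤ 2 * (N : ℝ) ^ (3 / 4 : ℝ) := by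
    intro u _
    have hN34 : (1 : ℝ) ≤ (N : ℝ) ^ (3 / 4 : ℝ) :=
      Real.one_le_rpow (by exact_mod_cast hN) (by norm_num)
    rcases (T.filter fun x => φ x = u).eq_empty_or_nonempty with he | ⟨x₀, hx₀⟩
    · rw [he]; simp; positivity
    set E := (Finset.univ.filter (· < i)).lcm fun j => Int.gcd (g.eval x₀) (x₀ - h j) with hE
    obtain ⟨hx₀T, hx₀u⟩ := Finset.mem_filter.1 hx₀
    have hE4 : N < E ^ 4 := hT' x₀ hx₀T
    have hE0 : 0 < E := by
      rcases Nat.eq_zero_or_pos E with h0 | h0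
      · rw [h0] at hE4; simp at hE4
      · exact h0
    have hdvd : ∀ x ∈ T.filter (fun x => φ x = u), ∀ j < i,
        ((Int.gcd (g.eval x₀) (x₀ - h j) : ℕ) : ℤ) ∣ x - h j := by
      intro x hx j hj
      have := congrFun ((Finset.mem_filter.1 hx).2.trans hx₀u.symm) j
      simp only [hφ, hj, if_true] at this
      rw [← this]
      exact Int.gcd_dvd_right _ _
    have hc := card_le_div_add_one hE0 (T.filter fun x => φ x = u)
      (fun x hx => hT x (Finset.mem_filter.1 hx).1) (by
        intro x hx y hy
        rw [Int.natCast_dvd]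
        refine Finset.lcm_dvd fun j hj => ?_
        rw [← Int.natCast_dvd]
        have hj' : j < i := by simpa using hj
        have := dvd_sub (hdvd x hx j hj') (hdvd y hy j hj')
        rwa [sub_sub_sub_cancel_right] at this)
    have hE14 : (N : ℝ) ^ (1 / 4 : ℝ) ≤ E := by
      have : (N : ℝ) ≤ (E : ℝ) ^ 4 := by exact_mod_cast hE4.le
      calc (N : ℝ) ^ (1 / 4 : ℝ) ≤ ((E : ℝ) ^ 4) ^ (1 / 4 : ℝ) :=
            Real.rpow_le_rpow hNpos.le this (by norm_num)
        _ = E := by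
          rw [one_div]
          exact_mod_cast Real.pow_rpow_inv_natCast (n := 4) (Nat.cast_nonneg E) (by norm_num)
    calc (#(T.filter fun x => φ x = u) : ℝ) ≤ ((N / E + 1 : ℕ) : ℝ) := by exact_mod_cast hc
      _ ≤ (N : ℝ) / E + 1 := by push_cast; gcongr; exact Nat.cast_div_le
      _ ≤ (N : ℝ) / (N : ℝ) ^ (1 / 4 : ℝ) + 1 := by gcongr
      _ = (N : ℝ) ^ (3 / 4 : ℝ) + 1 := by
        congr 1
        rw [div_eq_iff (by positivity), ← Real.rpow_add hNpos]; norm_num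
      _ ≤ _ := by linarith
  rw [Finset.card_eq_sum_card_fiberwise hmaps]
  push_cast
  calc _ ≤ #R • (2 * (N : ℝ) ^ (3 / 4 : ℝ)) := Finset.sum_le_card_nsmul _ _ _ hfib
    _ = #R * (2 * (N : ℝ) ^ (3 / 4 : ℝ)) := nsmul_eq_mul _ _
    _ ≤ _ := by gcongr

/-- Tuples with many constrained entries. -/
lemma card_constrained_le {m N : ℕ} {g : ℤ[X]} {B : ℝ} (hB0 : 0 ≤ B)
    (I : Finset (Fin m)) (S : Finset (Fin m → ℤ))
    (hS : ∀ h ∈ S, ∀ i, h i ∈ Finset.Icc (1 : ℤ) N)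
    (hI : ∀ h ∈ S, ∀ i ∈ I, IsConstrained g N h i)
    (hB : ∀ h : Fin m → ℤ, (∀ i, h i ∈ Finset.Icc (1 : ℤ) N) → ∀ i, ∀ T : Finset ℤ,
      (∀ x ∈ T, x ∈ Finset.Icc (1 : ℤ) N ∧ (IsSmallRadical m N (g.eval x) ∨
        N < ((Finset.univ.filter (· < i)).lcm fun j => Int.gcd (g.eval x) (x - h j)) ^ 4)) →
      (#T : ℝ) ≤ B) :
    (#S : ℝ) ≤ B ^ #I * (N : ℝ) ^ (m - #I) := by
  classical
  have key := card_le_prod_of_initial S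
    (fun h i => if i ∈ I then (Finset.Icc (1 : ℤ) N).filter (fun x =>
      IsSmallRadical m N (g.eval x) ∨
        N < ((Finset.univ.filter (· < i)).lcm fun j => Int.gcd (g.eval x) (x - h j)) ^ 4)
      else Finset.Icc (1 : ℤ) N)
    (fun i => if i ∈ I then B else N)
    (fun i => by split_ifs; exacts [hB0, Nat.cast_nonneg _])
    (fun h hh i => by
      split_ifs with hi
      · exact Finset.mem_filter.2 ⟨hS h hh i, hI h hh i hi⟩
      · exact hS h hh i)
    (fun h hh i => by
      split_ifs with hi
      · exact hB h (hS h hh) i _ fun x hx => Finset.mem_filter.1 hx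
      · simp)
    (fun h hh h' hh' i hag => by
      split_ifs with hi
      · refine Finset.filter_congr fun x _ => ?_
        have : ((Finset.univ.filter (· < i)).lcm fun j => Int.gcd (g.eval x) (x - h j)) =
            (Finset.univ.filter (· < i)).lcm fun j => Int.gcd (g.eval x) (x - h' j) := by
          refine Finset.lcm_congr rfl fun j hj => ?_
          rw [hag j (by simpa using hj)]
        rw [this]
      · rfl)
  refine key.trans_eq ?_
  rw [Finset.prod_ite, Finset.prod_const, Finset.prod_const]
  congr 2
  · congr 1; ext; simp
  · have : (Finset.univ.filter fun i => i ∉ I) = Iᶜ := by ext; simp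
    rw [this, Finset.card_compl, Fintype.card_fin]

lemma card_le_of_many_constrained {m N : ℕ} {g : ℤ[X]} {M : ℝ} (hM : 0 ≤ M)
    (hbd : ∀ I : Finset (Fin m), m ≤ 2 * #I → ∀ S : Finset (Fin m → ℤ),
      (∀ h ∈ S, ∀ i, h i ∈ Finset.Icc (1 : ℤ) N) →
      (∀ h ∈ S, ∀ i ∈ I, IsConstrained g N h i) → (#S : ℝ) ≤ M)
    (S : Finset (Fin m → ℤ))
    (hS : ∀ h ∈ S, ∀ i, h i ∈ Finset.Icc (1 : ℤ) N)
    (hrev : ∀ h ∈ S, ∀ i, IsConstrained g N h i ∨ IsConstrained g N (h ∘ Fin.rev) (Fin.rev i)) :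
    (#S : ℝ) ≤ 2 * 2 ^ m * M := by
  classical
  set T : Finset (Fin m → ℤ) := (Fintype.piFinset fun _ => Finset.Icc (1 : ℤ) N).filter
    fun h => m ≤ 2 * #(Finset.univ.filter fun i => IsConstrained g N h i) with hT
  have hTcard : (#T : ℝ) ≤ 2 ^ m * M := by
    have hsub : T ⊆ (Finset.univ : Finset (Finset (Fin m))).biUnion fun I =>
        T.filter fun h => (Finset.univ.filter fun i => IsConstrained g N h i) = I := by
      intro h hh
      simp [hh]
    calc (#T : ℝ) ≤ ((∑ I : Finset (Fin m), #(T.filter fun h =>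
        (Finset.univ.filter fun i => IsConstrained g N h i) = I) : ℕ) : ℝ) := by
          exact_mod_cast (Finset.card_le_card hsub).trans Finset.card_biUnion_le
      _ = ∑ I : Finset (Fin m), ((#(T.filter fun h =>
        (Finset.univ.filter fun i => IsConstrained g N h i) = I) : ℕ) : ℝ) := by push_cast; rfl
      _ ≤ #(Finset.univ : Finset (Finset (Fin m))) • M := by
          refine Finset.sum_le_card_nsmul _ _ _ fun I _ => ?_
          rcases (T.filter fun h => (Finset.univ.filter fun i => IsConstrained g N h i)
            = I).eq_empty_or_nonempty with he | ⟨h₀, hh₀⟩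
          · rw [he]; simpa using hM
          refine hbd I ?_ _ ?_ ?_
          · obtain ⟨h1, h2⟩ := Finset.mem_filter.1 hh₀
            rw [← h2]
            exact (Finset.mem_filter.1 h1).2
          · intro h hh i
            have := (Finset.mem_filter.1 (Finset.mem_filter.1 hh).1).1
            exact Fintype.mem_piFinset.1 this i
          · intro h hh i hi
            have := (Finset.mem_filter.1 hh).2
            rw [← this] at hi
            exact (Finset.mem_filter.1 hi).2
      _ = 2 ^ m * M := by simp
  have hsub : S ⊆ T ∪ T.image fun h => h ∘ Fin.rev := by
    intro h hh
    have h1 : (Finset.univ : Finset (Fin m)) ⊆ (Finset.univ.filter fun i => IsConstrained g N h i) ∪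
        (Finset.univ.filter fun i => IsConstrained g N (h ∘ Fin.rev) i).image Fin.rev := by
      intro i _
      simp only [Finset.mem_union, Finset.mem_filter, Finset.mem_univ, true_and, Finset.mem_image]
      rcases hrev h hh i with h2 | h2
      · exact Or.inl h2
      · exact Or.inr ⟨_, h2, Fin.rev_rev i⟩
    have h2 := (Finset.card_le_card h1).trans (Finset.card_union_le _ _)
    have h3 := Finset.card_image_le
      (s := Finset.univ.filter fun i => IsConstrained g N (h ∘ Fin.rev) i) (f := Fin.rev)
    rw [Finset.card_univ, Fintype.card_fin] at h2
    rw [Finset.mem_union, Finset.mem_image]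
    by_cases h4 : m ≤ 2 * #(Finset.univ.filter fun i => IsConstrained g N h i)
    · exact Or.inl (Finset.mem_filter.2 ⟨Fintype.mem_piFinset.2 (hS h hh), h4⟩)
    · refine Or.inr ⟨h ∘ Fin.rev, Finset.mem_filter.2
        ⟨Fintype.mem_piFinset.2 fun i => hS h hh _, by omega⟩, ?_⟩
      ext i; simp
  have h5 : (#S : ℝ) ≤ #T + #T := by
    exact_mod_cast (Finset.card_le_card hsub).trans ((Finset.card_union_le _ _).trans
      (Nat.add_le_add_left Finset.card_image_le _))
  linarith

/-- Few tuples `h` in `[1, N]` satisfy `g(h_i) ∣ ∏_{j ≠ i} (h_j - h_i)` for all `i`. -/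
theorem exists_card_tuples_le (m : ℕ) (hm : 1 ≤ m) : ∃ N₀ : ℕ, ∀ N : ℕ, N₀ ≤ N → ∀ g : ℤ[X],
    1 ≤ g.natDegree → g.natDegree ≤ m →
    (∀ x ∈ Finset.Icc (1 : ℤ) N, g.eval x ≠ 0 ∧ |g.eval x| ≤ (N : ℤ) ^ (5 * m)) →
    ∀ S : Finset (Fin m → ℤ), (∀ h ∈ S, ∀ i, h i ∈ Finset.Icc (1 : ℤ) N ∧
      g.eval (h i) ∣ ∏ j ∈ Finset.univ.erase i, (h j - h i)) →
    (#S : ℝ) ≤ (N : ℝ) ^ ((m : ℝ) - m / 12) := by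
  have hm0 : (0 : ℝ) < m := by exact_mod_cast hm
  obtain ⟨N₁, hN₁⟩ := exists_card_divisors_le_rpow (5 * m) (ε := 1 / (40 * m)) (by positivity)
  refine ⟨max N₁ (max (4 ^ 60) ((2 * m + 2) ^ 40)), fun N hN g hg hgm hgN S hS => ?_⟩
  have hNN₁ : N₁ ≤ N := (le_max_left _ _).trans hN
  have hN4 : 4 ^ 60 ≤ N := (le_max_left _ _).trans ((le_max_right _ _).trans hN)
  have hNm : (2 * m + 2) ^ 40 ≤ N := (le_max_right _ _).trans ((le_max_right _ _).trans hN)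
  have hN1 : 1 ≤ N := le_trans (by norm_num) hN4
  have hNpos : (0 : ℝ) < N := by exact_mod_cast hN1
  have hN1' : (1 : ℝ) ≤ N := by exact_mod_cast hN1
  set D : ℝ := (N : ℝ) ^ (1 / (40 * m) : ℝ) with hDdef
  have hD : ∀ n : ℕ, n ≠ 0 → n ≤ N ^ (5 * m) → (#n.divisors : ℝ) ≤ D := fun n h1 h2 =>
    hN₁ N hNN₁ n h1 h2
  have hD0 : 0 ≤ D := by positivity
  have hDm : D ^ m = (N : ℝ) ^ (1 / 40 : ℝ) := by
    rw [hDdef, ← Real.rpow_natCast, ← Real.rpow_mul hNpos.le]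
    congr 1
    field_simp
  have hD1 : 1 ≤ D := Real.one_le_rpow hN1' (by positivity)
  have hDD : D ≤ D ^ m := le_self_pow₀ hD1 (by omega)
  have hroot : ∀ (k c : ℕ), 0 < k → c ^ k ≤ N → (c : ℝ) ≤ (N : ℝ) ^ (1 / k : ℝ) := by
    intro k c hk hc
    have : ((c : ℝ) ^ k) ≤ N := by exact_mod_cast hc
    calc (c : ℝ) = ((c : ℝ) ^ k) ^ (1 / k : ℝ) := by
          rw [one_div, Real.pow_rpow_inv_natCast (by positivity) (by omega)]
      _ ≤ _ := Real.rpow_le_rpow (by positivity) this (by positivity)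
  have hB : ∀ h : Fin m → ℤ, (∀ i, h i ∈ Finset.Icc (1 : ℤ) N) → ∀ i, ∀ T : Finset ℤ,
      (∀ x ∈ T, x ∈ Finset.Icc (1 : ℤ) N ∧ (IsSmallRadical m N (g.eval x) ∨
        N < ((Finset.univ.filter (· < i)).lcm fun j => Int.gcd (g.eval x) (x - h j)) ^ 4)) →
      (#T : ℝ) ≤ (N : ℝ) ^ (4 / 5 : ℝ) := by
    classical
    intro h hh i T hT
    have h1 := card_isSmallRadical_le hg hgm hD
      (T.filter fun x => IsSmallRadical m N (g.eval x)) fun x hx => (Finset.mem_filter.1 hx).2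
    have h2 := card_lt_lcm_le hN1 hgN hD hh i
      (T.filter fun x => ¬ IsSmallRadical m N (g.eval x))
      (fun x hx => (hT x (Finset.mem_filter.1 hx).1).1)
      (fun x hx => ((hT x (Finset.mem_filter.1 hx).1).2).resolve_left (Finset.mem_filter.1 hx).2)
    have h3 : #T = #(T.filter fun x => IsSmallRadical m N (g.eval x)) +
        #(T.filter fun x => ¬ IsSmallRadical m N (g.eval x)) :=
      (Finset.card_filter_add_card_filter_not _).symm
    have h4 : (N.sqrt : ℝ) ≤ (N : ℝ) ^ (3 / 4 : ℝ) := by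
      refine (hroot 2 N.sqrt (by norm_num) (Nat.sqrt_le' N)).trans ?_
      exact Real.rpow_le_rpow_of_exponent_le hN1' (by norm_num)
    have h5 : ((2 * m + 2 : ℕ) : ℝ) ≤ (N : ℝ) ^ (1 / (40 : ℕ) : ℝ) :=
      hroot 40 _ (by norm_num) hNm
    have h6 : (N : ℝ) ^ (1 / 40 : ℝ) * (N : ℝ) ^ (3 / 4 : ℝ) * (N : ℝ) ^ (1 / 40 : ℝ) =
        (N : ℝ) ^ (4 / 5 : ℝ) := by
      rw [← Real.rpow_add hNpos, ← Real.rpow_add hNpos]; norm_num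
    rw [h3]
    push_cast at h5 ⊢
    calc _ ≤ (N : ℝ) ^ (3 / 4 : ℝ) * (D ^ m * (2 * m)) + D ^ m * (2 * (N : ℝ) ^ (3 / 4 : ℝ)) := by
          refine add_le_add (h1.trans ?_) h2
          gcongr
      _ = (N : ℝ) ^ (1 / 40 : ℝ) * (N : ℝ) ^ (3 / 4 : ℝ) * (2 * m + 2) := by rw [hDm]; ring
      _ ≤ (N : ℝ) ^ (1 / 40 : ℝ) * (N : ℝ) ^ (3 / 4 : ℝ) * (N : ℝ) ^ (1 / 40 : ℝ) := by gcongr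
      _ = _ := h6
  have hmain := card_le_of_many_constrained (g := g) (N := N)
    (M := (N : ℝ) ^ ((m : ℝ) - m / 10)) (by positivity) (by
      intro I hI S' hS' hS''
      refine (card_constrained_le (by positivity) I S' hS' hS'' hB).trans ?_
      have hIm : #I ≤ m := by simpa using Finset.card_le_univ I
      rw [← Real.rpow_natCast, ← Real.rpow_natCast, ← Real.rpow_mul hNpos.le,
        ← Real.rpow_add hNpos]
      refine Real.rpow_le_rpow_of_exponent_le hN1' ?_
      push_cast [hIm]
      have : (m : ℝ) ≤ 2 * #I := by exact_mod_cast hI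
      linarith) S (fun h hh i => (hS h hh i).1)
    (fun h hh i => isConstrained_or_rev (hgN _ (hS h hh i).1).1 (hS h hh i).2)
  refine hmain.trans ?_
  have h7 : (2 : ℝ) * 2 ^ m ≤ (N : ℝ) ^ ((m : ℝ) / 60) := by
    have h8 : ((4 : ℕ) : ℝ) ≤ (N : ℝ) ^ (1 / (60 : ℕ) : ℝ) := hroot 60 4 (by norm_num) hN4
    calc (2 : ℝ) * 2 ^ m ≤ 2 ^ m * 2 ^ m := by
          gcongr; exact le_self_pow₀ (by norm_num) (by omega)
      _ = ((4 : ℕ) : ℝ) ^ m := by rw [← mul_pow]; norm_num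
      _ ≤ ((N : ℝ) ^ (1 / (60 : ℕ) : ℝ)) ^ m := by gcongr
      _ = _ := by
        rw [← Real.rpow_natCast, ← Real.rpow_mul hNpos.le]; congr 1; push_cast; ring
  calc _ ≤ (N : ℝ) ^ ((m : ℝ) / 60) * (N : ℝ) ^ ((m : ℝ) - m / 10) := by gcongr
    _ = _ := by rw [← Real.rpow_add hNpos]; congr 1; ring

end CountingBound

section CommonFactor
open Polynomial

lemma abs_coeff_prod_sub_X_le {ι : Type*} [DecidableEq ι] (s : Finset ι) (h : ι → ℤ) {N : ℕ}
    (hh : ∀ i ∈ s, |h i| ≤ N) (k : ℕ) :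
    |(∏ j ∈ s, (C (h j) - X)).coeff k| ≤ ((N : ℤ) + 1) ^ #s := by
  induction s using Finset.induction_on generalizing k with
  | empty => simp [coeff_one]; split_ifs <;> simp
  | insert j s hj ih =>
    rw [Finset.prod_insert hj, Finset.card_insert_of_notMem hj, sub_mul, coeff_sub, coeff_C_mul]
    have ih' := fun k => ih (fun i hi => hh i (by simp [hi])) k
    have h0 : |h j| ≤ N := hh j (by simp)
    have h1 : |h j * (∏ j ∈ s, (C (h j) - X)).coeff k| ≤ N * ((N : ℤ) + 1) ^ #s := by
      rw [abs_mul]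
      exact mul_le_mul h0 (ih' k) (abs_nonneg _) (by positivity)
    have h2 : |(X * ∏ j ∈ s, (C (h j) - X)).coeff k| ≤ ((N : ℤ) + 1) ^ #s := by
      cases k with
      | zero => simp; positivity
      | succ k => rw [coeff_X_mul]; exact ih' k
    refine (abs_sub _ _).trans ((add_le_add h1 h2).trans_eq ?_)
    ring

/-- The numerator of `∑ ε_i / (h_i - Y)`. -/
noncomputable def recipNumerator {m : ℕ} (ε h : Fin m → ℤ) : ℤ[X] :=
  ∑ i, C (ε i) * ∏ j ∈ Finset.univ.erase i, (C (h j) - X)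

lemma eval_recipNumerator {m : ℕ} (ε h : Fin m → ℤ) (i : Fin m) :
    (recipNumerator ε h).eval (h i) = ε i * ∏ j ∈ Finset.univ.erase i, (h j - h i) := by
  rw [recipNumerator, eval_finsetSum, Finset.sum_eq_single i]
  · simp [eval_prod]
  · intro k _ hk
    rw [eval_mul, eval_prod, Finset.prod_eq_zero (i := i) (by simp [hk.symm]) (by simp), mul_zero]
  · simp

lemma natDegree_recipNumerator_le {m : ℕ} (ε h : Fin m → ℤ) :
    (recipNumerator ε h).natDegree ≤ m - 1 := by
  refine natDegree_sum_le_of_forall_le _ _ fun i _ => ?_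
  refine (natDegree_C_mul_le _ _).trans ((natDegree_prod_le _ _).trans ?_)
  refine (Finset.sum_le_card_nsmul _ _ 1 fun j _ => ?_).trans ?_
  · exact (natDegree_sub_le _ _).trans (by simp)
  · simp

lemma abs_coeff_recipNumerator_le {m N : ℕ} {ε h : Fin m → ℤ} (hε : ∀ i, |ε i| ≤ 1)
    (hh : ∀ i, |h i| ≤ N) (k : ℕ) :
    |(recipNumerator ε h).coeff k| ≤ m * ((N : ℤ) + 1) ^ (m - 1) := by
  rw [recipNumerator, finsetSum_coeff]
  refine (Finset.abs_sum_le_sum_abs _ _).trans ?_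
  refine (Finset.sum_le_card_nsmul _ _ (((N : ℤ) + 1) ^ (m - 1)) fun i _ => ?_).trans (by simp)
  rw [coeff_C_mul, abs_mul]
  have := abs_coeff_prod_sub_X_le (Finset.univ.erase i) h (fun j _ => hh j) k
  rw [Finset.card_erase_of_mem (by simp), Finset.card_univ, Fintype.card_fin] at this
  calc _ ≤ 1 * ((N : ℤ) + 1) ^ (m - 1) := mul_le_mul (hε i) this (abs_nonneg _) (by norm_num)
    _ = _ := one_mul _

lemma eval₂_recipNumerator {p : ℕ} [Fact p.Prime] {m : ℕ} {ε h : Fin m → ℤ} {a : ZMod p}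
    (ha : ∀ i, a + (h i : ZMod p) ≠ 0) (hsum : ∑ i, (ε i : ZMod p) * (a + (h i : ZMod p))⁻¹ = 0) :
    (recipNumerator ε h).eval₂ (Int.castRingHom (ZMod p)) (-a) = 0 := by
  have h1 : (recipNumerator ε h).eval₂ (Int.castRingHom (ZMod p)) (-a) =
      (∏ j, (a + (h j : ZMod p))) * ∑ i, (ε i : ZMod p) * (a + (h i : ZMod p))⁻¹ := by
    rw [recipNumerator, eval₂_finsetSum, Finset.mul_sum]
    refine Finset.sum_congr rfl fun i _ => ?_
    rw [← Finset.mul_prod_erase _ _ (Finset.mem_univ i), eval₂_mul, eval₂_finsetProd]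
    have h2 : ∏ j ∈ Finset.univ.erase i, (C (h j) - X).eval₂ (Int.castRingHom (ZMod p)) (-a) =
        ∏ j ∈ Finset.univ.erase i, (a + (h j : ZMod p)) :=
      Finset.prod_congr rfl fun j _ => by
        rw [eval₂_sub, eval₂_C, eval₂_X, eq_intCast, sub_neg_eq_add, add_comm]
    have := ha i
    rw [h2, eval₂_C, eq_intCast]
    field_simp
  rw [h1, hsum, mul_zero]

lemma abs_coeff_le_of_dvd {g P : ℤ[X]} (hP : P ≠ 0) (hgP : g ∣ P) {B : ℤ} {m : ℕ}
    (hm : P.natDegree < m) (hB : ∀ k, |P.coeff k| ≤ B) (k : ℕ) :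
    |g.coeff k| ≤ 2 ^ m * (m * B) := by
  obtain ⟨q, rfl⟩ := hgP
  have hq : q ≠ 0 := right_ne_zero_of_mul hP
  have hg : g ≠ 0 := left_ne_zero_of_mul hP
  set f := Int.castRingHom ℂ with hf
  have hinj : Function.Injective f := Int.cast_injective
  have h1 : 1 ≤ (q.map f).mahlerMeasure := by
    apply one_le_mahlerMeasure_of_one_le_norm_leadingCoeff
    rw [leadingCoeff_map_of_injective hinj]
    simp only [hf, eq_intCast, Complex.norm_intCast]
    exact_mod_cast Int.one_le_abs (leadingCoeff_ne_zero.2 hq)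
  have h2 := norm_coeff_le_choose_mul_mahlerMeasure_of_one_le_mahlerMeasure k (g.map f) (q.map f) h1
  rw [← Polynomial.map_mul, coeff_map, natDegree_map_eq_of_injective hinj] at h2
  have h3 : ((g * q).map f).mahlerMeasure ≤ m * B := by
    refine (mahlerMeasure_le_sum_norm_coeff _).trans ?_
    rw [sum_over_range' _ (by simp) m (by rwa [natDegree_map_eq_of_injective hinj])]
    refine (Finset.sum_le_card_nsmul _ _ (B : ℝ) fun i _ => ?_).trans (by simp)
    simp only [coeff_map, hf, eq_intCast, Complex.norm_intCast]
    exact_mod_cast hB i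
  have h4 : (g.natDegree.choose k : ℝ) ≤ 2 ^ m := by
    have : g.natDegree ≤ m := by
      rw [natDegree_mul hg hq] at hm; omega
    exact_mod_cast (Nat.choose_le_two_pow _ _).trans (Nat.pow_le_pow_right (by norm_num) this)
  have h5 : (0 : ℝ) ≤ m * B := (mahlerMeasure_nonneg _).trans h3
  have h6 : (|g.coeff k| : ℝ) ≤ 2 ^ m * (m * B) := by
    simp only [hf, eq_intCast, Complex.norm_intCast] at h2
    exact h2.trans (mul_le_mul h4 h3 (mahlerMeasure_nonneg _) (by positivity))
  exact_mod_cast h6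

lemma abs_resultant_le {f g : ℤ[X]} {B : ℤ} (hB0 : 0 ≤ B) (hf : ∀ k, |f.coeff k| ≤ B)
    (hg : ∀ k, |g.coeff k| ≤ B) (m n : ℕ) :
    |f.resultant g m n| ≤ (m + n).factorial * B ^ (m + n) := by
  have := Matrix.det_le (A := f.sylvester g m n) (abv := AbsoluteValue.abs) (x := B) (by
    intro i j
    change |f.sylvester g m n i j| ≤ B
    rw [sylvester, Matrix.of_apply]
    induction j using Fin.addCases <;> simp only [Fin.addCases_left, Fin.addCases_right] <;>
      split_ifs <;> first | exact hf _ | exact hg _ | simpa using hB0)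
  simpa [resultant, nsmul_eq_mul] using this

lemma exists_irreducible_dvd {R : Type*} [Field R] (φ : ℤ[X] →+* R) {P : ℤ[X]} (hP : P ≠ 0)
    (h : φ P = 0) : ∃ g, Irreducible g ∧ g ∣ P ∧ φ g = 0 := by
  obtain ⟨f, hf, hfP⟩ := WfDvdMonoid.exists_factors P hP
  have h1 : φ f.prod = 0 := by
    obtain ⟨u, hu⟩ := hfP.symm
    rw [← hu, map_mul, h, zero_mul]
  rw [map_multiset_prod, Multiset.prod_eq_zero_iff, Multiset.mem_map] at h1
  obtain ⟨g, hg, hg0⟩ := h1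
  exact ⟨g, hf g hg, (Multiset.dvd_prod hg).trans hfP.dvd, hg0⟩

/-- Two integer polynomials with a common root modulo a large prime, one of them irreducible. -/
lemma Irreducible.dvd_of_eval₂_eq_zero {p : ℕ} [Fact p.Prime] {g P : ℤ[X]} (hg : Irreducible g)
    (hdeg : g.natDegree ≠ 0) {x : ZMod p} (hgx : g.eval₂ (Int.castRingHom (ZMod p)) x = 0)
    (hPx : P.eval₂ (Int.castRingHom (ZMod p)) x = 0)
    (hlt : |g.resultant P| < p) : g ∣ P := by
  obtain ⟨u, v, -, -, huv⟩ := exists_mul_add_mul_eq_C_resultant g P le_rfl le_rfl (Or.inl hdeg)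
  have h1 : ((g.resultant P : ℤ) : ZMod p) = 0 := by
    have := congrArg (eval₂ (Int.castRingHom (ZMod p)) x) huv
    rw [eval₂_add, eval₂_mul, eval₂_mul, hgx, hPx, eval₂_C] at this
    simpa using this.symm
  have h2 : g.resultant P = 0 := by
    rw [ZMod.intCast_zmod_eq_zero_iff_dvd] at h1
    exact Int.eq_zero_of_abs_lt_dvd h1 hlt
  have hinj : Function.Injective (Int.castRingHom ℚ) := Int.cast_injective
  have hprim := hg.isPrimitive hdeg
  have h3 : (g.map (Int.castRingHom ℚ)).resultant (P.map (Int.castRingHom ℚ)) = 0 := by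
    rw [natDegree_map_eq_of_injective hinj, natDegree_map_eq_of_injective hinj, resultant_map_map,
      h2, map_zero]
  rw [IsPrimitive.Int.dvd_iff_map_cast_dvd_map_cast _ _ hprim]
  have h4 := (IsPrimitive.Int.irreducible_iff_irreducible_map_cast hprim).1 hg
  by_contra hnd
  exact (resultant_eq_zero_iff.1 h3).2 ((h4.coprime_iff_not_dvd).2 hnd)

/-- The integer points near `-a` on which a signed sum of `m` reciprocals vanishes modulo `p` are
governed by a single polynomial. -/
theorem exists_common_factor (m : ℕ) (hm : 1 ≤ m) : ∃ N₀ : ℕ, ∀ N : ℕ, N₀ ≤ N →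
    ∀ p : ℕ, p.Prime → N ^ (10 * m ^ 2) < p → ∀ a : ZMod p,
    (∀ x ∈ Finset.Icc (1 : ℤ) N, a + (x : ZMod p) ≠ 0) →
    ∀ ε : Fin m → ℤ, (∀ i, |ε i| = 1) → ∃ g : ℤ[X], 1 ≤ g.natDegree ∧ g.natDegree ≤ m ∧
      (∀ x ∈ Finset.Icc (1 : ℤ) N, g.eval x ≠ 0 ∧ |g.eval x| ≤ (N : ℤ) ^ (5 * m)) ∧
      ∀ h : Fin m → ℤ, (∀ i, h i ∈ Finset.Icc (1 : ℤ) N) →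
        ∑ i, (ε i : ZMod p) * (a + (h i : ZMod p))⁻¹ = 0 →
        ∀ i, g.eval (h i) ∣ ∏ j ∈ Finset.univ.erase i, (h j - h i) := by
  refine ⟨(2 * m).factorial * (4 ^ m * m ^ 2), fun N hN p hp hNp a ha ε hε => ?_⟩
  have := Fact.mk hp
  have hfac : (2 * m).factorial ≤ N := le_trans (Nat.le_mul_of_pos_right _ (by positivity)) hN
  have h4m : 4 ^ m * m ^ 2 ≤ N :=
    le_trans (Nat.le_mul_of_pos_left _ (Nat.factorial_pos _)) hN
  have hN1 : 1 ≤ N := (Nat.factorial_pos _).trans_le hfac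
  have hmN : m ≤ N := (Nat.le_mul_of_pos_left _ (by norm_num)).trans
    ((Nat.self_le_factorial (2 * m)).trans hfac)
  have hNZ : (1 : ℤ) ≤ N := by exact_mod_cast hN1
  have hdvd_of : ∀ (g : ℤ[X]) (h : Fin m → ℤ), g ∣ recipNumerator ε h → ∀ i,
      g.eval (h i) ∣ ∏ j ∈ Finset.univ.erase i, (h j - h i) := by
    intro g h hg i
    have h1 : g.eval (h i) ∣ (recipNumerator ε h).eval (h i) := by
      obtain ⟨q, hq⟩ := hg
      rw [hq, eval_mul]
      exact dvd_mul_right _ _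
    rw [eval_recipNumerator] at h1
    have hu : IsUnit (ε i) := Int.isUnit_iff_abs_eq.2 (hε i)
    exact hu.dvd_mul_left.1 h1
  have habs : ∀ x ∈ Finset.Icc (1 : ℤ) N, |x| ≤ N := by
    intro x hx
    have := Finset.mem_Icc.1 hx
    rw [abs_le]; omega
  by_cases hex : ∃ h : Fin m → ℤ, (∀ i, h i ∈ Finset.Icc (1 : ℤ) N) ∧
      ∑ i, (ε i : ZMod p) * (a + (h i : ZMod p))⁻¹ = 0 ∧ recipNumerator ε h ≠ 0
  swap
  · push Not at hex
    refine ⟨X, by simp, by simpa using hm, fun x hx => ?_, fun h hh hs => ?_⟩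
    · have h1 := Finset.mem_Icc.1 hx
      rw [eval_X]
      refine ⟨by omega, (habs x hx).trans ?_⟩
      exact le_self_pow₀ hNZ (by omega)
    · exact hdvd_of _ _ (by rw [hex h hh hs]; exact dvd_zero _)
  obtain ⟨h, hh, hs, hP0⟩ := hex
  have hroot : ∀ h : Fin m → ℤ, (∀ i, h i ∈ Finset.Icc (1 : ℤ) N) →
      ∑ i, (ε i : ZMod p) * (a + (h i : ZMod p))⁻¹ = 0 →
      (recipNumerator ε h).eval₂ (Int.castRingHom (ZMod p)) (-a) = 0 := fun h hh hs =>
    eval₂_recipNumerator (fun i => ha _ (hh i)) hs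
  have hcoef : ∀ h : Fin m → ℤ, (∀ i, h i ∈ Finset.Icc (1 : ℤ) N) → ∀ k,
      |(recipNumerator ε h).coeff k| ≤ m * ((N : ℤ) + 1) ^ (m - 1) := fun h hh k =>
    abs_coeff_recipNumerator_le (fun i => (hε i).le) (fun i => habs _ (hh i)) k
  obtain ⟨g, hgirr, hgP, hg0⟩ := exists_irreducible_dvd
    (eval₂RingHom (Int.castRingHom (ZMod p)) (-a)) hP0 (hroot h hh hs)
  rw [coe_eval₂RingHom] at hg0
  have hPdeg : ∀ h : Fin m → ℤ, (recipNumerator ε h).natDegree < m := fun h => by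
    have := natDegree_recipNumerator_le ε h; omega
  have hgdeg : g.natDegree < m := (natDegree_le_of_dvd hgP hP0).trans_lt (hPdeg h)
  have hbd : (2 : ℤ) ^ m * (m * (m * ((N : ℤ) + 1) ^ (m - 1))) ≤ (N : ℤ) ^ m := by
    calc (2 : ℤ) ^ m * (m * (m * ((N : ℤ) + 1) ^ (m - 1)))
        ≤ 2 ^ m * (m * (m * (2 * (N : ℤ)) ^ (m - 1))) := by gcongr; omega
      _ = (2 ^ m * 2 ^ (m - 1) * m ^ 2) * (N : ℤ) ^ (m - 1) := by rw [mul_pow]; ring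
      _ ≤ (2 ^ m * 2 ^ m * m ^ 2) * (N : ℤ) ^ (m - 1) := by gcongr <;> omega
      _ = (4 ^ m * m ^ 2) * (N : ℤ) ^ (m - 1) := by rw [← mul_pow]; norm_num
      _ ≤ N * (N : ℤ) ^ (m - 1) := by gcongr; exact_mod_cast h4m
      _ = (N : ℤ) ^ m := by rw [← pow_succ', Nat.sub_add_cancel hm]
  have hgcoef : ∀ k, |g.coeff k| ≤ (N : ℤ) ^ m := fun k =>
    (abs_coeff_le_of_dvd hP0 hgP (hPdeg h) (hcoef h hh) k).trans hbd
  have hPcoef : ∀ h : Fin m → ℤ, (∀ i, h i ∈ Finset.Icc (1 : ℤ) N) → ∀ k,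
      |(recipNumerator ε h).coeff k| ≤ (N : ℤ) ^ m := fun h hh k => by
    refine (hcoef h hh k).trans (le_trans ?_ hbd)
    have h0 : (0 : ℤ) ≤ m * ((N : ℤ) + 1) ^ (m - 1) := by positivity
    have h1 : (1 : ℤ) ≤ 2 ^ m * m := by
      have : 1 ≤ 2 ^ m * m := Nat.mul_pos (by positivity) hm
      exact_mod_cast this
    calc _ = 1 * (m * ((N : ℤ) + 1) ^ (m - 1)) := (one_mul _).symm
      _ ≤ (2 ^ m * m) * (m * ((N : ℤ) + 1) ^ (m - 1)) := by gcongr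
      _ = _ := by ring
  have hNmp : (N : ℤ) ^ m < p := by
    have : N ^ m ≤ N ^ (10 * m ^ 2) := Nat.pow_le_pow_right hN1 (by nlinarith)
    exact_mod_cast this.trans_lt hNp
  have hgdeg0 : g.natDegree ≠ 0 := by
    intro h0
    obtain ⟨c, hc⟩ := natDegree_eq_zero.1 h0
    rw [← hc, eval₂_C, eq_intCast, ZMod.intCast_zmod_eq_zero_iff_dvd] at hg0
    have h1 := hgcoef 0
    rw [← hc, coeff_C_zero] at h1
    have h2 := Int.eq_zero_of_abs_lt_dvd hg0 (h1.trans_lt hNmp)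
    rw [h2, C_0] at hc
    exact hgirr.ne_zero hc.symm
  refine ⟨g, by omega, hgdeg.le, fun x hx => ⟨fun hgx => ?_, ?_⟩, fun h' hh' hs' => ?_⟩
  · have h1 : X - C x ∣ g := dvd_iff_isRoot.2 hgx
    have h2 : Associated (X - C x) g := (irreducible_X_sub_C x).associated_of_dvd hgirr h1
    obtain ⟨q, hq⟩ := h2.symm.dvd
    have h3 := congrArg (eval₂ (Int.castRingHom (ZMod p)) (-a)) hq
    rw [eval₂_mul, hg0, zero_mul, eval₂_sub, eval₂_X, eval₂_C, eq_intCast] at h3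
    apply ha x hx
    linear_combination -h3
  · rw [eval_eq_sum_range' hgdeg]
    refine (Finset.abs_sum_le_sum_abs _ _).trans ?_
    calc ∑ i ∈ Finset.range m, |g.coeff i * x ^ i|
        ≤ #(Finset.range m) • ((N : ℤ) ^ m * (N : ℤ) ^ m) := by
          refine Finset.sum_le_card_nsmul _ _ _ fun i hi => ?_
          rw [abs_mul, abs_pow]
          have h1 : |x| ^ i ≤ (N : ℤ) ^ m :=
            (pow_le_pow_left₀ (abs_nonneg _) (habs x hx) i).trans
              (pow_le_pow_right₀ hNZ (Finset.mem_range.1 hi).le)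
          exact mul_le_mul (hgcoef i) h1 (by positivity) (by positivity)
      _ = m * ((N : ℤ) ^ m * (N : ℤ) ^ m) := by simp
      _ ≤ N * ((N : ℤ) ^ m * (N : ℤ) ^ m) := by gcongr
      _ = (N : ℤ) ^ (1 + m + m) := by rw [pow_add, pow_add, pow_one]; ring
      _ ≤ _ := pow_le_pow_right₀ hNZ (by omega)
  · refine hdvd_of _ _ (hgirr.dvd_of_eval₂_eq_zero hgdeg0 hg0 (hroot h' hh' hs') ?_)
    refine (abs_resultant_le (by positivity) hgcoef (hPcoef h' hh') _ _).trans_lt ?_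
    have hd : g.natDegree + (recipNumerator ε h').natDegree ≤ 2 * m := by
      have := hPdeg h'; omega
    have h1 : N ^ (1 + m * (2 * m)) ≤ N ^ (10 * m ^ 2) := Nat.pow_le_pow_right hN1 (by nlinarith)
    calc _ ≤ ((2 * m).factorial : ℤ) * ((N : ℤ) ^ m) ^ (2 * m) := by
          gcongr
          exact one_le_pow₀ hNZ
      _ ≤ N * ((N : ℤ) ^ m) ^ (2 * m) := by gcongr
      _ = (N : ℤ) ^ (1 + m * (2 * m)) := by rw [pow_add, pow_one, pow_mul (N : ℤ) m (2 * m)]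
      _ < p := by exact_mod_cast h1.trans_lt hNp

/-- Few solutions of a signed reciprocal equation in a short interval. -/
theorem exists_card_reciprocal_le (m : ℕ) (hm : 1 ≤ m) : ∃ N₀ : ℕ, ∀ N : ℕ, N₀ ≤ N →
    ∀ p : ℕ, p.Prime → N ^ (10 * m ^ 2) < p → ∀ a : ZMod p,
    (∀ x ∈ Finset.Icc (1 : ℤ) N, a + (x : ZMod p) ≠ 0) →
    ∀ ε : Fin m → ℤ, (∀ i, |ε i| = 1) → ∀ S : Finset (Fin m → ℤ),
      (∀ h ∈ S, (∀ i, h i ∈ Finset.Icc (1 : ℤ) N) ∧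
        ∑ i, (ε i : ZMod p) * (a + (h i : ZMod p))⁻¹ = 0) →
      (#S : ℝ) ≤ (N : ℝ) ^ ((m : ℝ) - m / 12) := by
  obtain ⟨N₁, h₁⟩ := exists_common_factor m hm
  obtain ⟨N₂, h₂⟩ := exists_card_tuples_le m hm
  refine ⟨max N₁ N₂, fun N hN p hp hNp a ha ε hε S hS => ?_⟩
  obtain ⟨g, hg1, hgm, hgN, hg⟩ := h₁ N ((le_max_left _ _).trans hN) p hp hNp a ha ε hε
  exact h₂ N ((le_max_right _ _).trans hN) g hg1 hgm hgN S fun h hh i =>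
    ⟨(hS h hh).1 i, hg h (hS h hh).1 (hS h hh).2 i⟩

end CommonFactor

section ReciprocalLaw

/-- Iterated differences of the law of `u k`, `k` uniform in `K`, are laws of signed sums. -/
lemma sum_iterate_diffLaw_mul {G : Type*} [AddCommGroup G] [Fintype G] {ρ : G → ℝ} {w : ℝ}
    {K : Finset ℤ} {u : ℤ → G} (hρ : ∀ φ : G → ℝ, ∑ x, ρ x * φ x = w * ∑ k ∈ K, φ (u k)) (j : ℕ) :
    ∃ m, m = 2 ^ j ∧ ∃ ε : Fin m → ℤ, (∀ i, |ε i| = 1) ∧ ∀ φ : G → ℝ,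
      ∑ z, diffLaw^[j] ρ z * φ z =
        w ^ m * ∑ h ∈ Fintype.piFinset (fun _ : Fin m => K), φ (∑ i, ε i • u (h i)) := by
  induction j with
  | zero =>
    refine ⟨1, by simp, fun _ => 1, by simp, fun φ => ?_⟩
    rw [Function.iterate_zero, id, hρ, pow_one]
    congr 1
    refine Finset.sum_nbij' (fun k _ => k) (fun h => h 0) ?_ ?_ ?_ ?_ ?_
    · intro k hk; simpa using hk
    · intro h hh; exact Fintype.mem_piFinset.1 hh 0
    · intro k hk; rfl
    · intro h hh; ext i; rw [Subsingleton.elim i 0]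
    · intro k hk; simp
  | succ j ih =>
    obtain ⟨m, hm, ε, hε, hφ⟩ := ih
    refine ⟨m + m, by rw [hm]; ring, Fin.append ε (fun i => -ε i), ?_, fun φ => ?_⟩
    · intro i
      induction i using Fin.addCases <;> simp [hε, -Fin.natAdd_eq_addNat]
    · rw [Function.iterate_succ_apply', sum_diffLaw_mul]
      have h1 : ∑ s, ∑ x, diffLaw^[j] ρ s * diffLaw^[j] ρ x * φ (x - s) =
          ∑ s, diffLaw^[j] ρ s * ∑ x, diffLaw^[j] ρ x * φ (x - s) := by
        refine Finset.sum_congr rfl fun s _ => ?_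
        rw [Finset.mul_sum]
        exact Finset.sum_congr rfl fun x _ => by ring
      rw [h1, hφ]
      simp_rw [fun s => hφ (fun x => φ (x - s))]
      rw [← Finset.mul_sum, ← mul_assoc, ← pow_add]
      congr 1
      rw [← Finset.sum_product' (f := fun (h h' : Fin m → ℤ) =>
        φ (∑ i, ε i • u (h' i) - ∑ i, ε i • u (h i)))]
      refine Finset.sum_nbij' (fun q => Fin.append q.2 q.1)
        (fun h => (fun i => h (Fin.natAdd m i), fun i => h (Fin.castAdd m i))) ?_ ?_ ?_ ?_ ?_
      · intro q hq
        simp only [Finset.mem_product, Fintype.mem_piFinset] at hq ⊢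
        intro i
        induction i using Fin.addCases <;> simp [hq, -Fin.natAdd_eq_addNat]
      · intro h hh
        simp only [Finset.mem_product, Fintype.mem_piFinset] at hh ⊢
        exact ⟨fun i => hh _, fun i => hh _⟩
      · intro q hq; simp [-Fin.natAdd_eq_addNat]
      · intro h hh
        ext i
        induction i using Fin.addCases <;> simp [-Fin.natAdd_eq_addNat]
      · intro q hq
        simp [Fin.sum_univ_add, sub_eq_add_neg, -Fin.natAdd_eq_addNat]

variable {p : ℕ} [Fact p.Prime]

lemma lt_of_zero_notMem_interval {a : ZMod p} {N : ℕ} (h : (0 : ZMod p) ∉ interval p a N) :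
    N < p := by
  by_contra! hN
  have hp := (Fact.out : p.Prime).pos
  apply h
  rw [interval, Finset.mem_image]
  by_cases ha : a = 0
  · exact ⟨p, Finset.mem_Icc.2 ⟨hp, hN⟩, by simp [ha]⟩
  · refine ⟨(-a).val, Finset.mem_Icc.2 ⟨?_, (ZMod.val_lt _).le.trans hN⟩, ?_⟩
    · have : (-a).val ≠ 0 := by rw [Ne, ZMod.val_eq_zero]; simpa using ha
      omega
    · rw [ZMod.natCast_zmod_val, add_neg_cancel]

lemma injOn_add_natCast {N : ℕ} (hN : N < p) (a : ZMod p) :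
    Set.InjOn (fun i : ℕ => a + (i : ZMod p)) (Finset.Icc 1 N : Finset ℕ) := by
  intro i hi j hj hij
  have hi' := (Finset.mem_Icc.1 hi).2
  have hj' := (Finset.mem_Icc.1 hj).2
  have := congrArg ZMod.val (add_left_cancel hij)
  rwa [ZMod.val_natCast_of_lt (by omega), ZMod.val_natCast_of_lt (by omega)] at this

lemma card_interval {N : ℕ} (hN : N < p) (a : ZMod p) : #(interval p a N) = N := by
  rw [interval, Finset.card_image_of_injOn (injOn_add_natCast hN a)]
  simp

/-- The inverses of an interval. -/
noncomputable def invInterval (p : ℕ) [Fact p.Prime] (a : ZMod p) (N : ℕ) : Finset (ZMod p) :=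
  (interval p a N).image (·⁻¹)

lemma card_invInterval {N : ℕ} (hN : N < p) (a : ZMod p) : #(invInterval p a N) = N := by
  rw [invInterval, Finset.card_image_of_injective _ inv_injective, card_interval hN]

lemma sum_unifOn_invInterval_mul {N : ℕ} (hN : N < p) (a : ZMod p) (φ : ZMod p → ℝ) :
    ∑ x, unifOn (invInterval p a N) x * φ x =
      (N : ℝ)⁻¹ * ∑ k ∈ Finset.Icc (1 : ℤ) N, φ (a + (k : ZMod p))⁻¹ := by
  simp_rw [unifOn, card_invInterval hN, ite_mul, zero_mul]
  rw [Finset.sum_ite_mem, Finset.univ_inter, ← Finset.mul_sum, invInterval,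
    Finset.sum_image inv_injective.injOn, interval, Finset.sum_image (injOn_add_natCast hN a)]
  congr 1
  refine Finset.sum_nbij' (fun i : ℕ => (i : ℤ)) Int.toNat ?_ ?_ ?_ ?_ ?_
  · intro i hi; simp only [Finset.mem_Icc] at hi ⊢; omega
  · intro i hi; simp only [Finset.mem_Icc] at hi ⊢; omega
  · intro i hi; simp
  · intro i hi; simp only [Finset.mem_Icc] at hi; omega
  · intro i hi; simp

lemma iterate_diffLaw_unifOn_invInterval_le {j : ℕ} : ∃ N₀ : ℕ, ∀ N : ℕ, N₀ ≤ N →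
    ∀ p : ℕ, ∀ [Fact p.Prime], N ^ (10 * (2 ^ j) ^ 2) < p → ∀ a : ZMod p,
    (0 : ZMod p) ∉ interval p a N → ∀ z,
      diffLaw^[j] (unifOn (invInterval p a N)) z ≤ (N : ℝ) ^ (-((2 : ℝ) ^ j / 12)) := by
  obtain ⟨N₀, h₀⟩ := exists_card_reciprocal_le (2 ^ j) (Nat.one_le_two_pow)
  refine ⟨max N₀ 1, fun N hN p hpF hNp a ha z => ?_⟩
  have hN1 : 1 ≤ N := (le_max_right _ _).trans hN
  have hNlt := lt_of_zero_notMem_interval ha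
  have hNpos : (0 : ℝ) < N := by exact_mod_cast hN1
  rcases Nat.eq_zero_or_pos j with rfl | hj
  · have h1 : unifOn (invInterval p a N) z ≤ (N : ℝ)⁻¹ := by
      rw [unifOn, card_invInterval hNlt]
      split_ifs
      · exact le_rfl
      · positivity
    refine h1.trans ?_
    rw [← Real.rpow_neg_one]
    exact Real.rpow_le_rpow_of_exponent_le (by exact_mod_cast hN1) (by norm_num)
  obtain ⟨i, rfl⟩ := Nat.exists_eq_succ_of_ne_zero hj.ne'
  have hle : diffLaw^[i + 1] (unifOn (invInterval p a N)) z ≤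
      diffLaw^[i + 1] (unifOn (invInterval p a N)) 0 := by
    rw [Function.iterate_succ_apply', diffLaw_zero]
    exact diffLaw_le_sum_sq _ _
  refine hle.trans ?_
  obtain ⟨m, hm, ε, hε, hφ⟩ := sum_iterate_diffLaw_mul
    (u := fun k : ℤ => (a + (k : ZMod p))⁻¹) (sum_unifOn_invInterval_mul hNlt a) (i + 1)
  have hz := hφ (fun x => if x = 0 then 1 else 0)
  simp only [mul_ite, mul_one, mul_zero, Finset.sum_ite_eq', Finset.mem_univ, if_true] at hz
  rw [hz, ← Finset.sum_filter, Finset.sum_const, nsmul_eq_mul, mul_one]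
  subst hm
  have hc := h₀ N ((le_max_left _ _).trans hN) p Fact.out hNp a (by
    intro x hx h0
    apply ha
    rw [interval, Finset.mem_image]
    have := Finset.mem_Icc.1 hx
    refine ⟨x.toNat, Finset.mem_Icc.2 (by omega), ?_⟩
    rw [← h0]
    congr 1
    have : ((x.toNat : ℤ) : ZMod p) = (x : ZMod p) := by rw [Int.toNat_of_nonneg (by omega)]
    exact_mod_cast this) ε hε
    ((Fintype.piFinset fun _ => Finset.Icc (1 : ℤ) N).filter fun h =>
      ∑ i, ε i • (a + (h i : ZMod p))⁻¹ = 0) (by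
    intro h hh
    obtain ⟨h1, h2⟩ := Finset.mem_filter.1 hh
    exact ⟨Fintype.mem_piFinset.1 h1, by simpa [zsmul_eq_mul] using h2⟩)
  calc _ ≤ (N : ℝ)⁻¹ ^ 2 ^ (i + 1) *
        (N : ℝ) ^ (((2 ^ (i + 1) : ℕ) : ℝ) - ((2 ^ (i + 1) : ℕ) : ℝ) / 12) := by gcongr
    _ = _ := by
      rw [← Real.rpow_neg_one, ← Real.rpow_natCast, ← Real.rpow_mul hNpos.le,
        ← Real.rpow_add hNpos]
      congr 1
      push_cast [Nat.succ_eq_add_one]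
      ring

/-- The uniform law on the inverses of an interval spreads out over `ZMod p`. -/
theorem exists_isSpread_unifOn_invInterval (n : ℕ) (hn : 50 ≤ n) : ∃ N₀ : ℕ, ∀ N : ℕ, N₀ ≤ N →
    ∀ p : ℕ, ∀ [Fact p.Prime], (p : ℝ) ^ (144000 / (n : ℝ) ^ 2) ≤ N → ∀ a : ZMod p,
    (0 : ZMod p) ∉ interval p a N →
      IsSpread n ((p : ℝ) ^ (-(5 / n) : ℝ)) (unifOn (invInterval p a N)) := by
  choose N₁ hN₁ using fun j : ℕ => iterate_diffLaw_unifOn_invInterval_le (j := j)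
  refine ⟨max 2 ((Finset.range (n + 1)).sup N₁), fun N hN p hpF hpN a ha => ?_⟩
  have hN2 : 2 ≤ N := (le_max_left _ _).trans hN
  have hNlt := lt_of_zero_notMem_interval ha
  have hNpos : (0 : ℝ) < N := by exact_mod_cast (by omega : 0 < N)
  have hppos : (0 : ℝ) < p := by exact_mod_cast (by omega : 0 < p)
  have hn0 : (0 : ℝ) < n := by exact_mod_cast (by omega : 0 < n)
  have hn50 : (50 : ℝ) ≤ n := by exact_mod_cast hn
  have hQ : (invInterval p a N).Nonempty := by
    rw [← Finset.card_pos, card_invInterval hNlt]; omega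
  have hprob := isProb_unifOn hQ
  refine ⟨hprob, fun z => ?_⟩
  set x := Real.log N with hx
  set y := Real.log p with hy
  have hx0 : 0 < x := Real.log_pos (by exact_mod_cast (by omega : 1 < N))
  have hxy : x ≤ y := Real.log_le_log hNpos (by exact_mod_cast hNlt.le)
  have hy0 : 0 < y := hx0.trans_le hxy
  have hCx : 144000 * y ≤ n ^ 2 * x := by
    have := Real.log_le_log (by positivity) hpN
    rw [Real.log_rpow hppos, div_mul_eq_mul_div, div_le_iff₀ (by positivity)] at this
    linarith
  suffices hsuff : ∃ j ≤ n, ∀ z, diffLaw^[j] (unifOn (invInterval p a N)) z ≤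
      (p : ℝ) ^ (-(5 / n) : ℝ) by
    obtain ⟨j, hj, hjz⟩ := hsuff
    have := (hprob.iterate_diffLaw j).iterate_diffLaw_le hjz (n - j) z
    rwa [← Function.iterate_add_apply, Nat.sub_add_cancel hj] at this
  by_cases h10 : N ^ (10 * (2 ^ 0) ^ 2) < p
  swap
  · refine ⟨0, Nat.zero_le _, fun z => ?_⟩
    have h1 : unifOn (invInterval p a N) z ≤ (N : ℝ)⁻¹ := by
      rw [unifOn, card_invInterval hNlt]
      split_ifs
      · exact le_rfl
      · positivity
    refine h1.trans ?_
    have h2 : y ≤ 10 * x := by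
      have : (p : ℝ) ≤ (N : ℝ) ^ 10 := by
        have : p ≤ N ^ 10 := by simpa using h10
        exact_mod_cast this
      have := Real.log_le_log hppos this
      rwa [Real.log_pow] at this
    rw [← Real.exp_log hNpos, ← Real.exp_neg, Real.rpow_def_of_pos hppos]
    apply Real.exp_le_exp.2
    have : 5 / n * y ≤ x := by
      rw [div_mul_eq_mul_div, div_le_iff₀ hn0]
      nlinarith
    linarith
  set j := Nat.findGreatest (fun j => N ^ (10 * (2 ^ j) ^ 2) < p) n with hj
  have hjp : N ^ (10 * (2 ^ j) ^ 2) < p :=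
    Nat.findGreatest_spec (P := fun j => N ^ (10 * (2 ^ j) ^ 2) < p) (Nat.zero_le n) h10
  have hlog : ∀ k : ℕ, p ≤ N ^ k → y ≤ k * x := by
    intro k hk
    have := Real.log_le_log hppos (show (p : ℝ) ≤ (N : ℝ) ^ k by exact_mod_cast hk)
    rwa [Real.log_pow] at this
  have hlog' : ∀ k : ℕ, N ^ k < p → k * x ≤ y := by
    intro k hk
    have := Real.log_le_log (by positivity) (show (N : ℝ) ^ k ≤ (p : ℝ) by exact_mod_cast hk.le)
    rwa [Real.log_pow] at this
  have hjn : j < n := by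
    refine lt_of_le_of_ne (Nat.findGreatest_le n) fun hjn => ?_
    rw [hjn] at hjp
    have h1 := hlog' _ hjp
    have h2 : (n : ℝ) ≤ 2 ^ n := by exact_mod_cast Nat.lt_two_pow_self.le
    push_cast at h1
    have h3 : (n : ℝ) ^ 2 ≤ (2 ^ n) ^ 2 := by gcongr
    nlinarith
  have hj1 : p ≤ N ^ (10 * (2 ^ (j + 1)) ^ 2) := by
    have := Nat.findGreatest_is_greatest (P := fun j => N ^ (10 * (2 ^ j) ^ 2) < p) (n := n)
      (k := j + 1) (Nat.lt_succ_self j) hjn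
    simpa using this
  refine ⟨j, hjn.le, fun z => ?_⟩
  have hNj : N₁ j ≤ N := (Finset.le_sup (f := N₁) (Finset.mem_range.2 (by omega))).trans
    ((le_max_right _ _).trans hN)
  refine (hN₁ j N hNj p hjp a ha z).trans ?_
  rw [Real.rpow_def_of_pos hNpos, Real.rpow_def_of_pos hppos]
  apply Real.exp_le_exp.2
  have h1 := hlog _ hj1
  push_cast at h1
  rw [pow_succ (2:ℝ) j] at h1
  set t : ℝ := 2 ^ j with ht
  have ht0 : 0 < t := by positivity
  have h2 : 60 * y ≤ t * n * x := by
    by_contra! hlt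
    have h3 : (t * n * x) ^ 2 < (60 * y) ^ 2 := pow_lt_pow_left₀ hlt (by positivity) (by norm_num)
    have h4 : (144000 * y) * y ≤ (n ^ 2 * x) * (10 * (t * 2) ^ 2 * x) := by gcongr
    nlinarith
  have h3 : 5 / n * y ≤ t / 12 * x := by
    rw [div_mul_eq_mul_div, div_le_iff₀ hn0]
    linarith
  linarith

end ReciprocalLaw

section KloostermanSum

lemma ep_eq_stdAddChar {p : ℕ} [NeZero p] (z : ZMod p) : ep p z = ZMod.stdAddChar z := by
  have h := ZMod.stdAddChar_coe (N := p) (z.val : ℤ)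
  rw [Int.cast_natCast, ZMod.natCast_zmod_val] at h
  rw [h, ep, Int.cast_natCast]

lemma ft_cfold_ofFn {p : ℕ} [Fact p.Prime] {n : ℕ} (w : Fin n → ZMod p → ℂ) (c : ZMod p) :
    ft (cfold (List.ofFn w) (Pi.single 1 1)) c =
      ∑ y : Fin n → ZMod p, (∏ i, w i (y i)) * ZMod.stdAddChar (c * ∏ i, y i) := by
  induction n generalizing c with
  | zero =>
    simp [cfold, ft, Pi.single_apply]
  | succ n ih =>
    have h : cfold (List.ofFn w) (Pi.single 1 1) =
        cconv (w 0) (cfold (List.ofFn fun i => w (Fin.succ i)) (Pi.single 1 1)) := by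
      rw [List.ofFn_succ]; rfl
    rw [h, ft_cconv, ← (Fin.consEquiv fun _ => ZMod p).sum_comp, Fintype.sum_prod_type]
    refine Finset.sum_congr rfl fun x _ => ?_
    rw [ih, Finset.mul_sum]
    refine Finset.sum_congr rfl fun y _ => ?_
    simp [Fin.prod_univ_succ, Fin.consEquiv, mul_assoc]

lemma sum_piFinset_div_eq_ft {p : ℕ} [Fact p.Prime] {n N : ℕ}
    (I : Fin n → Finset (ZMod p)) (α : Fin n → ZMod p → ℂ) (b : ZMod p) :
    (∑ x ∈ Fintype.piFinset I, (∏ i, α i (x i)) * ep p (b * ∏ i, (x i)⁻¹)) / (N : ℂ) ^ n =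
      ft (cfold (List.ofFn fun i y => if y⁻¹ ∈ I i then α i y⁻¹ / N else 0) (Pi.single 1 1)) b := by
  rw [ft_cfold_ofFn, ← Equiv.sum_comp (Equiv.inv (Fin n → ZMod p)), Finset.sum_div]
  rw [← Finset.sum_subset (Finset.subset_univ (Fintype.piFinset I))]
  · refine Finset.sum_congr rfl fun x hx => ?_
    rw [Fintype.mem_piFinset] at hx
    simp [hx, Finset.prod_div_distrib, ep_eq_stdAddChar, div_mul_eq_mul_div]
  · intro x _ hx
    rw [Fintype.mem_piFinset, not_forall] at hx
    obtain ⟨i, hi⟩ := hx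
    rw [Finset.prod_eq_zero (Finset.mem_univ i) (by simp [hi]), zero_mul]

lemma List.exists_eq_cons_append_cons {X : Type*} {L : List X} {m k : ℕ}
    (hL : L.length = m + k + 2) :
    ∃ x A y B, L = x :: (A ++ y :: B) ∧ A.length = m ∧ B.length = k := by
  match L, hL with
  | x :: T, hL =>
    have hT : T.length = m + k + 1 := by simpa using hL
    have hlen : (T.drop m).length = k + 1 := by rw [List.length_drop]; omega
    obtain ⟨y, B, hB⟩ := List.exists_cons_of_length_eq_add_one hlen
    refine ⟨x, T.take m, y, B, ?_, by simp; omega, ?_⟩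
    · rw [← hB, List.take_append_drop]
    · rw [hB] at hlen; simpa using hlen

lemma exists_flattening_parameters {n : ℕ} (hn : 20 ≤ n) :
    ∃ r : ℕ, ∃ p₀ : ℕ, ∀ p : ℕ, ∀ _ : Fact p.Prime, p₀ ≤ p → ∃ τ : ℝ, 2 ≤ τ ∧ (p : ℝ) = τ ^ (100 * n) ∧
      Flattens p r (τ ^ 500)⁻¹ (τ ^ (55 * n))⁻¹ (τ ^ 200) := by
  set E : ℕ := 2 * (100 * n * (6 + (2 * (100 * n) + 1)) + 2) + 1 with hE
  set t₀ : ℕ := 2 * (E * (100 * n)) + 1 with ht₀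
  clear_value E t₀
  have hE0 : E ≠ 0 := by omega
  have ht0 : t₀ ≠ 0 := by omega
  set m : ℕ := 8 * t₀ * E * (100 * n) with hm
  have hm0 : m ≠ 0 := by positivity
  refine ⟨8 * t₀ * (200 * E), 2 ^ m, fun p _ hp => ?_⟩
  set κ : ℝ := (p : ℝ) ^ ((m : ℝ)⁻¹) with hκdef
  have hκm : κ ^ m = p := Real.rpow_inv_natCast_pow (by positivity) hm0
  have hκ : 2 ≤ κ := by
    refine le_of_pow_le_pow_left₀ hm0 (by positivity) ?_
    rw [hκm]; exact_mod_cast hp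
  have hpτ : (p : ℝ) = ((κ ^ (8 * t₀)) ^ E) ^ (100 * n) := by
    rw [← pow_mul, ← pow_mul, ← hκm, hm, mul_assoc (8 * t₀)]
  refine ⟨(κ ^ (8 * t₀)) ^ E, ?_, hpτ, ?_⟩
  · rw [← pow_mul]
    exact hκ.trans (le_self_pow₀ (by linarith) (by positivity))
  · intro ν π hν hπ hν0 hπ0 hπS
    exact sum_sq_iterate_diffLaw_mconv_le hκ hn hE.ge ht₀ rfl hpτ hν hπ hν0 hπ0 hπS

lemma Flattens.norm_ft_lt {p : ℕ} [Fact p.Prime] {n r s : ℕ} (hn : 2 ≤ n) (hs : 1 ≤ s) {τ : ℝ}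
    (hτ : 2 ≤ τ) (hp : (p : ℝ) = τ ^ (100 * n))
    (hFL : Flattens p r (τ ^ 500)⁻¹ (τ ^ (55 * n))⁻¹ (τ ^ 200))
    {l : Fin n → ZMod p → ℝ} (hl : ∀ i, IsSpread s (τ ^ 500)⁻¹ (l i))
    {w : Fin n → ZMod p → ℂ} (hw : ∀ i x, ‖w i x‖ ≤ l i x) {b : ZMod p} (hb : b ≠ 0)
    {β : ℝ} (hβ0 : 0 ≤ β) (hβ1 : β ≤ 1 / 2) (hβ : β ^ (2 ^ (s + 1 + r)) ^ n = τ⁻¹) :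
    ‖ft (cfold (List.ofFn w) (Pi.single 1 1)) b‖ < β := by
  by_contra! h
  obtain ⟨l₁, L₁, l₂, L₂, hL, hlen₁, hlen₂⟩ := List.exists_eq_cons_append_cons (L := List.ofFn l)
    (m := n / 2 - 1) (k := n - n / 2 - 1) (by rw [List.length_ofFn]; omega)
  have hlen : L₁.length + L₂.length + 2 = n := by omega
  have hmem : ∀ l' ∈ l₁ :: (L₁ ++ l₂ :: L₂), IsSpread s (τ ^ 500)⁻¹ l' := by
    rw [← hL]
    intro l' hl'
    obtain ⟨i, rfl⟩ := (List.mem_ofFn' _ _).1 hl'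
    exact hl i
  have hforall : List.Forall₂ (fun (w : ZMod p → ℂ) l => ∀ x, ‖w x‖ ≤ l x) (List.ofFn w)
      (l₁ :: (L₁ ++ l₂ :: L₂)) := by
    rw [← hL, List.forall₂_iff_get]
    refine ⟨by simp, fun i h₁ h₂ x => ?_⟩
    simpa using hw _ x
  have hτ0 : 0 < τ := by linarith
  have hτ1 : 1 ≤ τ := by linarith
  have hmax : ∀ k, n ≤ 2 * k + 1 → max (τ ^ (55 * n))⁻¹ ((τ ^ 200) ^ k)⁻¹ ≤ (τ ^ (55 * n))⁻¹ := by
    intro k hk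
    refine max_le le_rfl ?_
    rw [← pow_mul]
    exact inv_anti₀ (by positivity) (pow_le_pow_right₀ hτ1 (by omega))
  refine hFL.false_of_le_norm hs (by positivity) (by positivity) (one_le_pow₀ hτ1)
    (hmem l₁ (by simp)) (hmem l₂ (by simp)) (fun l' h => hmem l' (by simp [h]))
    (fun l' h => hmem l' (by simp [h])) hforall hb hβ0 hβ1 ?_ ?_ h
  · rw [hlen, hβ, ← div_eq_mul_inv, ← one_div, div_le_div_iff₀ (by positivity) hτ0]
    calc 2 * τ ≤ τ * τ := by gcongr
      _ = τ ^ 2 := by ring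
      _ ≤ τ ^ 500 := pow_le_pow_right₀ hτ1 (by norm_num)
      _ = 1 * τ ^ 500 := by ring
  · rw [hlen, hβ]
    calc _ ≤ (τ ^ (55 * n))⁻¹ * (τ ^ (55 * n))⁻¹ * p := by
          gcongr
          · exact hmax _ (by omega)
          · exact hmax _ (by omega)
      _ = (τ ^ (10 * n))⁻¹ := by
          rw [hp, ← mul_inv, ← pow_add, inv_mul_eq_iff_eq_mul₀ (by positivity),
            ← div_eq_mul_inv, eq_div_iff (by positivity), ← pow_add]
          congr 1; ring
      _ < (τ⁻¹) ^ 2 := by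
          rw [inv_pow]
          gcongr
          · linarith
          · omega

end KloostermanSum

/-- there is an absolute `C > 0` such that for every `n ≥ 1` there are
`δ = δ(n) > 0` and `p_0 = p_0(n)` such that multilinear Kloosterman sums in `n` variables
over intervals of length `N > p^{C/n²}` admit a power saving `p^{−δ} N^n`. -/
theorem stmt_13 :
    ∃ C : ℝ, 0 < C ∧
      ∀ n : ℕ, 0 < n →
        ∃ δ : ℝ, 0 < δ ∧ ∃ p0 : ℕ, ∀ p : ℕ, p.Prime → p0 ≤ p →
          ∀ N : ℕ, 0 < N → (p : ℝ) ^ (C / (n : ℝ) ^ 2) < (N : ℝ) →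
            ∀ a : Fin n → ZMod p,
              (∀ i, (0 : ZMod p) ∉ interval p (a i) N) →
              ∀ α : Fin n → ZMod p → ℂ,
                (∀ i, ∀ x ∈ interval p (a i) N, ‖α i x‖ ≤ 1) →
                ∀ b : ZMod p, b ≠ 0 →
                  ‖∑ x ∈ Fintype.piFinset (fun i => interval p (a i) N),
                      (∏ i, α i (x i)) * ep p (b * ∏ i, (x i)⁻¹)‖ <
                    (p : ℝ) ^ (-δ) * (N : ℝ) ^ n := by
  refine ⟨144000, by norm_num, fun n hn => ?_⟩
  rcases lt_or_ge n 50 with hsmall | hn50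
  · refine ⟨1, one_pos, 0, fun p hp _ N _ hNp a ha => ?_⟩
    have : Fact p.Prime := ⟨hp⟩
    have hlt := lt_of_zero_notMem_interval (ha ⟨0, hn⟩)
    have hle : (p : ℝ) ≤ (p : ℝ) ^ ((144000 : ℝ) / (n : ℝ) ^ 2) := by
      refine Real.self_le_rpow_of_one_le (by exact_mod_cast hp.one_lt.le) ?_
      rw [one_le_div (by positivity)]
      have : (n : ℝ) ≤ 50 := by exact_mod_cast hsmall.le
      nlinarith [(n.cast_nonneg : (0 : ℝ) ≤ n)]
    have : (p : ℝ) < N := hle.trans_lt hNp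
    exact absurd (by exact_mod_cast this) hlt.le.not_gt
  · obtain ⟨r, p₁, hflat⟩ := exists_flattening_parameters (n := n) (by omega)
    obtain ⟨N₀, hspread⟩ := exists_isSpread_unifOn_invInterval n hn50
    set D : ℕ := 2 ^ (n + 1 + r) with hD
    set G : ℕ := 100 * n * D ^ n with hG
    have hG0 : G ≠ 0 := by positivity
    refine ⟨(G : ℝ)⁻¹, by positivity, max p₁ (max (2 ^ G) (N₀ ^ n ^ 2)), ?_⟩
    intro p hp hp0 N hN hNp a ha α hα b hb
    have : Fact p.Prime := ⟨hp⟩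
    have hp1 : (1 : ℝ) ≤ p := by exact_mod_cast hp.one_lt.le
    have hn0 : (0 : ℝ) < n := by exact_mod_cast hn
    obtain ⟨τ, hτ, hpτ, hFL⟩ := hflat p this ((le_max_left _ _).trans hp0)
    set γ : ℝ := (p : ℝ) ^ ((G : ℝ)⁻¹) with hγdef
    have hγG : γ ^ G = p := Real.rpow_inv_natCast_pow (by positivity) hG0
    have hγ : 2 ≤ γ := by
      refine le_of_pow_le_pow_left₀ hG0 (by positivity) ?_
      rw [hγG]
      exact_mod_cast ((le_max_left _ _).trans (le_max_right _ _)).trans hp0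
    have hγτ : γ ^ D ^ n = τ := by
      refine (pow_left_inj₀ (by positivity) (by positivity)
        (show 100 * n ≠ 0 by positivity)).1 ?_
      rw [← pow_mul, ← hpτ, ← hγG, hG, mul_comm]
    have hNN₀ : N₀ ≤ N := by
      have h1 : ((N₀ ^ n ^ 2 : ℕ) : ℝ) ≤ p := by
        exact_mod_cast ((le_max_right _ _).trans (le_max_right _ _)).trans hp0
      have h2 : (p : ℝ) ≤ (N : ℝ) ^ n ^ 2 := by
        calc (p : ℝ) ≤ (p : ℝ) ^ (144000 : ℝ) := Real.self_le_rpow_of_one_le hp1 (by norm_num)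
          _ = ((p : ℝ) ^ ((144000 : ℝ) / (n : ℝ) ^ 2)) ^ n ^ 2 := by
              rw [← Real.rpow_mul_natCast (by positivity)]
              congr 1
              push_cast
              field_simp
          _ ≤ (N : ℝ) ^ n ^ 2 := by gcongr
      have h3 : N₀ ^ n ^ 2 ≤ N ^ n ^ 2 := by exact_mod_cast h1.trans h2
      exact le_of_pow_le_pow_left₀ (by positivity) (by positivity) h3
    have hP : (p : ℝ) ^ (-(5 / n) : ℝ) = (τ ^ 500)⁻¹ := by
      rw [hpτ, Real.rpow_neg (by positivity), ← Real.rpow_natCast τ (100 * n),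
        ← Real.rpow_mul (by positivity), ← Real.rpow_natCast τ 500]
      congr 2
      push_cast
      field_simp
      norm_num
    have hlt := Flattens.norm_ft_lt (s := n) (by omega) (by omega) hτ hpτ hFL
      (l := fun i => unifOn (invInterval p (a i) N))
      (fun i => hP ▸ hspread N hNN₀ p hNp.le (a i) (ha i))
      (w := fun i y => if y⁻¹ ∈ interval p (a i) N then α i y⁻¹ / N else 0) (fun i x => by
        have hmem : x ∈ invInterval p (a i) N ↔ x⁻¹ ∈ interval p (a i) N := by
          rw [invInterval, Finset.mem_image]
          exact ⟨fun ⟨y, hy, h⟩ => by rwa [← h, inv_inv], fun h => ⟨_, h, inv_inv x⟩⟩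
        rw [unifOn, card_invInterval (lt_of_zero_notMem_interval (ha i))]
        by_cases hx : x⁻¹ ∈ interval p (a i) N
        · rw [if_pos hx, if_pos (hmem.2 hx), norm_div, Complex.norm_natCast, inv_eq_one_div (N : ℝ)]
          gcongr
          exact hα i _ hx
        · rw [if_neg hx, if_neg (mt hmem.1 hx), norm_zero]) hb (β := γ⁻¹) (by positivity)
      (by rw [one_div]; gcongr) (by rw [inv_pow, hγτ])
    rw [← sum_piFinset_div_eq_ft, norm_div, norm_pow, Complex.norm_natCast,
      div_lt_iff₀ (by positivity)] at hlt
    rwa [Real.rpow_neg (by positivity)]
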